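/- Let (T^s, ν^s) and (T^u, ν^u) be a transverse pair of measured turbulations on Σ such that there is a countable collection R_i of compatible tartans, each of which is stable bi-Lipschitz regular, with μ(⋃_i R_i^⋔) = 1. Then for every non-empty open subset U of Σ there is a positive measure compatible tartan all of whose fibers are contained in U; hence the pair of turbulations is full. -/

import Mathlib

open MeasureTheory Set Function Topology Filter
open scoped ENNReal

noncomputable section

variable {S : Type} [TopologicalSpace S] [MeasurableSpace S]

/-- `d` is (the distance function of) a metric on `S` compatible with its topology. -/
def IsCompatibleMetric (S : Type) [TopologicalSpace S] (d : S → S → ℝ) : Prop :=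
  (∀ x y, d x y = d y x) ∧ (∀ x y, d x y = 0 ↔ x = y) ∧
  (∀ x y z, d x z ≤ d x y + d y z) ∧
  (∀ s : Set S, IsOpen s ↔ ∀ x ∈ s, ∃ ε > (0 : ℝ), ∀ y, d x y < ε → y ∈ s)

/-- An immersed line: a continuous injective image of `ℝ`. -/
def IsImmersedLine (ℓ : Set S) : Prop :=
  ∃ f : ℝ → S, Continuous f ∧ Function.Injective f ∧ Set.range f = ℓ

/-- `A` is a closed stream arc of the immersed line `ℓ` with endpoints `x` and `y`. -/
def IsArcIn (ℓ A : Set S) (x y : S) : Prop :=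
  ∃ f : ℝ → S, Continuous f ∧ Function.Injective f ∧ Set.range f = ℓ ∧
    ∃ a b : ℝ, a ≤ b ∧ f a = x ∧ f b = y ∧ A = f '' Set.Icc a b

/-- `A` is a closed stream arc of the immersed line `ℓ`. -/
def IsArc (ℓ A : Set S) : Prop := ∃ x y, IsArcIn ℓ A x y

/-- Topological transversality of two immersed lines at a point `x`: local pieces (arcs) of the
two lines through `x` are, in some chart around `x`, the two coordinate axes. -/
def TransverseAt (ℓ ℓ' : Set S) (x : S) : Prop :=
  ∃ α β : Set S, x ∈ α ∧ x ∈ β ∧ IsArc ℓ α ∧ IsArc ℓ' β ∧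
    ∃ U : Set S, IsOpen U ∧ x ∈ U ∧ ∃ e : U ≃ₜ ℝ × ℝ,
      Subtype.val '' (⇑e ⁻¹' {p : ℝ × ℝ | p.2 = 0}) = α ∩ U ∧
      Subtype.val '' (⇑e ⁻¹' {p : ℝ × ℝ | p.1 = 0}) = β ∩ U

/-- The (manifold) boundary of the surface `S`: points having no neighbourhood
homeomorphic to the plane. -/
def ManifoldBdry (S : Type) [TopologicalSpace S] : Set S :=
  {x : S | ¬ ∃ U : Set S, IsOpen U ∧ x ∈ U ∧ Nonempty (U ≃ₜ ℝ × ℝ)}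

/-- An Oxtoby–Ulam (OU) measure on the compact surface `S`: Borel (via the ambient
`BorelSpace` assumption), non-atomic, positive on non-empty open sets, and vanishing on
the boundary of `S`. -/
structure IsOUMeasure (μ : Measure S) : Prop where
  noAtoms : ∀ x : S, μ {x} = 0
  openPos : ∀ U : Set S, IsOpen U → U.Nonempty → 0 < μ U
  boundaryNull : μ (ManifoldBdry S) = 0

/-- A measured turbulation on `S` (with ambient measure `μ`): a partition of a full
`μ`-measure Borel subset of `S` into streamlines (immersed lines), together with an
OU measure on each streamline which is finite on closed stream arcs. -/
structure MeasuredTurbulation (μ : Measure S) where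
  lines : Set (Set S)
  lines_immersed : ∀ ℓ ∈ lines, IsImmersedLine ℓ
  lines_disjoint : lines.PairwiseDisjoint id
  domain_borel : MeasurableSet (⋃₀ lines)
  domain_full : μ (⋃₀ lines) = 1
  ν : Set S → Measure S
  ν_supported : ∀ ℓ ∈ lines, ν ℓ ℓᶜ = 0
  ν_nonatomic : ∀ ℓ ∈ lines, ∀ x : S, ν ℓ {x} = 0
  ν_arc_pos : ∀ ℓ ∈ lines, ∀ A : Set S, ∀ x y : S, IsArcIn ℓ A x y → x ≠ y → 0 < ν ℓ A
  ν_arc_finite : ∀ ℓ ∈ lines, ∀ A : Set S, ∀ x y : S, IsArcIn ℓ A x y → ν ℓ A < ⊤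

namespace MeasuredTurbulation

variable {μ : Measure S}

/-- Tameness with respect to a given metric `d`: stream arcs of small stream measure are small. -/
def TameWith (T : MeasuredTurbulation μ) (d : S → S → ℝ) : Prop :=
  ∀ ε : ℝ, 0 < ε → ∃ δ : ℝ, 0 < δ ∧
    ∀ ℓ ∈ T.lines, ∀ A : Set S, ∀ x y : S,
      IsArcIn ℓ A x y → T.ν ℓ A < ENNReal.ofReal δ → d x y < ε

/-- A measured turbulation is tame if it is tame with respect to (every, equivalently some)
metric on `S` compatible with its topology. -/
def Tame (T : MeasuredTurbulation μ) : Prop :=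
  ∀ d : S → S → ℝ, IsCompatibleMetric S d → T.TameWith d

/-- Every streamline is dense in `S`. -/
def DenseStreamlines (T : MeasuredTurbulation μ) : Prop := ∀ ℓ ∈ T.lines, Dense ℓ

/-- Two measured turbulations are transverse if almost every point lies on streamlines of both
which intersect transversely there. -/
def TransversePair (Ts Tu : MeasuredTurbulation μ) : Prop :=
  ∃ W : Set S, MeasurableSet W ∧ μ W = 1 ∧
    ∀ x ∈ W, ∃ ℓ ∈ Ts.lines, ∃ ℓ' ∈ Tu.lines, x ∈ ℓ ∧ x ∈ ℓ' ∧ TransverseAt ℓ ℓ' x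

end MeasuredTurbulation

/-- A tartan for the (stable, unstable) pair of measured turbulations `(Ts, Tu)`. -/
structure Tartan {μ : Measure S} (Ts Tu : MeasuredTurbulation μ) where
  Rs : Set S
  Ru : Set S
  borel_s : MeasurableSet Rs
  borel_u : MeasurableSet Ru
  fibs : Set (Set S)
  fibu : Set (Set S)
  fibs_disjoint : fibs.PairwiseDisjoint id
  fibu_disjoint : fibu.PairwiseDisjoint id
  fibs_cover : ⋃₀ fibs = Rs
  fibu_cover : ⋃₀ fibu = Ru
  /-- (a) every stable fiber meets every unstable fiber in exactly one point. -/
  inter_unique : ∀ A ∈ fibs, ∀ B ∈ fibu, ∃! z : S, z ∈ A ∩ B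
  /-- The fibers are stream arcs of the corresponding turbulations, and (b) they can be
  oriented consistently: every stable fiber crosses the unstable fibers in the same order,
  and vice versa. -/
  oriented : ∃ ords ordu : Set S → S → S → Prop,
    (∀ A ∈ fibs, ∃ ℓ ∈ Ts.lines, ∃ f : ℝ → S, Continuous f ∧ Function.Injective f ∧
        Set.range f = ℓ ∧ ∃ a b : ℝ, a ≤ b ∧ A = f '' Set.Icc a b ∧
        ∀ s ∈ Set.Icc a b, ∀ t ∈ Set.Icc a b, (ords A (f s) (f t) ↔ s ≤ t)) ∧
    (∀ B ∈ fibu, ∃ ℓ ∈ Tu.lines, ∃ f : ℝ → S, Continuous f ∧ Function.Injective f ∧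
        Set.range f = ℓ ∧ ∃ a b : ℝ, a ≤ b ∧ B = f '' Set.Icc a b ∧
        ∀ s ∈ Set.Icc a b, ∀ t ∈ Set.Icc a b, (ordu B (f s) (f t) ↔ s ≤ t)) ∧
    (∀ A ∈ fibs, ∀ A' ∈ fibs, ∀ B ∈ fibu, ∀ B' ∈ fibu,
      ∀ p ∈ A ∩ B, ∀ q ∈ A ∩ B', ∀ p' ∈ A' ∩ B, ∀ q' ∈ A' ∩ B',
        (ords A p q ↔ ords A' p' q')) ∧
    (∀ B ∈ fibu, ∀ B' ∈ fibu, ∀ A ∈ fibs, ∀ A' ∈ fibs,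
      ∀ p ∈ B ∩ A, ∀ q ∈ B ∩ A', ∀ p' ∈ B' ∩ A, ∀ q' ∈ B' ∩ A',
        (ordu B p q ↔ ordu B' p' q'))
  /-- (c) the stream measures of the fibers are bounded above. -/
  bounded : ∃ L : ℝ≥0∞, L < ⊤ ∧
    (∀ A ∈ fibs, ∀ ℓ ∈ Ts.lines, A ⊆ ℓ → Ts.ν ℓ A ≤ L) ∧
    (∀ B ∈ fibu, ∀ ℓ ∈ Tu.lines, B ⊆ ℓ → Tu.ν ℓ B ≤ L)
  /-- (d) `Rs ∪ Ru` is contained in an open topological disk. -/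
  in_disk : ∃ U : Set S, IsOpen U ∧ Rs ∪ Ru ⊆ U ∧ Nonempty (U ≃ₜ ℝ × ℝ)

namespace Tartan

variable {μ : Measure S} {Ts Tu : MeasuredTurbulation μ}

/-- The set `R^⋔` of tartan intersection points. -/
def core (R : Tartan Ts Tu) : Set S := R.Rs ∩ R.Ru

/-- The tartan `R` is compatible with the ambient measure `μ`: for all stable and unstable
fibers `𝔰`, `𝔲`, the bijection `ψ : E^𝔰 × E^𝔲 → R^⋔`, `(x, y) ↦ 𝔲(x) ⋔ 𝔰(y)`, is
bi-measurable and pushes `ν_𝔰 × ν_𝔲` forward to `μ` restricted to `R^⋔`. -/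
def Compatible (R : Tartan Ts Tu) : Prop :=
  ∀ 𝔰 ∈ R.fibs, ∀ 𝔲 ∈ R.fibu,
  ∀ ℓs ∈ Ts.lines, 𝔰 ⊆ ℓs → ∀ ℓu ∈ Tu.lines, 𝔲 ⊆ ℓu →
  ∃ ψ : S × S → S,
    (∀ x ∈ 𝔰 ∩ R.core, ∀ y ∈ 𝔲 ∩ R.core,
      ∀ B ∈ R.fibu, x ∈ B → ∀ A ∈ R.fibs, y ∈ A → ψ (x, y) ∈ B ∩ A) ∧
    Set.InjOn ψ ((𝔰 ∩ R.core) ×ˢ (𝔲 ∩ R.core)) ∧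
    ψ '' ((𝔰 ∩ R.core) ×ˢ (𝔲 ∩ R.core)) = R.core ∧
    Measurable ψ ∧
    (∀ E : Set (S × S), E ⊆ (𝔰 ∩ R.core) ×ˢ (𝔲 ∩ R.core) → MeasurableSet E →
      MeasurableSet (ψ '' E)) ∧
    Measure.map ψ (((Ts.ν ℓs).restrict (𝔰 ∩ R.core)).prod
      ((Tu.ν ℓu).restrict (𝔲 ∩ R.core))) = μ.restrict R.core

/-- Image of `B ⊆ E^𝔰` under the holonomy map `h_{𝔰,𝔰'} : E^𝔰 → E^{𝔰'}`, `x ↦ 𝔲(x) ⋔ 𝔰'`. -/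
def holSS (R : Tartan Ts Tu) (𝔰' B : Set S) : Set S :=
  {x' : S | ∃ x ∈ B, ∃ Bu ∈ R.fibu, x ∈ Bu ∧ x' ∈ Bu ∩ 𝔰'}

/-- Image of `B ⊆ E^𝔲` under the holonomy map `h_{𝔲,𝔲'} : E^𝔲 → E^{𝔲'}`, `y ↦ 𝔰(y) ⋔ 𝔲'`. -/
def holUU (R : Tartan Ts Tu) (𝔲' B : Set S) : Set S :=
  {y' : S | ∃ y ∈ B, ∃ A ∈ R.fibs, y ∈ A ∧ y' ∈ A ∩ 𝔲'}

/-- "`𝔲(x) ⋔ 𝔰(y) ∈ A`": the intersection point of the unstable fiber through `x` and the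
stable fiber through `y` belongs to `A`. -/
def sectMem (R : Tartan Ts Tu) (A : Set S) (x y : S) : Prop :=
  ∃ B ∈ R.fibu, x ∈ B ∧ ∃ C ∈ R.fibs, y ∈ C ∧ ∃ z ∈ B ∩ C, z ∈ A

/-- `ν_{𝔲(x)}(A ∩ 𝔲(x))`: the stream measure of `A` along the unstable fiber through `x`. -/
def fiberMeasU (R : Tartan Ts Tu) (A : Set S) (x : S) : ℝ≥0∞ :=
  ⨆ (B : Set S) (_ : B ∈ R.fibu) (_ : x ∈ B) (ℓ : Set S) (_ : ℓ ∈ Tu.lines) (_ : B ⊆ ℓ),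
    Tu.ν ℓ (A ∩ B)

/-- `ν_{𝔰(y)}(A ∩ 𝔰(y))`: the stream measure of `A` along the stable fiber through `y`. -/
def fiberMeasS (R : Tartan Ts Tu) (A : Set S) (y : S) : ℝ≥0∞ :=
  ⨆ (C : Set S) (_ : C ∈ R.fibs) (_ : y ∈ C) (ℓ : Set S) (_ : ℓ ∈ Ts.lines) (_ : C ⊆ ℓ),
    Ts.ν ℓ (A ∩ C)

end Tartan

/-- The union of the stable streamlines containing fibers of `R`. -/
def stableSaturation {μ : Measure S} {Ts Tu : MeasuredTurbulation μ} (R : Tartan Ts Tu) :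
    Set S :=
  ⋃₀ {ℓ : Set S | ℓ ∈ Ts.lines ∧ ∃ A ∈ R.fibs, A ⊆ ℓ}

/-- The union of the unstable streamlines containing fibers of `R`. -/
def unstableSaturation {μ : Measure S} {Ts Tu : MeasuredTurbulation μ} (R : Tartan Ts Tu) :
    Set S :=
  ⋃₀ {ℓ : Set S | ℓ ∈ Tu.lines ∧ ∃ B ∈ R.fibu, B ⊆ ℓ}

/-- The pair `(Ts, Tu)` is full: countably many compatible tartans cover a full measure
subset of `S`, and every non-empty open set contains a positive measure compatible tartan. -/
def FullPair {μ : Measure S} (Ts Tu : MeasuredTurbulation μ) : Prop :=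
  (∃ R : ℕ → Tartan Ts Tu, (∀ i, (R i).Compatible) ∧ μ (⋃ i, (R i).core) = 1) ∧
  (∀ U : Set S, IsOpen U → U.Nonempty →
    ∃ R : Tartan Ts Tu, R.Compatible ∧ 0 < μ R.core ∧ R.Rs ∪ R.Ru ⊆ U)

/-- `(Ts, Tu)` are measurable pseudo-Anosov turbulations: transverse, tame, full, with
dense streamlines. -/
def MPATurbulations {μ : Measure S} (Ts Tu : MeasuredTurbulation μ) : Prop :=
  Ts.TransversePair Tu ∧ Ts.Tame ∧ Tu.Tame ∧ FullPair Ts Tu ∧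
    Ts.DenseStreamlines ∧ Tu.DenseStreamlines

/-- `F` is a measurable pseudo-Anosov homeomorphism with invariant turbulations `(Ts, Tu)`
and dilatation `lam > 1`. -/
structure IsMPA (μ : Measure S) (F : S ≃ₜ S) (Ts Tu : MeasuredTurbulation μ)
    (lam : ℝ) : Prop where
  measurePreserving : MeasurePreserving (⇑F) μ μ
  one_lt_lam : 1 < lam
  turbulations : MPATurbulations Ts Tu
  stable_image : ∀ ℓ ∈ Ts.lines, ⇑F '' ℓ ∈ Ts.lines
  unstable_image : ∀ ℓ ∈ Tu.lines, ⇑F '' ℓ ∈ Tu.lines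
  stable_contract : ∀ ℓ ∈ Ts.lines, ∀ A : Set S, ∀ x y : S, IsArcIn ℓ A x y →
    Ts.ν (⇑F '' ℓ) (⇑F '' A) = (ENNReal.ofReal lam)⁻¹ * Ts.ν ℓ A
  unstable_expand : ∀ ℓ ∈ Tu.lines, ∀ A : Set S, ∀ x y : S, IsArcIn ℓ A x y →
    Tu.ν (⇑F '' ℓ) (⇑F '' A) = ENNReal.ofReal lam * Tu.ν ℓ A

/-- `x` is a (two-sided) density point of `D` along the streamline `ℓ` of `T`. -/
def DensityPtAlong {μ : Measure S} (T : MeasuredTurbulation μ) (ℓ D : Set S) (x : S) :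
    Prop :=
  ∀ ε : ℝ, 0 < ε → ∃ δ : ℝ, 0 < δ ∧ ∀ A : Set S, ∀ y : S,
    IsArcIn ℓ A x y → T.ν ℓ A < ENNReal.ofReal δ →
      (1 - ε) * (T.ν ℓ A).toReal ≤ (T.ν ℓ (A ∩ D)).toReal

/-- The set `den_k(R)` of level `k` density points of the tartan `R`. -/
def denSet {μ : Measure S} {Ts Tu : MeasuredTurbulation μ} (R : Tartan Ts Tu) :
    ℕ → Set S
  | 0 => R.core
  | k + 1 =>
    {x : S | x ∈ denSet R k ∧
      (∀ ℓ ∈ Ts.lines, x ∈ ℓ → DensityPtAlong Ts ℓ (denSet R k) x) ∧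
      (∀ ℓ ∈ Tu.lines, x ∈ ℓ → DensityPtAlong Tu ℓ (denSet R k) x)}

/-- The set `X_{δ,η}(R)`: points of `R^⋔` all of whose stable and unstable stream arcs of
measure less than `η` contain points of `R^⋔` in density at least `1 - δ`. -/
def Xset {μ : Measure S} {Ts Tu : MeasuredTurbulation μ} (R : Tartan Ts Tu)
    (δ η : ℝ) : Set S :=
  {x : S | x ∈ R.core ∧
    (∀ ℓ ∈ Ts.lines, x ∈ ℓ → ∀ A : Set S, ∀ y : S, IsArcIn ℓ A x y →
      Ts.ν ℓ A < ENNReal.ofReal η →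
        ENNReal.ofReal (1 - δ) * Ts.ν ℓ A ≤ Ts.ν ℓ (A ∩ R.core)) ∧
    (∀ ℓ ∈ Tu.lines, x ∈ ℓ → ∀ A : Set S, ∀ y : S, IsArcIn ℓ A x y →
      Tu.ν ℓ A < ENNReal.ofReal η →
        ENNReal.ofReal (1 - δ) * Tu.ν ℓ A ≤ Tu.ν ℓ (A ∩ R.core))}

/-- A regular tartan: for `y ∈ 𝔰(x) ∩ R^⋔` and `z ∈ 𝔲(x) ∩ R^⋔` at small stream distance
from `x`, all the fibers of the subtartan `R(y,z)` (the subarcs of stable fibers running from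
`𝔲(y)` to `𝔲(z) = 𝔲(x)`, and of unstable fibers running from `𝔰(y) = 𝔰(x)` to `𝔰(z)`)
are contained in `U`. -/
def Tartan.Regular {μ : Measure S} {Ts Tu : MeasuredTurbulation μ}
    (R : Tartan Ts Tu) : Prop :=
  ∀ x ∈ R.core, ∀ U ∈ 𝓝 x, ∃ δ : ℝ, 0 < δ ∧
    ∀ 𝔰x ∈ R.fibs, x ∈ 𝔰x → ∀ 𝔲x ∈ R.fibu, x ∈ 𝔲x →
    ∀ y ∈ 𝔰x ∩ R.core, ∀ z ∈ 𝔲x ∩ R.core,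
    (∀ ℓ ∈ Ts.lines, 𝔰x ⊆ ℓ → ∀ α : Set S, IsArcIn ℓ α x y →
      Ts.ν ℓ α < ENNReal.ofReal δ) →
    (∀ ℓ ∈ Tu.lines, 𝔲x ⊆ ℓ → ∀ α : Set S, IsArcIn ℓ α x z →
      Tu.ν ℓ α < ENNReal.ofReal δ) →
    ∀ 𝔲y ∈ R.fibu, y ∈ 𝔲y → ∀ 𝔰z ∈ R.fibs, z ∈ 𝔰z →
      ((∀ A ∈ R.fibs, ∀ p q : S, p ∈ A ∩ 𝔲y → q ∈ A ∩ 𝔲x →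
          ∀ ℓ ∈ Ts.lines, A ⊆ ℓ → ∀ α : Set S, IsArcIn ℓ α p q → α ⊆ U) ∧
       (∀ B ∈ R.fibu, ∀ p q : S, p ∈ B ∩ 𝔰x → q ∈ B ∩ 𝔰z →
          ∀ ℓ ∈ Tu.lines, B ⊆ ℓ → ∀ β : Set S, IsArcIn ℓ β p q → β ⊆ U))

/-- A (stable) bi-Lipschitz regular tartan: for some metric compatible with the topology of
`S` and some `K ≥ 1`, stream measure and distance are `K`-bi-Lipschitz comparable along
stable fibers. -/
def Tartan.StableBiLipschitzRegular {μ : Measure S} {Ts Tu : MeasuredTurbulation μ}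
    (R : Tartan Ts Tu) : Prop :=
  ∃ d : S → S → ℝ, IsCompatibleMetric S d ∧ ∃ K : ℝ, 1 ≤ K ∧
    ∀ 𝔰 ∈ R.fibs, ∀ x ∈ 𝔰, ∀ y ∈ 𝔰, ∀ ℓ ∈ Ts.lines, 𝔰 ⊆ ℓ →
      ∀ α : Set S, IsArcIn ℓ α x y →
        d x y / K ≤ (Ts.ν ℓ α).toReal ∧ (Ts.ν ℓ α).toReal ≤ K * d x y

/-- The turbulation `T` has partial flowboxes: if `x` and `y` lie on the same streamline
`ℓ`, and arcs transverse to `ℓ` at `x` and `y` contain transverse intersections with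
streamlines of `T` arbitrarily close to `x` and `y` on the same side of `ℓ`, then every
neighbourhood `U` of the stream arc `[x,y]` contains other stream arcs with endpoints on the
two transversals.  (The transversals and the side are encoded via a chart straightening the
streamline.) -/
def HasPartialFlowboxes {μ : Measure S} (T : MeasuredTurbulation μ) : Prop :=
  ∀ ℓ ∈ T.lines, ∀ x y : S, ∀ A : Set S, IsArcIn ℓ A x y →
  ∀ V : Set S, IsOpen V → ∀ e : V ≃ₜ ℝ × ℝ, A ⊆ V →
  (Subtype.val '' (⇑e ⁻¹' {p : ℝ × ℝ | p.2 = 0}) ⊆ ℓ) →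
  (∃ hx : x ∈ V, e ⟨x, hx⟩ = (0, 0)) →
  (∃ hy : y ∈ V, e ⟨y, hy⟩ = (1, 0)) →
  (∀ ε : ℝ, 0 < ε → ∃ p : S, ∃ hp : p ∈ V,
      (e ⟨p, hp⟩).1 = 0 ∧ 0 < (e ⟨p, hp⟩).2 ∧ (e ⟨p, hp⟩).2 < ε ∧
      ∃ ℓ' ∈ T.lines, p ∈ ℓ' ∧
        TransverseAt ℓ' (Subtype.val '' (⇑e ⁻¹' {q : ℝ × ℝ | q.1 = 0})) p) →
  (∀ ε : ℝ, 0 < ε → ∃ p : S, ∃ hp : p ∈ V,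
      (e ⟨p, hp⟩).1 = 1 ∧ 0 < (e ⟨p, hp⟩).2 ∧ (e ⟨p, hp⟩).2 < ε ∧
      ∃ ℓ' ∈ T.lines, p ∈ ℓ' ∧
        TransverseAt ℓ' (Subtype.val '' (⇑e ⁻¹' {q : ℝ × ℝ | q.1 = 1})) p) →
  ∀ U : Set S, IsOpen U → A ⊆ U →
    ∃ ℓ'' ∈ T.lines, ∃ A'' : Set S, ∃ x'' y'' : S, IsArcIn ℓ'' A'' x'' y'' ∧
      A'' ⊆ U ∧ A'' ≠ A ∧
      x'' ∈ Subtype.val '' (⇑e ⁻¹' {q : ℝ × ℝ | q.1 = 0}) ∧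
      y'' ∈ Subtype.val '' (⇑e ⁻¹' {q : ℝ × ℝ | q.1 = 1})

/-- Forward Birkhoff averages of `φ` under the homeomorphism `F`. -/
def birkhoffFwd (F : S ≃ₜ S) (φ : S → ℝ) (x : S) (n : ℕ) : ℝ :=
  (n : ℝ)⁻¹ * ∑ i ∈ Finset.range n, φ ((⇑F)^[i] x)

/-- Backward Birkhoff averages of `φ` under the homeomorphism `F`. -/
def birkhoffBwd (F : S ≃ₜ S) (φ : S → ℝ) (x : S) (n : ℕ) : ℝ :=
  (n : ℝ)⁻¹ * ∑ i ∈ Finset.range n, φ ((⇑F.symm)^[i] x)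

/-- The set `Z` of points where the forward and backward Birkhoff averages of `φ` exist
and are equal. -/
def ZSet (F : S ≃ₜ S) (φ : S → ℝ) : Set S :=
  {x : S | ∃ c : ℝ, Tendsto (birkhoffFwd F φ x) atTop (𝓝 c) ∧
      Tendsto (birkhoffBwd F φ x) atTop (𝓝 c)}

/-- The relation `~` on `Z`: `x ~ y` if they are joined by a finite chain of stream arcs
whose consecutive intersections contain points of `Z`. -/
def StreamRel {μ : Measure S} (Ts Tu : MeasuredTurbulation μ) (F : S ≃ₜ S)
    (φ : S → ℝ) (x y : S) : Prop :=
  x ∈ ZSet F φ ∧ y ∈ ZSet F φ ∧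
  (x = y ∨ ∃ k : ℕ, ∃ α : Fin (k + 1) → Set S,
    (∀ i, (∃ ℓ ∈ Ts.lines, IsArc ℓ (α i)) ∨ (∃ ℓ ∈ Tu.lines, IsArc ℓ (α i))) ∧
    x ∈ α 0 ∧ y ∈ α (Fin.last k) ∧
    ∀ i : Fin k, ∃ z ∈ α i.castSucc ∩ α i.succ, z ∈ ZSet F φ)


/-- A continuous function on the line avoiding the places where the cosine is negative stays within
`π / 2` of a single multiple of `2π`. -/
theorem exists_int_forall_abs_sub_le_of_cos_nonneg {h : ℝ → ℝ} (hc : Continuous h)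
    (hcos : ∀ t, 0 ≤ Real.cos (h t)) :
    ∃ k : ℤ, ∀ t, |h t - k * (2 * Real.pi)| ≤ Real.pi / 2 := by
  have hpi := Real.pi_pos
  have hcos' : ∀ (k : ℤ) t, 0 ≤ Real.cos (h t - k * (2 * Real.pi)) := fun k t => by
    rw [Real.cos_sub_int_mul_two_pi]; exact hcos t
  refine ⟨round (h 0 / (2 * Real.pi)), ?_⟩
  set k : ℤ := round (h 0 / (2 * Real.pi))
  have key : ∀ x : ℝ, |x| ≤ Real.pi → Real.pi / 2 < |x| → Real.cos x < 0 := fun x h1 h2 => by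
    rw [← Real.cos_abs]
    exact Real.cos_neg_of_pi_div_two_lt_of_lt h2 (by linarith)
  have h0 : |h 0 - k * (2 * Real.pi)| ≤ Real.pi := by
    have := abs_sub_round (h 0 / (2 * Real.pi))
    have e : h 0 - k * (2 * Real.pi) = (h 0 / (2 * Real.pi) - k) * (2 * Real.pi) := by
      field_simp
    rw [e, abs_mul, abs_of_pos (by positivity : 0 < 2 * Real.pi)]
    nlinarith
  have h0' : |h 0 - k * (2 * Real.pi)| ≤ Real.pi / 2 := by
    by_contra! hlt
    exact absurd (hcos' k 0) (not_le.2 (key _ h0 hlt))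
  intro t
  by_contra! hlt
  have hcont : Continuous fun t => |h t - k * (2 * Real.pi)| := by fun_prop
  obtain ⟨t', ht'⟩ : min |h t - k * (2 * Real.pi)| Real.pi ∈
      range fun t => |h t - k * (2 * Real.pi)| := by
    apply mem_range_of_exists_le_of_exists_ge hcont ⟨0, _⟩ ⟨t, min_le_left _ _⟩
    exact le_min (h0'.trans hlt.le) h0
  have h1 : |h t' - k * (2 * Real.pi)| ≤ Real.pi := ht'.trans_le (min_le_right _ _)
  have h2 : Real.pi / 2 < |h t' - k * (2 * Real.pi)| := by
    rw [show |h t' - k * (2 * Real.pi)| = _ from ht']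
    exact lt_min hlt (by linarith)
  exact absurd (hcos' k t') (not_le.2 (key _ h1 h2))

/-- A path crossing a rectangle from left to right meets every path crossing it from bottom
to top. -/
theorem JoinedIn.inter_nonempty_of_cross {F G : Set (ℝ × ℝ)} {p q r s : ℝ × ℝ}
    (hF : JoinedIn F p q) (hG : JoinedIn G r s) (hGF : ∀ z ∈ G, p.1 ≤ z.1 ∧ z.1 ≤ q.1)
    (hFG : ∀ z ∈ F, r.2 ≤ z.2 ∧ z.2 ≤ s.2) : (F ∩ G).Nonempty := by
  have hpi := Real.pi_pos
  obtain ⟨a, ha⟩ := hF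
  obtain ⟨b, hb⟩ := hG
  by_contra hne
  have ha' : ∀ x, a.extend x ∈ F := fun x => by
    obtain ⟨y, hy⟩ : a.extend x ∈ range a := by rw [← Path.extend_range]; exact mem_range_self x
    exact hy ▸ ha y
  have hb' : ∀ x, b.extend x ∈ G := fun x => by
    obtain ⟨y, hy⟩ : b.extend x ∈ range b := by rw [← Path.extend_range]; exact mem_range_self x
    exact hy ▸ hb y
  let g : ℝ × ℝ → ℂ := fun x =>
    ⟨(a.extend x.1).1 - (b.extend x.2).1, (a.extend x.1).2 - (b.extend x.2).2⟩
  have hg : Continuous g := by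
    have h1 : Continuous fun x : ℝ × ℝ => a.extend x.1 := a.continuous_extend.comp continuous_fst
    have h2 : Continuous fun x : ℝ × ℝ => b.extend x.2 := b.continuous_extend.comp continuous_snd
    have h3 : g = fun x => Complex.equivRealProdCLM.symm (a.extend x.1 - b.extend x.2) := by
      ext x
      apply Complex.ext <;> simp [g]
    rw [h3]; fun_prop
  have hg0 : ∀ x, g x ≠ 0 := fun x h => by
    have h1 := congrArg Complex.re h
    have h2 := congrArg Complex.im h
    simp only [g, Complex.zero_re, Complex.zero_im] at h1 h2
    have : a.extend x.1 = b.extend x.2 := Prod.ext (by linarith) (by linarith)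
    exact hne ⟨_, ha' x.1, this ▸ hb' x.2⟩
  obtain ⟨θ, hθ, hexp⟩ := Complex.exists_continuousOn_eqOn_exp_comp (U := (univ : Set (ℝ × ℝ)))
    (by
      have := convex_univ.contractibleSpace (univ_nonempty (α := ℝ × ℝ))
      unfold IsSimplyConnected; infer_instance) isOpen_univ hg.continuousOn (by
      rintro ⟨x, -, hx⟩; exact hg0 x hx)
  rw [continuousOn_univ] at hθ
  have hre : ∀ x, (g x).re = Real.exp (θ x).re * Real.cos (θ x).im := fun x => by
    rw [← hexp (mem_univ x)]; exact Complex.exp_re _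
  have him : ∀ x, (g x).im = Real.exp (θ x).re * Real.sin (θ x).im := fun x => by
    rw [← hexp (mem_univ x)]; exact Complex.exp_im _
  have hφ : Continuous fun x => (θ x).im := Complex.continuous_im.comp hθ
  obtain ⟨l, hl⟩ := exists_int_forall_abs_sub_le_of_cos_nonneg (h := fun t => (θ (1, t)).im)
    (hφ.comp (by fun_prop)) (fun t => by
      refine nonneg_of_mul_nonneg_right ?_ (Real.exp_pos (θ (1, t)).re)
      rw [← hre]
      have := (hGF _ (hb' t)).2
      simp only [g, Path.extend_one]; linarith)
  obtain ⟨k, hk⟩ := exists_int_forall_abs_sub_le_of_cos_nonneg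
    (h := fun t => (θ (t, 0)).im - Real.pi / 2)
    ((hφ.comp (by fun_prop)).sub continuous_const) (fun t => by
      refine nonneg_of_mul_nonneg_right ?_ (Real.exp_pos (θ (t, 0)).re)
      rw [Real.cos_sub_pi_div_two, ← him]
      have := (hFG _ (ha' t)).1
      simp only [g, Path.extend_zero]; linarith)
  obtain ⟨m, hm⟩ := exists_int_forall_abs_sub_le_of_cos_nonneg
    (h := fun t => (θ (t, 1)).im + Real.pi / 2)
    ((hφ.comp (by fun_prop)).add continuous_const) (fun t => by
      refine nonneg_of_mul_nonneg_right ?_ (Real.exp_pos (θ (t, 1)).re)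
      rw [Real.cos_add_pi_div_two, mul_neg, ← him]
      have := (hFG _ (ha' t)).2
      simp only [g, Path.extend_one]; linarith)
  obtain ⟨n, hn⟩ := exists_int_forall_abs_sub_le_of_cos_nonneg
    (h := fun t => (θ (0, t)).im - Real.pi)
    ((hφ.comp (by fun_prop)).sub continuous_const) (fun t => by
      refine nonneg_of_mul_nonneg_right ?_ (Real.exp_pos (θ (0, t)).re)
      rw [Real.cos_sub_pi, mul_neg, ← hre]
      have := (hGF _ (hb' t)).1
      simp only [g, Path.extend_zero]; linarith)
  have h10 := hl 0
  have h11 := hl 1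
  have k0 := hk 0
  have k1 := hk 1
  have m0 := hm 0
  have m1 := hm 1
  have n0 := hn 0
  have n1 := hn 1
  simp only [abs_le] at h10 h11 k0 k1 m0 m1 n0 n1
  have aux : ∀ x y : ℤ, (x - y : ℝ) * Real.pi < 2 * Real.pi → x - y < 2 := fun x y h => by
    have : ((x - y : ℤ) : ℝ) < (2 : ℤ) := by push_cast; nlinarith
    exact_mod_cast this
  have aux' : ∀ x y : ℤ, (x - y : ℝ) * (2 * Real.pi) < 2 * Real.pi → x - y < 1 := fun x y h => by
    have : ((x - y : ℤ) : ℝ) < (1 : ℤ) := by push_cast; nlinarith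
    exact_mod_cast this
  have e1 := aux' k l (by linarith)
  have e2 := aux' l k (by linarith)
  have e3 := aux' m l (by linarith)
  have e4 := aux' l m (by linarith)
  have e5 := aux' k n (by linarith)
  have e6 := aux' n k (by linarith)
  have e7 := aux' n m (by linarith)
  have e8 := aux' (m - 1) n (by push_cast; linarith)
  have e9 : n - (m - 1) < 1 := aux' n (m - 1) (by push_cast; linarith)
  omega

theorem joinedIn_horizontal {F : Set (ℝ × ℝ)} {x y v : ℝ} (h : ∀ t ∈ uIcc x y, (t, v) ∈ F) :
    JoinedIn F (x, v) (y, v) := by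
  refine JoinedIn.of_segment_subset ?_
  rw [← Prod.image_mk_segment_left, segment_eq_uIcc]
  exact image_subset_iff.2 h

theorem joinedIn_vertical {F : Set (ℝ × ℝ)} {x y u : ℝ} (h : ∀ t ∈ uIcc x y, (u, t) ∈ F) :
    JoinedIn F (u, x) (u, y) := by
  refine JoinedIn.of_segment_subset ?_
  rw [← Prod.image_mk_segment_right, segment_eq_uIcc]
  exact image_subset_iff.2 h

theorem JoinedIn.joinedIn_pathComponentIn {X : Type*} [TopologicalSpace X] {F : Set X} {x y : X}
    (h : JoinedIn F x y) : JoinedIn (pathComponentIn F x) x y :=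
  (isPathConnected_pathComponentIn h.source_mem).joinedIn x
    (mem_pathComponentIn_self h.source_mem) y h

/-- The closed rectangle `[-1, 1] × [-h, h]`. -/
def planeBox (h : ℝ) : Set (ℝ × ℝ) := Icc (-1) 1 ×ˢ Icc (-h) h

theorem mem_planeBox {h : ℝ} {z : ℝ × ℝ} :
    z ∈ planeBox h ↔ (-1 ≤ z.1 ∧ z.1 ≤ 1) ∧ -h ≤ z.2 ∧ z.2 ≤ h := Iff.rfl

theorem convex_planeBox (h : ℝ) : Convex ℝ (planeBox h) := (convex_Icc _ _).prod (convex_Icc _ _)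

theorem isCompact_planeBox (h : ℝ) : IsCompact (planeBox h) := isCompact_Icc.prod isCompact_Icc

/-- `C` is a closed path-connected subset of the rectangle `planeBox h` which joins its bottom to
its top and meets the horizontal axis in `(u, 0)` only. -/
structure IsCrosser (h u : ℝ) (C : Set (ℝ × ℝ)) : Prop where
  subset_box : C ⊆ planeBox h
  isClosed : IsClosed C
  left_lt : -1 < u
  lt_right : u < 1
  joinedIn : ∀ z ∈ C, JoinedIn C (u, 0) z
  base_mem : (u, 0) ∈ C
  axis : ∀ x, (x, 0) ∈ C → x = u
  bot : ∃ x, (x, -h) ∈ C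
  top : ∃ x, (x, h) ∈ C

/-- The part of `planeBox h` lying to the left of `C`. -/
def leftSide (h : ℝ) (C : Set (ℝ × ℝ)) : Set (ℝ × ℝ) := pathComponentIn (planeBox h \ C) (-1, 0)

/-- The part of `planeBox h` lying to the right of `C`. -/
def rightSide (h : ℝ) (C : Set (ℝ × ℝ)) : Set (ℝ × ℝ) := pathComponentIn (planeBox h \ C) (1, 0)

theorem measurableSet_pathComponentIn_diff {h : ℝ} {C : Set (ℝ × ℝ)} (hC : IsClosed C)
    (p : ℝ × ℝ) : MeasurableSet (pathComponentIn (planeBox h \ C) p) := by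
  set L := pathComponentIn (planeBox h \ C) p
  have key : L = planeBox h ∩ interior {z | z ∈ planeBox h → z ∈ L} := by
    ext z
    refine ⟨fun hz => ⟨(pathComponentIn_subset hz).1, ?_⟩,
      fun hz => interior_subset (s := {z | z ∈ planeBox h → z ∈ L}) hz.2 hz.1⟩
    have hz' : z ∈ planeBox h \ C := pathComponentIn_subset hz
    obtain ⟨ε, hε, hball⟩ := Metric.isOpen_iff.1 hC.isOpen_compl z hz'.2
    refine mem_interior.2 ⟨Metric.ball z ε, fun y hy hyb => ?_, Metric.isOpen_ball,
      Metric.mem_ball_self hε⟩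
    refine JoinedIn.trans hz (JoinedIn.of_segment_subset fun w hw => ⟨?_, hball ?_⟩)
    · exact (convex_planeBox h).segment_subset hz'.1 hyb hw
    · exact (convex_ball z ε).segment_subset (Metric.mem_ball_self hε) hy hw
  rw [key]
  exact (isCompact_planeBox h).measurableSet.inter isOpen_interior.measurableSet

namespace IsCrosser

variable {h u u' : ℝ} {C C' : Set (ℝ × ℝ)}

theorem nonneg (hC : IsCrosser h u C) : 0 ≤ h := by
  have := (hC.subset_box hC.base_mem).2.2
  simpa using this

theorem not_joinedIn (hC : IsCrosser h u C) : ¬ JoinedIn (planeBox h \ C) (-1, 0) (1, 0) := by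
  intro hJ
  obtain ⟨x, hx⟩ := hC.bot
  obtain ⟨y, hy⟩ := hC.top
  obtain ⟨z, hz, hz'⟩ := hJ.inter_nonempty_of_cross ((hC.joinedIn _ hx).symm.trans
    (hC.joinedIn _ hy)) (fun z hz => (hC.subset_box hz).1) (fun z hz => hz.1.2)
  exact hz.2 hz'

theorem disjoint_sides (hC : IsCrosser h u C) : Disjoint (leftSide h C) (rightSide h C) :=
  disjoint_left.2 fun _ hl hr => hC.not_joinedIn (JoinedIn.trans hl (JoinedIn.symm hr))

theorem joinedIn_left (hC : IsCrosser h u C) {x : ℝ} (hx1 : -1 ≤ x) (hx : x < u) :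
    JoinedIn (planeBox h \ C) (-1, 0) (x, 0) := by
  refine joinedIn_horizontal fun t ht => ?_
  rw [uIcc_of_le hx1] at ht
  have := hC.nonneg
  have := hC.lt_right
  exact ⟨mem_planeBox.2 ⟨⟨ht.1, by dsimp only; linarith [ht.2]⟩, by dsimp only; constructor <;> linarith⟩,
    fun hc => by have := hC.axis t hc; linarith [ht.2]⟩

theorem joinedIn_right (hC : IsCrosser h u C) {x : ℝ} (hx1 : x ≤ 1) (hx : u < x) :
    JoinedIn (planeBox h \ C) (1, 0) (x, 0) := by
  refine joinedIn_horizontal fun t ht => ?_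
  rw [uIcc_of_ge hx1] at ht
  have := hC.nonneg
  have := hC.left_lt
  exact ⟨mem_planeBox.2 ⟨⟨by dsimp only; linarith [ht.1], ht.2⟩, by dsimp only; constructor <;> linarith⟩,
    fun hc => by have := hC.axis t hc; linarith [ht.1]⟩

theorem subset_leftSide (hC : IsCrosser h u C) (hC' : IsCrosser h u' C') (hd : Disjoint C C')
    (hu : u' < u) : C' ⊆ leftSide h C := fun z hz =>
  (hC.joinedIn_left hC'.left_lt.le hu).trans ((hC'.joinedIn z hz).mono
    (subset_sdiff.2 ⟨hC'.subset_box, hd.symm⟩))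

theorem subset_rightSide (hC : IsCrosser h u C) (hC' : IsCrosser h u' C') (hd : Disjoint C C')
    (hu : u < u') : C' ⊆ rightSide h C := fun z hz =>
  (hC.joinedIn_right hC'.lt_right.le hu).trans ((hC'.joinedIn z hz).mono
    (subset_sdiff.2 ⟨hC'.subset_box, hd.symm⟩))

theorem leftSide_subset (hC : IsCrosser h u C) (hC' : IsCrosser h u' C') (hd : Disjoint C C')
    (hu : u' < u) : leftSide h C' ⊆ leftSide h C := fun _ hz =>
  hz.joinedIn_pathComponentIn.mono (subset_sdiff.2
    ⟨pathComponentIn_subset.trans sdiff_subset, hC'.disjoint_sides.mono_right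
      (hC'.subset_rightSide hC hd.symm hu)⟩)

theorem rightSide_subset (hC : IsCrosser h u C) (hC' : IsCrosser h u' C') (hd : Disjoint C C')
    (hu : u < u') : rightSide h C' ⊆ rightSide h C := fun _ hz =>
  hz.joinedIn_pathComponentIn.mono (subset_sdiff.2
    ⟨pathComponentIn_subset.trans sdiff_subset, (hC'.disjoint_sides.mono_left
      (hC'.subset_leftSide hC hd.symm hu)).symm⟩)

end IsCrosser

theorem exists_countable_subset_dense_left (T : Set ℝ) : ∃ D ⊆ T, D.Countable ∧ T ⊆ closure D ∧
    {t ∈ T | ∃ a < t, D ∩ Ioo a t = ∅}.Countable := by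
  obtain ⟨D, hDT, hD, hTD⟩ :=
    (TopologicalSpace.IsSeparable.of_separableSpace T).exists_countable_dense_subset
  refine ⟨D, hDT, hD, hTD, (countable_setOfPred_isolated_left_within (s := T)).mono ?_⟩
  rintro t ⟨ht, a, hat, hemp⟩
  refine ⟨ht, ?_⟩
  have hT : T ∩ Ioo a t = ∅ := by
    by_contra hne
    obtain ⟨y, hyT, hy⟩ := nonempty_iff_ne_empty.2 hne
    obtain ⟨d, hd, hdD⟩ := mem_closure_iff.1 (hTD hyT) _ isOpen_Ioo hy
    exact (hemp.subset ⟨hdD, hd⟩)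
  rw [← empty_mem_iff_bot]
  exact mem_nhdsWithin.2 ⟨Ioi a, isOpen_Ioi, hat, fun y hy => hT.subset ⟨hy.2.1, hy.1, hy.2.2⟩⟩

/-- Disjoint crossers with different base points are, up to countably many exceptions, the fibres
of a measurable function restricted to a measurable set. -/
theorem exists_measurable_of_isCrosser {ι : Type*} {h : ℝ} {I : Set ι} {u : ι → ℝ}
    {C : ι → Set (ℝ × ℝ)} (hu : InjOn u I) (hC : ∀ i ∈ I, IsCrosser h (u i) (C i))
    (hd : I.PairwiseDisjoint C) :
    ∃ Z : Set ι, Z.Countable ∧ ∃ Y : Set (ℝ × ℝ), MeasurableSet Y ∧ ∃ Φ : ℝ × ℝ → ℝ,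
      Measurable Φ ∧ ∀ i ∈ I \ Z, ∀ z, z ∈ C i ↔ z ∈ Y ∧ Φ z = u i := by
  obtain ⟨D₀, hD₀I, hD₀, hD₀d, hD₀l⟩ := exists_countable_subset_dense_left (u '' I)
  obtain ⟨D, hDI, rfl⟩ := subset_image_iff.1 hD₀I
  have hD : D.Countable := countable_of_injective_of_countable_image (hu.mono hDI) hD₀
  have hdij : ∀ i ∈ I, ∀ j ∈ I, u i ≠ u j → Disjoint (C i) (C j) := fun i hi j hj hij =>
    hd hi hj fun e => hij (congrArg u e)
  have hLR : ∀ i ∈ I, ∀ d ∈ D, (u i < u d → C i ⊆ leftSide h (C d)) ∧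
      (u d < u i → C i ⊆ rightSide h (C d)) := fun i hi d hd =>
    ⟨fun hlt => (hC d (hDI hd)).subset_leftSide (hC i hi) (hdij d (hDI hd) i hi hlt.ne') hlt,
      fun hlt => (hC d (hDI hd)).subset_rightSide (hC i hi) (hdij d (hDI hd) i hi hlt.ne) hlt⟩
  let F : ι → Set (ℝ × ℝ) := fun i => {z | z ∈ planeBox h ∧ ∀ d ∈ D,
    (u i < u d → z ∈ leftSide h (C d)) ∧ (u d < u i → z ∈ rightSide h (C d))}
  let Bad : Set (ℝ × ℝ) → Set ι := fun b => {i ∈ I | Disjoint b (C i) ∧ (b ∩ F i).Nonempty}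
  have hBad : ∀ b, Convex ℝ b → (Bad b).Countable := by
    intro b hb
    refine countable_of_injective_of_countable_image (f := u) (hu.mono fun i hi => hi.1) ?_
    refine Set.Finite.countable (not_infinite.1 fun hinf => ?_)
    obtain ⟨s, hs, hcard⟩ := hinf.exists_subset_card_eq 5
    have hex : ∀ k : Fin 5, ∃ i ∈ Bad b, u i = s.orderEmbOfFin hcard k := fun k =>
      hs (Finset.orderEmbOfFin_mem s hcard k)
    choose i hi hui using hex
    have hlt : ∀ k l : Fin 5, k < l → u (i k) < u (i l) := fun k l hkl => by
      rw [hui, hui]; exact (s.orderEmbOfFin hcard).strictMono hkl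
    have hbet : ∀ k l m : Fin 5, k < l → l < m → ∃ d ∈ D, u (i k) < u d ∧ u d < u (i m) := by
      intro k l m hkl hlm
      obtain ⟨_, hd, d, hdD, rfl⟩ := mem_closure_iff.1 (hD₀d (mem_image_of_mem u (hi l).1)) _
        isOpen_Ioo (⟨hlt k l hkl, hlt l m hlm⟩ : u (i l) ∈ Ioo (u (i k)) (u (i m)))
      exact ⟨d, hdD, hd⟩
    obtain ⟨d, hdD, hd1, hd2⟩ := hbet 0 1 2 (by decide) (by decide)
    obtain ⟨d', hdD', hd1', hd2'⟩ := hbet 2 3 4 (by decide) (by decide)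
    obtain ⟨z, hzb, hzF⟩ := (hi 0).2.2
    obtain ⟨z', hzb', hzF'⟩ := (hi 4).2.2
    have h2 := hC _ (hi 2).1
    have hz : z ∈ leftSide h (C (i 2)) :=
      h2.leftSide_subset (hC d (hDI hdD)) (hdij _ (hi 2).1 _ (hDI hdD) hd2.ne') hd2
        ((hzF.2 d hdD).1 hd1)
    have hz' : z' ∈ rightSide h (C (i 2)) :=
      h2.rightSide_subset (hC d' (hDI hdD')) (hdij _ (hi 2).1 _ (hDI hdD') hd1'.ne) hd1'
        ((hzF'.2 d' hdD').2 hd2')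
    have hzz : JoinedIn (planeBox h \ C (i 2)) z z' := JoinedIn.of_segment_subset fun w hw =>
      ⟨(convex_planeBox h).segment_subset hzF.1 hzF'.1 hw,
        disjoint_left.1 (hi 2).2.1 (hb.segment_subset hzb hzb' hw)⟩
    exact h2.not_joinedIn (JoinedIn.trans hz (hzz.trans (JoinedIn.symm hz')))
  obtain ⟨Q, hQc, hQ⟩ : ∃ Q : Set (ℝ × ℝ), Q.Countable ∧ Dense Q :=
    TopologicalSpace.exists_countable_dense _
  let Z₁ : Set ι := {i ∈ I | ∃ a < u i, u '' D ∩ Ioo a (u i) = ∅}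
  have hZ₁ : Z₁.Countable := by
    refine countable_of_injective_of_countable_image (hu.mono fun i hi => hi.1) (hD₀l.mono ?_)
    rintro _ ⟨i, ⟨hi, hi'⟩, rfl⟩
    exact ⟨mem_image_of_mem u hi, hi'⟩
  let Z₂ : Set ι := ⋃ q ∈ Q, ⋃ n : ℕ, Bad (Metric.ball q (1 / (n + 1 : ℝ)))
  have hZ₂ : Z₂.Countable := hQc.biUnion fun q _ => countable_iUnion fun n =>
    hBad _ (convex_ball _ _)
  have hFC : ∀ i ∈ I \ Z₂, F i ⊆ C i := by
    rintro i ⟨hi, hiZ⟩ z hz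
    by_contra hzC
    obtain ⟨ε, hε, hball⟩ := Metric.isOpen_iff.1 (hC i hi).isClosed.isOpen_compl z hzC
    obtain ⟨n, hn⟩ := exists_nat_one_div_lt (half_pos hε)
    obtain ⟨q, hq, hqz⟩ := hQ.exists_dist_lt z (by positivity : (0 : ℝ) < 1 / (n + 1 : ℝ))
    refine hiZ (mem_biUnion hq (mem_iUnion.2 ⟨n, hi, ?_, z, hqz, hz⟩))
    refine disjoint_left.2 fun w hw hwC => hball ?_ hwC
    rw [Metric.mem_ball] at hw ⊢
    linarith [dist_triangle w q z, dist_comm q z]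
  classical
  have := hD.to_subtype
  let φ : D → ℝ × ℝ → ℝ := fun d z => if z ∈ rightSide h (C d) then u d else -1
  have hbdd : ∀ z, BddAbove (range fun d => φ d z) := by
    refine fun z => ⟨1, ?_⟩
    rintro _ ⟨d, rfl⟩
    have := (hC d (hDI d.2)).lt_right
    dsimp only [φ]
    split_ifs <;> linarith
  have hFΦ : ∀ i ∈ I \ Z₁, ∀ z ∈ F i, ⨆ d, φ d z = u i := by
    rintro i ⟨hi, hiZ⟩ z hz
    have hex : ∀ a < u i, ∃ d ∈ D, a < u d ∧ u d < u i := fun a ha => by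
      by_contra! hcon
      refine hiZ ⟨hi, a, ha, eq_empty_iff_forall_notMem.2 ?_⟩
      rintro _ ⟨⟨d, hd, rfl⟩, h1, h2⟩
      exact absurd h2 (not_lt.2 (hcon d hd h1))
    obtain ⟨d₀, hd₀, -⟩ := hex (u i - 1) (by linarith)
    have : Nonempty D := ⟨⟨d₀, hd₀⟩⟩
    refine le_antisymm (ciSup_le fun d => ?_) (le_of_forall_lt fun a ha => ?_)
    · dsimp only [φ]
      split_ifs with hzd
      · by_contra! hlt
        exact disjoint_left.1 (hC d (hDI d.2)).disjoint_sides ((hz.2 d d.2).1 hlt) hzd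
      · exact (hC i hi).left_lt.le
    · obtain ⟨d, hd, had, hdi⟩ := hex a ha
      refine had.trans_le (le_trans (le_of_eq ?_) (le_ciSup (hbdd z) ⟨d, hd⟩))
      exact (if_pos ((hz.2 d hd).2 hdi)).symm
  refine ⟨Z₁ ∪ Z₂, hZ₁.union hZ₂, planeBox h ∩ ⋂ d : D, (leftSide h (C d) ∪ rightSide h (C d)) ∪
    {z | ⨆ d, φ d z = u d}, ?_, fun z => ⨆ d, φ d z, ?_, ?_⟩
  · have hΦ : Measurable fun z => ⨆ d, φ d z := Measurable.iSup fun d => Measurable.ite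
      (measurableSet_pathComponentIn_diff (hC d (hDI d.2)).isClosed _) measurable_const
      measurable_const
    exact (isCompact_planeBox h).measurableSet.inter (MeasurableSet.iInter fun d =>
      ((measurableSet_pathComponentIn_diff (hC d (hDI d.2)).isClosed _).union
        (measurableSet_pathComponentIn_diff (hC d (hDI d.2)).isClosed _)).union
        (hΦ (measurableSet_singleton _)))
  · exact Measurable.iSup fun d => Measurable.ite
      (measurableSet_pathComponentIn_diff (hC d (hDI d.2)).isClosed _) measurable_const
      measurable_const
  · rintro i ⟨hi, hiZ⟩ z
    have hi₁ : i ∈ I \ Z₁ := ⟨hi, fun hc => hiZ (Or.inl hc)⟩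
    constructor
    · intro hz
      have hzF : z ∈ F i := ⟨(hC i hi).subset_box hz, fun d hd =>
        ⟨fun hlt => (hLR i hi d hd).1 hlt hz, fun hlt => (hLR i hi d hd).2 hlt hz⟩⟩
      refine ⟨⟨hzF.1, mem_iInter.2 fun d => ?_⟩, hFΦ i hi₁ z hzF⟩
      rcases lt_trichotomy (u i) (u d) with hlt | heq | hlt
      · exact Or.inl (Or.inl ((hzF.2 d d.2).1 hlt))
      · exact Or.inr ((hFΦ i hi₁ z hzF).trans heq)
      · exact Or.inl (Or.inr ((hzF.2 d d.2).2 hlt))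
    · rintro ⟨⟨hzb, hzY⟩, hzΦ⟩
      refine hFC i ⟨hi, fun hc => hiZ (Or.inr hc)⟩ ⟨hzb, fun d hd => ⟨fun hlt => ?_, fun hlt => ?_⟩⟩
      · rcases mem_iInter.1 hzY ⟨d, hd⟩ with (hl | hr) | he
        · exact hl
        · have hle := le_ciSup (hbdd z) ⟨d, hd⟩
          have : φ ⟨d, hd⟩ z = u d := if_pos hr
          linarith
        · exact absurd (hzΦ.symm.trans he) hlt.ne
      · have : Nonempty D := ⟨⟨d, hd⟩⟩
        obtain ⟨d', hd'⟩ := exists_lt_of_lt_ciSup (hlt.trans_eq hzΦ.symm)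
        dsimp only [φ] at hd'
        split_ifs at hd' with hzd'
        · exact (hC d (hDI hd)).rightSide_subset (hC d' (hDI d'.2))
            (hdij _ (hDI hd) _ (hDI d'.2) hd'.ne) hd' hzd'
        · linarith [(hC d (hDI hd)).left_lt]

/-- `D` is a closed path-connected subset of the rectangle `planeBox h` which meets the horizontal
axis in `(u, 0)` only and the boundary of the rectangle in `e` only, and does not change side of
the axis. -/
structure IsLeg (h u : ℝ) (D : Set (ℝ × ℝ)) (e : ℝ × ℝ) : Prop where
  isClosed : IsClosed D
  left_lt : -1 < u
  lt_right : u < 1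
  joinedIn : ∀ z ∈ D, JoinedIn D (u, 0) z
  base_mem : (u, 0) ∈ D
  axis : ∀ x, (x, 0) ∈ D → x = u
  exit_mem : e ∈ D
  exit_mem_box : e ∈ planeBox h
  exit_frontier : e.1 = -1 ∨ e.1 = 1 ∨ |e.2| = h
  inner : ∀ z ∈ D, z ≠ e → z ∈ Ioo (-1 : ℝ) 1 ×ˢ Ioo (-h) h
  same_side : ∀ z ∈ D, z ≠ (u, 0) → 0 < e.2 * z.2

namespace IsLeg

variable {h u u' : ℝ} {D D' : Set (ℝ × ℝ)} {e e' : ℝ × ℝ}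

theorem subset_box (hD : IsLeg h u D e) : D ⊆ planeBox h := fun z hz => by
  by_cases hze : z = e
  · exact hze ▸ hD.exit_mem_box
  · have := hD.inner z hz hze
    exact ⟨⟨this.1.1.le, this.1.2.le⟩, this.2.1.le, this.2.2.le⟩

theorem nonneg (hD : IsLeg h u D e) : 0 ≤ h := by
  have := (hD.subset_box hD.base_mem).2.2
  simpa using this

theorem reflect (hD : IsLeg h u D e) :
    IsLeg h u ((fun z : ℝ × ℝ => (z.1, -z.2)) ⁻¹' D) (e.1, -e.2) := by
  have hr : Continuous fun z : ℝ × ℝ => (z.1, -z.2) := by fun_prop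
  refine ⟨hD.isClosed.preimage hr, hD.left_lt, hD.lt_right, fun z hz => ?_, ?_, fun x hx => ?_,
    ?_, ?_, ?_, fun z hz hze => ?_, fun z hz hzu => ?_⟩
  · have := (hD.joinedIn _ hz).map_continuousOn hr.continuousOn
    simp only [neg_zero, neg_neg] at this
    refine this.mono ?_
    rintro _ ⟨w, hw, rfl⟩
    simpa using hw
  · simpa using hD.base_mem
  · exact hD.axis x (by simpa using hx)
  · simpa using hD.exit_mem
  · have := hD.exit_mem_box
    simp only [mem_planeBox] at this ⊢
    exact ⟨this.1, by linarith, by linarith⟩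
  · simpa using hD.exit_frontier
  · have := hD.inner _ hz (fun he => hze (by rw [← he]; simp))
    exact ⟨this.1, by linarith [this.2.2], by linarith [this.2.1]⟩
  · have := hD.same_side _ hz (fun he => hzu (by
      have h1 := congrArg Prod.fst he
      have h2 := congrArg Prod.snd he
      exact Prod.ext h1 (by simpa using h2)))
    simpa using this

theorem nonneg_of_exit (hD : IsLeg h u D e) (he : e.2 = h) {z : ℝ × ℝ} (hz : z ∈ D) :
    0 ≤ z.2 := by
  by_cases hzu : z = (u, 0)
  · rw [hzu]
  · have := hD.same_side z hz hzu
    by_contra! hlt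
    have := hD.nonneg
    nlinarith

theorem exit_lt (hD : IsLeg h u D e) (hD' : IsLeg h u' D' e') (hd : Disjoint D D')
    (he : e.2 = h) (he' : e'.2 = h) (hu : u < u') : e.1 < e'.1 := by
  have hh := hD.nonneg
  by_contra! hle
  have h1 : JoinedIn ({z : ℝ × ℝ | 0 ≤ z.2 ∧ z.2 ≤ h} \ D) (-1, h) (e'.1, h) := by
    refine joinedIn_horizontal fun t ht => ⟨⟨hh, le_rfl⟩, fun htD => ?_⟩
    rw [uIcc_of_le hD'.exit_mem_box.1.1] at ht
    by_cases hte : (t, h) = e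
    · have h2 : t = e.1 := congrArg Prod.fst hte
      have h3 : e = e' := Prod.ext (by linarith [ht.2]) (he.trans he'.symm)
      exact disjoint_left.1 hd hD.exit_mem (h3 ▸ hD'.exit_mem)
    · exact lt_irrefl _ (hD.inner _ htD hte).2.2
  have h2 : JoinedIn ({z : ℝ × ℝ | 0 ≤ z.2 ∧ z.2 ≤ h} \ D) (e'.1, h) (u', 0) := by
    have := (hD'.joinedIn _ hD'.exit_mem).symm
    rw [show e' = (e'.1, h) from Prod.ext rfl he'] at this
    exact this.mono fun z hz => ⟨⟨hD'.nonneg_of_exit he' hz, (hD'.subset_box hz).2.2⟩,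
      disjoint_right.1 hd hz⟩
  have h3 : JoinedIn ({z : ℝ × ℝ | 0 ≤ z.2 ∧ z.2 ≤ h} \ D) (u', 0) (1, 0) := by
    refine joinedIn_horizontal fun t ht => ⟨⟨le_rfl, hh⟩, fun htD => ?_⟩
    rw [uIcc_of_le hD'.lt_right.le] at ht
    linarith [hD.axis t htD, ht.1]
  obtain ⟨z, hz, hz'⟩ := ((h1.trans h2).trans h3).inter_nonempty_of_cross
    (hD.joinedIn _ hD.exit_mem) (fun z hz => (hD.subset_box hz).1)
    (fun z hz => ⟨hz.1.1, hz.1.2.trans he.ge⟩)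
  exact hz.2 hz'

end IsLeg

/-- Only countably many disjoint pairs of legs leave a rectangle on the same horizontal edge. -/
theorem countable_of_isLeg_of_top {ι : Type*} {h : ℝ} (hh : 0 < h) {I : Set ι} {u : ι → ℝ}
    {D D' : ι → Set (ℝ × ℝ)} {e e' : ι → ℝ × ℝ} (hu : InjOn u I)
    (hD : ∀ i ∈ I, IsLeg h (u i) (D i) (e i)) (hD' : ∀ i ∈ I, IsLeg h (u i) (D' i) (e' i))
    (hDD' : ∀ i ∈ I, D i ∩ D' i ⊆ {(u i, 0)})
    (hd : I.PairwiseDisjoint fun i => D i ∪ D' i)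
    (he : ∀ i ∈ I, (e i).2 = h) (he' : ∀ i ∈ I, (e' i).2 = h) : I.Countable := by
  have hne : ∀ i ∈ I, (e i).1 ≠ (e' i).1 := fun i hi heq => by
    have h1 : e i = e' i := Prod.ext heq ((he i hi).trans (he' i hi).symm)
    have h2 := hDD' i hi ⟨(hD i hi).exit_mem, h1 ▸ (hD' i hi).exit_mem⟩
    have h3 := congrArg Prod.snd (mem_singleton_iff.1 h2)
    rw [he i hi] at h3
    exact hh.ne' h3
  have key : ∀ i ∈ I, ∀ j ∈ I, u i < u j → max (e i).1 (e' i).1 < min (e j).1 (e' j).1 := by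
    intro i hi j hj hij
    have hdij := hd hi hj fun hc => hij.ne (congrArg u hc)
    simp only [Function.onFun, disjoint_union_left, disjoint_union_right] at hdij
    exact max_lt
      (lt_min ((hD i hi).exit_lt (hD j hj) hdij.1.1 (he i hi) (he j hj) hij)
        ((hD i hi).exit_lt (hD' j hj) hdij.2.1 (he i hi) (he' j hj) hij))
      (lt_min ((hD' i hi).exit_lt (hD j hj) hdij.1.2 (he' i hi) (he j hj) hij)
        ((hD' i hi).exit_lt (hD' j hj) hdij.2.2 (he' i hi) (he' j hj) hij))
  refine PairwiseDisjoint.countable_of_isOpen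
    (s := fun i => Ioo (min (e i).1 (e' i).1) (max (e i).1 (e' i).1)) ?_ (fun i _ => isOpen_Ioo)
    (fun i hi => nonempty_Ioo.2 (min_lt_max.2 (hne i hi)))
  intro i hi j hj hij
  rcases lt_or_gt_of_ne (fun hc => hij (hu hi hj hc)) with hlt | hlt
  · exact disjoint_left.2 fun z hz hz' => by
      linarith [key i hi j hj hlt, hz.2, hz'.1]
  · exact disjoint_left.2 fun z hz hz' => by
      linarith [key j hj i hi hlt, hz'.2, hz.1]

theorem countable_of_isLeg {ι : Type*} {h : ℝ} (hh : 0 < h) {I : Set ι} {u : ι → ℝ}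
    {D D' : ι → Set (ℝ × ℝ)} {e e' : ι → ℝ × ℝ} (hu : InjOn u I)
    (hD : ∀ i ∈ I, IsLeg h (u i) (D i) (e i)) (hD' : ∀ i ∈ I, IsLeg h (u i) (D' i) (e' i))
    (hDD' : ∀ i ∈ I, D i ∩ D' i ⊆ {(u i, 0)})
    (hd : I.PairwiseDisjoint fun i => D i ∪ D' i)
    (he : ∀ i ∈ I, |(e i).2| = h) (hee' : ∀ i ∈ I, (e i).2 = (e' i).2) : I.Countable := by
  have h1 : {i ∈ I | (e i).2 = h}.Countable :=
    countable_of_isLeg_of_top hh (hu.mono (sep_subset _ _)) (fun i hi => hD i hi.1)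
      (fun i hi => hD' i hi.1) (fun i hi => hDD' i hi.1) (hd.subset (sep_subset _ _))
      (fun i hi => hi.2) (fun i hi => (hee' i hi.1).symm.trans hi.2)
  have h2 : {i ∈ I | (e i).2 = -h}.Countable := by
    refine countable_of_isLeg_of_top hh (hu.mono (sep_subset _ _))
      (fun i hi => (hD i hi.1).reflect) (fun i hi => (hD' i hi.1).reflect) (fun i hi z hz => ?_)
      (fun i hi j hj hij => ?_)
      (fun i hi => by simp [hi.2]) (fun i hi => by simp [← hee' i hi.1, hi.2])
    · have := mem_singleton_iff.1 (hDD' i hi.1 hz)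
      have h1 := congrArg Prod.fst this
      have h2 := congrArg Prod.snd this
      exact Prod.ext h1 (by simpa using h2)
    · have := hd hi.1 hj.1 hij
      exact this.preimage (fun z : ℝ × ℝ => (z.1, -z.2))
  refine (h1.union h2).mono fun i hi => ?_
  rcases eq_or_eq_neg_of_abs_eq (he i hi) with h | h
  · exact Or.inl ⟨hi, h⟩
  · exact Or.inr ⟨hi, h⟩

namespace IsLeg

variable {h u u' u₁ u₂ : ℝ} {D D' C₁ C₂ : Set (ℝ × ℝ)} {e e' : ℝ × ℝ}

theorem isCrosser (hD : IsLeg h u D e) (hD' : IsLeg h u D' e') (he : |e.2| = h)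
    (he' : e'.2 = -e.2) : IsCrosser h u (D ∪ D') := by
  have hb : ∀ z ∈ D ∪ D', JoinedIn (D ∪ D') (u, 0) z := by
    rintro z (hz | hz)
    · exact (hD.joinedIn z hz).mono subset_union_left
    · exact (hD'.joinedIn z hz).mono subset_union_right
  refine ⟨union_subset hD.subset_box hD'.subset_box, hD.isClosed.union hD'.isClosed, hD.left_lt,
    hD.lt_right, hb, Or.inl hD.base_mem, ?_, ?_, ?_⟩
  · rintro x (hx | hx)
    · exact hD.axis x hx
    · exact hD'.axis x hx
  · rcases eq_or_eq_neg_of_abs_eq he with h1 | h1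
    · exact ⟨e'.1, Or.inr (by rw [← h1, ← he']; exact hD'.exit_mem)⟩
    · exact ⟨e.1, Or.inl (by rw [← h1]; exact hD.exit_mem)⟩
  · rcases eq_or_eq_neg_of_abs_eq he with h1 | h1
    · exact ⟨e.1, Or.inl (by rw [← h1]; exact hD.exit_mem)⟩
    · exact ⟨e'.1, Or.inr (by rw [h1, neg_neg] at he'; rw [← he']; exact hD'.exit_mem)⟩

/-- A leg based between two crossers leaves the rectangle through a horizontal edge. -/
theorem abs_exit_eq (hD : IsLeg h u D e) (h₁ : IsCrosser h u₁ C₁) (h₂ : IsCrosser h u₂ C₂)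
    (hC₁ : ∀ z ∈ C₁, |z.1| = 1 → |z.2| = h) (hC₂ : ∀ z ∈ C₂, |z.1| = 1 → |z.2| = h)
    (hd₁ : Disjoint C₁ D) (hd₂ : Disjoint C₂ D) (hu₁ : u₁ < u) (hu₂ : u < u₂) : |e.2| = h := by
  by_contra hne
  have hlt : |e.2| < h := lt_of_le_of_ne (abs_le.2 hD.exit_mem_box.2) hne
  have hedge : ∀ {C : Set (ℝ × ℝ)} {x : ℝ}, (∀ z ∈ C, |z.1| = 1 → |z.2| = h) → |x| = 1 →
      JoinedIn (planeBox h \ C) (x, 0) (x, e.2) := fun {C x} hC hx => by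
    refine joinedIn_vertical fun t ht => ?_
    have ht' : |t| ≤ |e.2| := by simpa using abs_sub_left_of_mem_uIcc ht
    refine ⟨⟨abs_le.1 hx.le, abs_le.1 (ht'.trans hlt.le)⟩, fun hc => ?_⟩
    have := hC _ hc hx
    simp only at this
    linarith
  have hleg : ∀ {C : Set (ℝ × ℝ)}, Disjoint C D → JoinedIn (planeBox h \ C) e (u, 0) :=
    fun hCD => (hD.joinedIn e hD.exit_mem).symm.mono (subset_sdiff.2 ⟨hD.subset_box, hCD.symm⟩)
  rcases hD.exit_frontier with he | he | he
  · have h3 := hedge (C := C₁) (x := -1) hC₁ (by simp)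
    rw [← he] at h3
    have h4 := (h3.trans (hleg hd₁)).trans (h₁.joinedIn_right hD.lt_right.le hu₁).symm
    rw [he] at h4
    exact h₁.not_joinedIn h4
  · have h3 := hedge (C := C₂) (x := 1) hC₂ (by simp)
    rw [← he] at h3
    have h4 := (h3.trans (hleg hd₂)).trans (h₂.joinedIn_left hD.left_lt.le hu₂).symm
    rw [he] at h4
    exact h₂.not_joinedIn h4.symm
  · exact hne he

end IsLeg

theorem exists_isLeg {S : Type*} [TopologicalSpace S] [T2Space S] {j : ℝ × ℝ → S}
    (hj : IsOpenEmbedding j) {f : ℝ → S} (hf : Continuous f) {τ b u h : ℝ} (hτb : τ < b)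
    (hfτ : f τ = j (u, 0)) (hu : u ∈ Ioo (-1 : ℝ) 1) (hh : 0 < h)
    (haxis : ∀ t ∈ Icc τ b, f t ∈ j '' (Icc (-1) 1 ×ˢ {0}) → t = τ)
    (hb : f b ∉ j '' planeBox h) :
    ∃ t, τ < t ∧ t ≤ b ∧ f '' Icc τ t ⊆ j '' planeBox h ∧ ∃ e, f t = j e ∧
      IsLeg h u (j ⁻¹' (f '' Icc τ t)) e := by
  set B : Set (ℝ × ℝ) := Ioo (-1 : ℝ) 1 ×ˢ Ioo (-h) h with hB
  have hBbox : B ⊆ planeBox h := prod_mono Ioo_subset_Icc_self Ioo_subset_Icc_self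
  have hO : IsOpen (j '' B) := hj.isOpenMap _ (isOpen_Ioo.prod isOpen_Ioo)
  have hK : IsClosed (j '' planeBox h) := ((isCompact_planeBox h).image hj.continuous).isClosed
  let A : Set ℝ := Icc τ b ∩ f ⁻¹' (j '' B)ᶜ
  have hA : IsCompact A := isCompact_Icc.inter_right (hO.isClosed_compl.preimage hf)
  have hbA : b ∈ A := ⟨⟨hτb.le, le_rfl⟩, fun hc => hb (image_mono hBbox hc)⟩
  obtain ⟨t, ⟨htI, htO⟩, htmin⟩ := hA.exists_isLeast ⟨b, hbA⟩
  have hτO : f τ ∈ j '' B := ⟨(u, 0), ⟨hu, by constructor <;> simpa using hh⟩, hfτ.symm⟩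
  have hτt : τ < t := lt_of_le_of_ne htI.1 fun he => htO (he ▸ hτO)
  have hin : ∀ s ∈ Ico τ t, f s ∈ j '' B := fun s hs => by
    by_contra hc
    exact absurd hs.2 (not_lt.2 (htmin ⟨⟨hs.1, hs.2.le.trans htI.2⟩, hc⟩))
  have hsub : f '' Icc τ t ⊆ j '' planeBox h := by
    have h1 : closure (Ico τ t) ⊆ f ⁻¹' (j '' planeBox h) :=
      closure_minimal (fun s hs => image_mono hBbox (hin s hs)) (hK.preimage hf)
    rw [closure_Ico hτt.ne] at h1
    exact image_subset_iff.2 h1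
  have hw : ∀ s ∈ Icc τ t, ∃ w ∈ planeBox h, j w = f s := fun s hs => hsub (mem_image_of_mem f hs)
  choose! w hwb hw using hw
  have hwc : ContinuousOn w (Icc τ t) := by
    rw [hj.isInducing.continuousOn_iff]
    exact hf.continuousOn.congr hw
  have hD : j ⁻¹' (f '' Icc τ t) = w '' Icc τ t := by
    ext z
    constructor
    · rintro ⟨s, hs, hz⟩
      exact ⟨s, hs, hj.injective ((hw s hs).trans hz)⟩
    · rintro ⟨s, hs, rfl⟩
      exact ⟨s, hs, (hw s hs).symm⟩
  have hwτ : w τ = (u, 0) := hj.injective ((hw τ ⟨le_rfl, hτt.le⟩).trans hfτ)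
  have hw0 : ∀ s ∈ Icc τ t, (w s).2 = 0 → s = τ := fun s hs h0 => by
    refine haxis s ⟨hs.1, hs.2.trans htI.2⟩ ⟨w s, ⟨(hwb s hs).1, h0⟩, hw s hs⟩
  have htt : t ∈ Icc τ t := ⟨hτt.le, le_rfl⟩
  refine ⟨t, hτt, htI.2, hsub, w t, (hw t htt).symm, ?_⟩
  rw [hD]
  refine ⟨(isCompact_Icc.image_of_continuousOn hwc).isClosed, hu.1, hu.2, ?_,
    ⟨τ, ⟨le_rfl, hτt.le⟩, hwτ⟩, ?_, mem_image_of_mem w htt, hwb t htt, ?_, ?_, ?_⟩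
  · rintro _ ⟨s, hs, rfl⟩
    have hsub' : Icc τ s ⊆ Icc τ t := Icc_subset_Icc_right hs.2
    have := ((convex_Icc τ s).isPathConnected ⟨τ, le_rfl, hs.1⟩).image' (hwc.mono hsub')
    rw [← hwτ]
    exact (this.joinedIn _ (mem_image_of_mem w ⟨le_rfl, hs.1⟩) _
      (mem_image_of_mem w ⟨hs.1, le_rfl⟩)).mono (image_mono hsub')
  · rintro x ⟨s, hs, hx⟩
    have h1 := hw0 s hs (by rw [hx])
    rw [h1, hwτ] at hx
    exact (congrArg Prod.fst hx).symm
  · have h1 : w t ∉ B := fun hc => htO ⟨w t, hc, hw t htt⟩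
    have h2 := hwb t htt
    by_contra! hne
    refine h1 ⟨⟨lt_of_le_of_ne h2.1.1 hne.1.symm, lt_of_le_of_ne h2.1.2 hne.2.1⟩, ?_⟩
    exact abs_lt.1 (lt_of_le_of_ne (abs_le.2 h2.2) hne.2.2)
  · rintro _ ⟨s, hs, rfl⟩ hne
    obtain ⟨z, hz, hjz⟩ := hin s ⟨hs.1, lt_of_le_of_ne hs.2 fun he => hne (by rw [he])⟩
    rwa [← hj.injective (hjz.trans (hw s hs).symm)]
  · rintro _ ⟨s, hs, rfl⟩ hne
    by_contra! hle
    have hsτ : τ < s := lt_of_le_of_ne hs.1 fun he => hne (by rw [← he, hwτ])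
    have hcont : ContinuousOn (fun r => (w t).2 * (w r).2) (Icc s t) :=
      continuousOn_const.mul (continuous_snd.comp_continuousOn
        (hwc.mono (Icc_subset_Icc_left hs.1)))
    obtain ⟨r, hr, hr0⟩ := intermediate_value_Icc hs.2 hcont ⟨hle, mul_self_nonneg _⟩
    have hrI : r ∈ Icc τ t := ⟨hs.1.trans hr.1, hr.2⟩
    rcases mul_eq_zero.1 hr0 with h0 | h0
    · exact hτt.ne' (hw0 t htt h0)
    · exact (hsτ.trans_le hr.1).ne' (hw0 r hrI h0)

theorem eventually_abs_exit_eq {S : Type*} [TopologicalSpace S] {j : ℝ × ℝ → S}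
    (hj : IsOpenEmbedding j) {f : ℝ → S} (hf : Continuous f) {τ b u : ℝ} (hτb : τ < b)
    (hfτ : f τ = j (u, 0)) (hu : u ∈ Ioo (-1 : ℝ) 1)
    (haxis : ∀ t ∈ Icc τ b, f t ∈ j '' (Icc (-1) 1 ×ˢ {0}) → t = τ) :
    ∃ h₀ > 0, ∀ h < h₀, f b ∉ j '' planeBox h ∧ ∀ t e, τ < t →
      f '' Icc τ t ⊆ j '' planeBox h → f t = j e → IsLeg h u (j ⁻¹' (f '' Icc τ t)) e →
        |e.2| = h := by
  have key : ∀ t ∈ Ioc τ b, ∃ h₀ > 0, ∀ h < h₀, f t ∉ j '' planeBox h := by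
    intro t ht
    by_cases hr : f t ∈ range j
    · obtain ⟨z, hz⟩ := hr
      by_cases hz0 : z.2 = 0
      · refine ⟨1, one_pos, fun h _ => ?_⟩
        rintro ⟨z', hz', hzz'⟩
        rw [hj.injective (hzz'.trans hz.symm)] at hz'
        exact ht.1.ne' (haxis t ⟨ht.1.le, ht.2⟩ ⟨z, ⟨hz'.1, hz0⟩, hz⟩)
      · refine ⟨|z.2|, abs_pos.2 hz0, fun h hh => ?_⟩
        rintro ⟨z', hz', hzz'⟩
        rw [hj.injective (hzz'.trans hz.symm)] at hz'
        exact absurd (abs_le.2 hz'.2) (not_le.2 hh)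
    · refine ⟨1, one_pos, fun h _ => ?_⟩
      rintro ⟨z', hz', hzz'⟩
      exact hr ⟨z', hzz'⟩
  obtain ⟨ε, hε, hεO⟩ := Metric.isOpen_iff.1
    ((hj.isOpenMap _ (isOpen_Ioo.prod (isOpen_univ (X := ℝ)))).preimage hf) τ
    (⟨(u, 0), ⟨hu, mem_univ _⟩, hfτ.symm⟩ : τ ∈ f ⁻¹' (j '' (Ioo (-1 : ℝ) 1 ×ˢ univ)))
  set c := min b (τ + ε / 2)
  have hτc : τ < c := lt_min hτb (by linarith)
  obtain ⟨h₁, hh₁, H₁⟩ := key b ⟨hτb, le_rfl⟩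
  obtain ⟨h₂, hh₂, H₂⟩ := key c ⟨hτc, min_le_left _ _⟩
  refine ⟨min h₁ h₂, lt_min hh₁ hh₂, fun h hh => ⟨H₁ h (hh.trans_le (min_le_left _ _)), ?_⟩⟩
  intro t e hτt hsub hte hleg
  have htc : t < c := by
    by_contra! hct
    exact H₂ h (hh.trans_le (min_le_right _ _)) (hsub (mem_image_of_mem f ⟨hτc.le, hct⟩))
  have hball : t ∈ Metric.ball τ ε := by
    rw [Metric.mem_ball, Real.dist_eq, abs_lt]
    have := min_le_right b (τ + ε / 2)
    constructor <;> linarith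
  obtain ⟨z, hz, hzt⟩ := hεO hball
  rw [hj.injective (hzt.trans hte)] at hz
  rcases hleg.exit_frontier with he | he | he
  · exact absurd hz.1.1 (by rw [he]; exact lt_irrefl _)
  · exact absurd hz.1.2 (by rw [he]; exact lt_irrefl _)
  · exact he

theorem exists_measurable_crossers {S : Type*} [MeasurableSpace S] [MeasurableSingletonClass S]
    (m : Measure S) [NullSingletonClass m] {h : ℝ} (hh : 0 < h) {O : Set S} (hO : MeasurableSet O)
    {u : S → ℝ} (hu : Measurable u) (hinj : InjOn u O) {D D' : S → Set (ℝ × ℝ)}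
    {e e' : S → ℝ × ℝ} (hD : ∀ x ∈ O, IsLeg h (u x) (D x) (e x))
    (hD' : ∀ x ∈ O, IsLeg h (u x) (D' x) (e' x)) (hDD' : ∀ x ∈ O, D x ∩ D' x ⊆ {(u x, 0)})
    (hd : O.PairwiseDisjoint fun x => D x ∪ D' x) {G : Set S} (hGO : G ⊆ O)
    (hG : ∀ x ∈ G, |(e x).2| = h ∧ |(e' x).2| = h) (hm : 0 < m G) :
    ∃ P ⊆ O, MeasurableSet P ∧ 0 < m P ∧ ∃ Y : Set (ℝ × ℝ), MeasurableSet Y ∧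
      ∃ Φ : ℝ × ℝ → ℝ, Measurable Φ ∧ ∀ x ∈ P, ∀ z, z ∈ D x ∪ D' x ↔ z ∈ Y ∧ Φ z = u x := by
  let Tch : Set S := {x ∈ O | (|(e x).2| = h ∧ |(e' x).2| = h) ∧ (e x).2 = (e' x).2}
  have hTch : Tch.Countable := by
    have hs : Tch ⊆ O := sep_subset _ _
    exact countable_of_isLeg hh (hinj.mono hs) (fun x hx => hD x (hs hx))
      (fun x hx => hD' x (hs hx)) (fun x hx => hDD' x (hs hx)) (hd.subset hs)
      (fun x hx => hx.2.1.1) (fun x hx => hx.2.2)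
  let Cr : Set S := {x ∈ O | |(e x).2| = h ∧ (e' x).2 = -(e x).2}
  have hCrO : Cr ⊆ O := sep_subset _ _
  have hcr : ∀ x ∈ O, |(e x).2| = h → |(e' x).2| = h → x ∉ Tch → x ∈ Cr := by
    intro x hx h1 h2 hxT
    refine ⟨hx, h1, ?_⟩
    have hne : (e x).2 ≠ (e' x).2 := fun hc => hxT ⟨hx, ⟨h1, h2⟩, hc⟩
    rcases abs_eq_abs.1 (h1.trans h2.symm) with h3 | h3
    · exact absurd h3 hne
    · rw [h3, neg_neg]
  have hGCr : G ⊆ Cr ∪ Tch := fun x hx => by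
    by_cases hxT : x ∈ Tch
    · exact Or.inr hxT
    · exact Or.inl (hcr x (hGO hx) (hG x hx).1 (hG x hx).2 hxT)
  have hmCr : 0 < m Cr := by
    by_contra! h0
    have h1 : m (Cr ∪ Tch) = 0 :=
      measure_union_null (nonpos_iff_eq_zero.1 h0) (hTch.measure_zero m)
    exact hm.ne' (measure_mono_null hGCr h1)
  have hCross : ∀ x ∈ Cr, IsCrosser h (u x) (D x ∪ D' x) := fun x hx =>
    (hD x hx.1).isCrosser (hD' x hx.1) hx.2.1 hx.2.2
  have hedge : ∀ x ∈ Cr, ∀ z ∈ D x ∪ D' x, |z.1| = 1 → |z.2| = h := by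
    have aux : ∀ {D : Set (ℝ × ℝ)} {v : ℝ} {e : ℝ × ℝ}, IsLeg h v D e → |e.2| = h → ∀ z ∈ D,
        |z.1| = 1 → |z.2| = h := fun {D v e} hD he z hz hz1 => by
      by_cases hze : z = e
      · rw [hze, he]
      · exact absurd (abs_lt.2 (hD.inner z hz hze).1) (by rw [hz1]; exact lt_irrefl _)
    rintro x hx z (hz | hz)
    · exact aux (hD x hx.1) hx.2.1 z hz
    · exact aux (hD' x hx.1) (by rw [hx.2.2, abs_neg, hx.2.1]) z hz
  obtain ⟨Q₀, hQ₀, hQ₀c, hQ₀d, -⟩ := exists_countable_subset_dense_left (u '' Cr)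
  obtain ⟨Q, hQ, rfl⟩ := subset_image_iff.1 hQ₀
  have hQc : Q.Countable :=
    countable_of_injective_of_countable_image (hinj.mono (hQ.trans hCrO)) hQ₀c
  let N : S → S → Set S := fun p q => O ∩ u ⁻¹' Ioo (u p) (u q)
  let E₁ : Set S := {x ∈ Cr | ∀ y ∈ Cr, u x ≤ u y}
  let E₂ : Set S := {x ∈ Cr | ∀ y ∈ Cr, u y ≤ u x}
  have hE₁ : m E₁ = 0 := Set.Subsingleton.measure_zero (fun x hx y hy =>
    hinj (hCrO hx.1) (hCrO hy.1) (le_antisymm (hx.2 y hy.1) (hy.2 x hx.1))) m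
  have hE₂ : m E₂ = 0 := Set.Subsingleton.measure_zero (fun x hx y hy =>
    hinj (hCrO hx.1) (hCrO hy.1) (le_antisymm (hy.2 x hx.1) (hx.2 y hy.1))) m
  obtain ⟨p, hp, q, hq, hpq⟩ : ∃ p ∈ Q, ∃ q ∈ Q, 0 < m (N p q) := by
    by_contra! hcon
    have h1 : m (⋃ p ∈ Q, ⋃ q ∈ Q, N p q) = 0 :=
      (measure_biUnion_null_iff hQc).2 fun p hp => (measure_biUnion_null_iff hQc).2 fun q hq =>
        nonpos_iff_eq_zero.1 (hcon p hp q hq)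
    refine hmCr.ne' (measure_mono_null (fun x hx => ?_)
      (measure_union_null (measure_union_null hE₁ hE₂) h1))
    by_cases hx₁ : x ∈ E₁
    · exact Or.inl (Or.inl hx₁)
    by_cases hx₂ : x ∈ E₂
    · exact Or.inl (Or.inr hx₂)
    have hx₁' : ∃ y ∈ Cr, u y < u x := by
      by_contra! hc
      exact hx₁ ⟨hx, hc⟩
    have hx₂' : ∃ y ∈ Cr, u x < u y := by
      by_contra! hc
      exact hx₂ ⟨hx, hc⟩
    obtain ⟨y₁, hy₁, hy₁x⟩ := hx₁'
    obtain ⟨y₂, hy₂, hy₂x⟩ := hx₂'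
    obtain ⟨_, hd1, d₁, hd₁, rfl⟩ := mem_closure_iff.1 (hQ₀d (mem_image_of_mem u hy₁)) _
      isOpen_Iio (hy₁x : u y₁ ∈ Iio (u x))
    obtain ⟨_, hd2, d₂, hd₂, rfl⟩ := mem_closure_iff.1 (hQ₀d (mem_image_of_mem u hy₂)) _
      isOpen_Ioi (hy₂x : u y₂ ∈ Ioi (u x))
    exact Or.inr (mem_biUnion hd₁ (mem_biUnion hd₂ ⟨hCrO hx, hd1, hd2⟩))
  have hNCr : N p q \ Tch ⊆ Cr := by
    rintro x ⟨⟨hxO, hxp, hxq⟩, hxT⟩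
    have hpx : p ≠ x := fun hc => lt_irrefl _ (hc ▸ hxp)
    have hqx : q ≠ x := fun hc => lt_irrefl _ (hc ▸ hxq)
    have hd₁ := hd (hCrO (hQ hp)) hxO hpx
    have hd₂ := hd (hCrO (hQ hq)) hxO hqx
    simp only [Function.onFun] at hd₁ hd₂
    refine hcr x hxO ?_ ?_ hxT
    · exact (hD x hxO).abs_exit_eq (hCross p (hQ hp)) (hCross q (hQ hq)) (hedge p (hQ hp))
        (hedge q (hQ hq)) (hd₁.mono_right subset_union_left) (hd₂.mono_right subset_union_left)
        hxp hxq
    · exact (hD' x hxO).abs_exit_eq (hCross p (hQ hp)) (hCross q (hQ hq)) (hedge p (hQ hp))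
        (hedge q (hQ hq)) (hd₁.mono_right subset_union_right) (hd₂.mono_right subset_union_right)
        hxp hxq
  obtain ⟨Z, hZ, Y, hY, Φ, hΦ, hYΦ⟩ := exists_measurable_of_isCrosser (hinj.mono hCrO) hCross
    (hd.subset hCrO)
  have hN : MeasurableSet (N p q) := hO.inter (hu measurableSet_Ioo)
  have hTZ : (Tch ∪ Z).Countable := hTch.union hZ
  refine ⟨N p q \ (Tch ∪ Z), sdiff_subset.trans inter_subset_left, hN.diff hTZ.measurableSet, ?_,
    Y, hY, Φ, hΦ, fun x hx z => ?_⟩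
  · rwa [measure_sdiff_null (hTZ.measure_zero m)]
  · exact hYΦ x ⟨hNCr ⟨hx.1, fun hc => hx.2 (Or.inl hc)⟩, fun hc => hx.2 (Or.inr hc)⟩ z

theorem exists_isLeg_pair {S : Type*} [TopologicalSpace S] [T2Space S] {j : ℝ × ℝ → S}
    (hj : IsOpenEmbedding j) {f : ℝ → S} (hf : Continuous f) {a τ b u h : ℝ} (haτ : a < τ)
    (hτb : τ < b) (hfτ : f τ = j (u, 0)) (hu : u ∈ Ioo (-1 : ℝ) 1) (hh : 0 < h)
    (haxis : ∀ t ∈ Icc a b, f t ∈ j '' (Icc (-1) 1 ×ˢ {0}) → t = τ)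
    (ha : f a ∉ j '' planeBox h) (hb : f b ∉ j '' planeBox h) :
    ∃ s t, (a ≤ s ∧ s < τ ∧ τ < t ∧ t ≤ b ∧ f '' Icc s t ⊆ j '' planeBox h) ∧
      ∃ e e', (f t = j e ∧ IsLeg h u (j ⁻¹' (f '' Icc τ t)) e) ∧
        f s = j e' ∧ IsLeg h u (j ⁻¹' (f '' Icc s τ)) e' := by
  obtain ⟨t, hτt, htb, hsub, e, he, hleg⟩ := exists_isLeg hj hf hτb hfτ hu hh
    (fun t ht => haxis t ⟨haτ.le.trans ht.1, ht.2⟩) hb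
  obtain ⟨s, hτs, hsa, hsub', e', he', hleg'⟩ := exists_isLeg hj (f := f ∘ Neg.neg)
    (hf.comp continuous_neg) (τ := -τ) (b := -a) (neg_lt_neg haτ) (by simpa using hfτ) hu hh
    (fun t ht hc => by
      have := haxis (-t) ⟨by linarith [ht.2], by linarith [ht.1]⟩ hc
      linarith) (by simpa using ha)
  rw [image_comp, image_neg_Icc, neg_neg] at hsub' hleg'
  refine ⟨-s, t, ⟨by linarith, by linarith, hτt, htb, ?_⟩, e, e', ⟨he, hleg⟩, he', hleg'⟩
  rw [← Icc_union_Icc_eq_Icc (by linarith : -s ≤ τ) hτt.le, image_union]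
  exact union_subset hsub' hsub

theorem eventually_abs_exit_eq_pair {S : Type*} [TopologicalSpace S] {j : ℝ × ℝ → S}
    (hj : IsOpenEmbedding j) {f : ℝ → S} (hf : Continuous f) {a τ b u : ℝ} (haτ : a < τ)
    (hτb : τ < b) (hfτ : f τ = j (u, 0)) (hu : u ∈ Ioo (-1 : ℝ) 1)
    (haxis : ∀ t ∈ Icc a b, f t ∈ j '' (Icc (-1) 1 ×ˢ {0}) → t = τ) :
    ∃ h₀ > 0, ∀ h < h₀, (f a ∉ j '' planeBox h ∧ f b ∉ j '' planeBox h) ∧ ∀ s t e e', s < τ →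
      τ < t → f '' Icc s t ⊆ j '' planeBox h → f t = j e →
        IsLeg h u (j ⁻¹' (f '' Icc τ t)) e → f s = j e' → IsLeg h u (j ⁻¹' (f '' Icc s τ)) e' →
          |e.2| = h ∧ |e'.2| = h := by
  obtain ⟨h₁, hh₁, H₁⟩ := eventually_abs_exit_eq hj hf hτb hfτ hu
    (fun t ht => haxis t ⟨haτ.le.trans ht.1, ht.2⟩)
  obtain ⟨h₂, hh₂, H₂⟩ := eventually_abs_exit_eq hj (f := f ∘ Neg.neg)
    (hf.comp continuous_neg) (τ := -τ) (b := -a) (neg_lt_neg haτ) (by simpa using hfτ) hu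
    (fun t ht hc => by
      have := haxis (-t) ⟨by linarith [ht.2], by linarith [ht.1]⟩ hc
      linarith)
  refine ⟨min h₁ h₂, lt_min hh₁ hh₂, fun h hh => ?_⟩
  obtain ⟨hb, H₁⟩ := H₁ h (hh.trans_le (min_le_left _ _))
  obtain ⟨ha, H₂⟩ := H₂ h (hh.trans_le (min_le_right _ _))
  refine ⟨⟨by simpa using ha, hb⟩, fun s t e e' hs ht hsub he hleg he' hleg' =>
    ⟨H₁ t e ht ((image_mono (Icc_subset_Icc_left hs.le)).trans hsub) he hleg,
      H₂ (-s) e' (neg_lt_neg hs) ?_ (by simpa using he') ?_⟩⟩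
  · rw [image_comp, image_neg_Icc, neg_neg, neg_neg]
    exact (image_mono (Icc_subset_Icc_right ht.le)).trans hsub
  · rw [image_comp, image_neg_Icc, neg_neg, neg_neg]
    exact hleg'

theorem exists_good_arcs {S : Type*} [TopologicalSpace S] [T2Space S] [MeasurableSpace S]
    [BorelSpace S] (m : Measure S) [NullSingletonClass m] {E : Set S} (hE : MeasurableSet E)
    (hmE : 0 < m E) {j : ℝ × ℝ → S} (hj : IsOpenEmbedding j) {f : S → ℝ → S}
    (hf : ∀ x ∈ E, Continuous (f x)) (hfi : ∀ x ∈ E, Injective (f x)) {a b τ : S → ℝ}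
    (haτ : ∀ x ∈ E, a x < τ x) (hτb : ∀ x ∈ E, τ x < b x) {α β : S → S} (hα : Measurable α)
    (hβ : Measurable β) (hαa : ∀ x ∈ E, f x (a x) = α x) (hβb : ∀ x ∈ E, f x (b x) = β x)
    {u : S → ℝ} (hu : Measurable u) (huE : ∀ x ∈ E, u x ∈ Ioo (-1 : ℝ) 1)
    (hfτ : ∀ x ∈ E, f x (τ x) = j (u x, 0))
    (haxis : ∀ x ∈ E, ∀ t ∈ Icc (a x) (b x), f x t ∈ j '' (Icc (-1) 1 ×ˢ {0}) → t = τ x)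
    (hd : E.PairwiseDisjoint fun x => f x '' Icc (a x) (b x)) :
    ∃ P ⊆ E, MeasurableSet P ∧ 0 < m P ∧ ∃ s t : S → ℝ,
      (∀ x ∈ P, a x ≤ s x ∧ s x < τ x ∧ τ x < t x ∧ t x ≤ b x ∧
        f x '' Icc (s x) (t x) ⊆ j '' planeBox 1) ∧
      ∃ Y : Set S, MeasurableSet Y ∧ ∃ Φ : S → ℝ, Measurable Φ ∧
        ∀ x ∈ P, ∀ z, z ∈ f x '' Icc (s x) (t x) ↔ z ∈ Y ∧ Φ z = u x := by
  have hK : ∀ h, IsClosed (j '' planeBox h) := fun h =>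
    ((isCompact_planeBox h).image hj.continuous).isClosed
  let η : ℕ → ℝ := fun n => 1 / (n + 1)
  have hη : ∀ n, 0 < η n := fun n => by positivity
  let O : ℕ → Set S := fun n =>
    E ∩ (α ⁻¹' (j '' planeBox (η n))ᶜ ∩ β ⁻¹' (j '' planeBox (η n))ᶜ)
  have hO : ∀ n, MeasurableSet (O n) := fun n =>
    hE.inter ((hα (hK _).measurableSet.compl).inter (hβ (hK _).measurableSet.compl))
  have hleg : ∀ n, ∀ x ∈ O n, ∃ s t, (a x ≤ s ∧ s < τ x ∧ τ x < t ∧ t ≤ b x ∧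
      f x '' Icc s t ⊆ j '' planeBox (η n)) ∧
      ∃ e e', (f x t = j e ∧ IsLeg (η n) (u x) (j ⁻¹' (f x '' Icc (τ x) t)) e) ∧
        f x s = j e' ∧ IsLeg (η n) (u x) (j ⁻¹' (f x '' Icc s (τ x))) e' := fun n x hx =>
    exists_isLeg_pair hj (hf x hx.1) (haτ x hx.1) (hτb x hx.1) (hfτ x hx.1) (huE x hx.1) (hη n)
      (haxis x hx.1) (by rw [hαa x hx.1]; exact hx.2.1) (by rw [hβb x hx.1]; exact hx.2.2)
  choose! s t hst e e' he he' using hleg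
  let G : ℕ → Set S := fun n => {x ∈ O n | |(e n x).2| = η n ∧ |(e' n x).2| = η n}
  have hEG : E ⊆ ⋃ n, G n := by
    intro x hx
    obtain ⟨h₀, hh₀, H⟩ := eventually_abs_exit_eq_pair hj (hf x hx) (haτ x hx) (hτb x hx)
      (hfτ x hx) (huE x hx) (haxis x hx)
    obtain ⟨n, hn⟩ := exists_nat_one_div_lt hh₀
    obtain ⟨⟨h1, h2⟩, H⟩ := H (η n) hn
    rw [hαa x hx] at h1
    rw [hβb x hx] at h2
    have hxO : x ∈ O n := ⟨hx, h1, h2⟩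
    have h3 := hst n x hxO
    exact mem_iUnion.2 ⟨n, hxO, H _ _ _ _ h3.2.1 h3.2.2.1 h3.2.2.2.2 (he n x hxO).1 (he n x hxO).2
      (he' n x hxO).1 (he' n x hxO).2⟩
  obtain ⟨n, hn⟩ : ∃ n, 0 < m (G n) := by
    by_contra! hc
    exact hmE.ne' (measure_mono_null hEG (measure_iUnion_null fun n => nonpos_iff_eq_zero.1 (hc n)))
  have hOE : O n ⊆ E := inter_subset_left
  have hinter : ∀ x ∈ O n, j ⁻¹' (f x '' Icc (τ x) (t n x)) ∪ j ⁻¹' (f x '' Icc (s n x) (τ x)) =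
      j ⁻¹' (f x '' Icc (s n x) (t n x)) := fun x hx => by
    have h3 := hst n x hx
    rw [← preimage_union, ← image_union, union_comm,
      Icc_union_Icc_eq_Icc h3.2.1.le h3.2.2.1.le]
  have hsubab : ∀ x ∈ O n, f x '' Icc (s n x) (t n x) ⊆ f x '' Icc (a x) (b x) := fun x hx =>
    image_mono (Icc_subset_Icc (hst n x hx).1 (hst n x hx).2.2.2.1)
  have hinj : InjOn u (O n) := fun x hx y hy hxy => by
    by_contra hne
    refine disjoint_left.1 (hd (hOE hx) (hOE hy) hne)
      ⟨τ x, ⟨(haτ x hx.1).le, (hτb x hx.1).le⟩, rfl⟩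
      ⟨τ y, ⟨(haτ y hy.1).le, (hτb y hy.1).le⟩, ?_⟩
    rw [hfτ x hx.1, hfτ y hy.1, hxy]
  obtain ⟨P, hPO, hP, hmP, Y, hY, Φ, hΦ, H⟩ := exists_measurable_crossers m (hη n) (hO n) hu hinj
    (fun x hx => (he n x hx).2) (fun x hx => (he' n x hx).2) (fun x hx z hz => by
      obtain ⟨⟨c, hc, hcz⟩, d, hd', hdz⟩ := hz
      have hcd : c = d := hfi x hx.1 (hcz.trans hdz.symm)
      have hcτ : c = τ x := le_antisymm (hcd ▸ hd'.2) hc.1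
      rw [hcτ, hfτ x hx.1] at hcz
      exact (hj.injective hcz).symm) (fun x hx y hy hne => by
      simp only [Function.onFun]
      rw [hinter x hx, hinter y hy]
      exact ((hd (hOE hx) (hOE hy) hne).mono (hsubab x hx) (hsubab y hy)).preimage j)
    (sep_subset _ _) (fun x hx => hx.2) hn
  have hbox : ∀ x ∈ P, f x '' Icc (s n x) (t n x) ⊆ j '' planeBox 1 := fun x hx =>
    (hst n x (hPO hx)).2.2.2.2.trans (image_mono (prod_mono le_rfl (Icc_subset_Icc
      (neg_le_neg ((div_le_one (by positivity)).2 (by simp)))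
      ((div_le_one (by positivity)).2 (by simp)))))
  obtain ⟨Ψ, hΨ, hΨj⟩ := hj.measurableEmbedding.exists_measurable_extend hΦ fun _ => inferInstance
  refine ⟨P, hPO.trans hOE, hP, hmP, s n, t n, fun x hx => ?_, j '' Y,
    hj.measurableEmbedding.measurableSet_image.2 hY, Ψ, hΨ, fun x hx z => ?_⟩
  · have h3 := hst n x (hPO hx)
    exact ⟨h3.1, h3.2.1, h3.2.2.1, h3.2.2.2.1, hbox x hx⟩
  · have H' := H x hx
    rw [hinter x (hPO hx)] at H'
    constructor
    · intro hz
      obtain ⟨w, -, rfl⟩ := hbox x hx hz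
      obtain ⟨h1, h2⟩ := (H' w).1 hz
      exact ⟨mem_image_of_mem j h1, by rw [← h2]; exact congrFun hΨj w⟩
    · rintro ⟨⟨w, hw, rfl⟩, h2⟩
      exact (H' w).2 ⟨hw, by rw [← h2]; exact (congrFun hΨj w).symm⟩

section Reparametrization

variable {S : Type*} [TopologicalSpace S] [T2Space S] {f γ : ℝ → S} {φ : ℝ → ℝ}

theorem continuousOn_of_comp_eq_of_mapsTo (hf : Continuous f) (hfi : Injective f)
    (hγ : Continuous γ) (hφ : ∀ s, f (φ s) = γ s) {A : Set ℝ} {a b : ℝ}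
    (hA : MapsTo φ A (Icc a b)) : ContinuousOn φ A := by
  have he : IsClosedEmbedding (fun t : Icc a b => f t) :=
    (hf.comp continuous_subtype_val).isClosedEmbedding (hfi.comp Subtype.val_injective)
  rw [continuousOn_iff_continuous_domRestrict]
  have h1 : Continuous (fun s : A => (⟨φ s, hA s.2⟩ : Icc a b)) := by
    rw [he.isInducing.continuous_iff]
    exact (hγ.comp continuous_subtype_val).congr fun s => (hφ s).symm
  exact continuous_subtype_val.comp h1

theorem isClosed_preimage_Icc_of_comp_eq (hf : Continuous f) (hfi : Injective f)
    (hγ : Continuous γ) (hφ : ∀ s, f (φ s) = γ s) (a b : ℝ) : IsClosed (φ ⁻¹' Icc a b) := by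
  have h1 : φ ⁻¹' Icc a b = γ ⁻¹' (f '' Icc a b) := by
    ext s
    rw [mem_preimage, mem_preimage, ← hφ, hfi.mem_set_image]
  rw [h1]
  exact (isCompact_Icc.image hf).isClosed.preimage hγ

theorem tendsto_atTop_or_eq_of_comp_eq (hf : Continuous f) (hfi : Injective f)
    (hγ : Continuous γ) (hφ : ∀ s, f (φ s) = γ s) {c s M : ℝ} (hcs : c < s)
    (hM : ∀ r ∈ Ioc c s, M < φ r) (hcont : ContinuousOn φ (Ioc c s)) (hc : φ c ≤ M) :
    φ c = M ∨ Tendsto f atTop (𝓝 (γ c)) := by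
  by_cases hfreq : ∃ N, ∃ᶠ r in 𝓝[>] c, φ r ≤ N
  · obtain ⟨N, hN⟩ := hfreq
    left
    have h1 : c ∈ closure (φ ⁻¹' Icc M N) := by
      rw [mem_closure_iff_frequently]
      have h2 : ∃ᶠ r in 𝓝[>] c, r ∈ φ ⁻¹' Icc M N :=
        (hN.and_eventually (Ioc_mem_nhdsGT hcs)).mono fun r hr => ⟨(hM r hr.2).le, hr.1⟩
      exact h2.filter_mono nhdsWithin_le_nhds
    rw [(isClosed_preimage_Icc_of_comp_eq hf hfi hγ hφ M N).closure_eq] at h1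
    exact le_antisymm hc h1.1
  · right
    push Not at hfreq
    intro V hV
    have h1 : ∀ᶠ r in 𝓝 c, r ∈ γ ⁻¹' V := hγ.continuousAt hV
    obtain ⟨ε, hε, hεV⟩ := Metric.eventually_nhds_iff.1 h1
    set d := min s (c + ε / 2) with hd
    have hcd : c < d := lt_min hcs (by linarith)
    have hdV : ∀ r ∈ Ioc c d, γ r ∈ V := fun r hr => hεV (by
      rw [Real.dist_eq, abs_of_pos (by linarith [hr.1])]
      linarith [hr.2, min_le_right s (c + ε / 2)])
    refine mem_map.2 (mem_of_superset (Ici_mem_atTop (φ d)) fun t ht => ?_)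
    obtain ⟨r, hr, hr1⟩ := ((hfreq t).and (Ioc_mem_nhdsGT hcd)).exists
    obtain ⟨q, hq, rfl⟩ := intermediate_value_Icc' hr1.2
      (hcont.mono fun q hq => ⟨hr1.1.trans_le hq.1, hq.2.trans (min_le_left _ _)⟩) ⟨ht, hr.le⟩
    rw [mem_preimage, hφ]
    exact hdV q ⟨hr1.1.trans_le hq.1, hq.2⟩

theorem exists_tendsto_or_abs_eq_of_comp_eq (hf : Continuous f) (hfi : Injective f)
    (hγ : Continuous γ) (hφ : ∀ s, f (φ s) = γ s) {r s M : ℝ} (hM0 : 0 ≤ M) (hrs : r ≤ s)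
    (hr : |φ r| ≤ M) (hs : M < |φ s|)
    (hb : ∀ q ∈ Icc r s, M < |φ q| → ∃ N, ∀ᶠ q' in 𝓝 q, |φ q'| ≤ N) :
    ∃ c ∈ Icc r s, |φ c| = M ∨ Tendsto f atTop (𝓝 (γ c)) ∨ Tendsto f atBot (𝓝 (γ c)) := by
  have hK : IsCompact (Icc r s ∩ φ ⁻¹' Icc (-M) M) :=
    isCompact_Icc.inter_right (isClosed_preimage_Icc_of_comp_eq hf hfi hγ hφ _ _)
  obtain ⟨c, ⟨hc, hcM⟩, hmax⟩ := hK.exists_isGreatest ⟨r, ⟨le_rfl, hrs⟩, abs_le.1 hr⟩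
  have hcs : c < s := lt_of_le_of_ne hc.2 fun h => not_lt.2 (abs_le.2 hcM) (h ▸ hs)
  have hgt : ∀ q ∈ Ioc c s, M < |φ q| := fun q hq => by
    by_contra! h
    exact absurd hq.1 (not_lt.2 (hmax ⟨⟨hc.1.trans hq.1.le, hq.2⟩, abs_le.1 h⟩))
  have hcont : ContinuousOn φ (Ioc c s) := fun q hq => by
    obtain ⟨N, hN⟩ := hb q ⟨hc.1.trans hq.1.le, hq.2⟩ (hgt q hq)
    exact ((continuousOn_of_comp_eq_of_mapsTo hf hfi hγ hφ (A := {q' | |φ q'| ≤ N})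
      fun q' hq' => abs_le.1 hq').continuousAt hN).continuousWithinAt
  refine ⟨c, hc, ?_⟩
  have hpc : IsPreconnected (Ioc c s) := isPreconnected_Ioc
  rcases lt_or_ge 0 (φ s) with hpos | hneg
  · have h1 : ∀ q ∈ Ioc c s, M < φ q := fun q hq => by
      by_contra! hle
      have h2 : φ q < -M := by
        rcases lt_abs.1 (hgt q hq) with h | h <;> linarith
      obtain ⟨q', hq', h0⟩ := hpc.intermediate_value hq (right_mem_Ioc.2 hcs) hcont
        (⟨by linarith, hpos.le⟩ : (0 : ℝ) ∈ Icc (φ q) (φ s))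
      have := hgt q' hq'
      rw [h0, abs_zero] at this
      linarith
    rcases tendsto_atTop_or_eq_of_comp_eq hf hfi hγ hφ hcs h1 hcont hcM.2 with h | h
    · exact Or.inl (by rw [h, abs_of_nonneg hM0])
    · exact Or.inr (Or.inl h)
  · have h1 : ∀ q ∈ Ioc c s, M < (-φ) q := fun q hq => by
      by_contra! hle
      have h2 : M < φ q := by
        rcases lt_abs.1 (hgt q hq) with h | h
        · exact h
        · exact absurd h (not_lt.2 hle)
      obtain ⟨q', hq', h0⟩ := hpc.intermediate_value (right_mem_Ioc.2 hcs) hq hcont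
        (⟨hneg, by linarith⟩ : (0 : ℝ) ∈ Icc (φ s) (φ q))
      have := hgt q' hq'
      rw [h0, abs_zero] at this
      linarith
    rcases tendsto_atTop_or_eq_of_comp_eq (f := f ∘ Neg.neg) (φ := -φ) (hf.comp continuous_neg)
      (hfi.comp neg_injective) hγ (fun q => by simp [hφ]) hcs h1 hcont.neg
      (by simpa using neg_le.1 hcM.1) with h | h
    · left
      rw [← abs_neg, ← Pi.neg_apply, h, abs_of_nonneg hM0]
    · refine Or.inr (Or.inr ?_)
      simpa [Function.comp_def] using h.comp tendsto_neg_atBot_atTop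

theorem eventually_abs_le_of_comp_eq (hf : Continuous f) (hfi : Injective f)
    (hγ : Continuous γ) (hγi : Injective γ) (hφ : ∀ s, f (φ s) = γ s) {s₀ : ℝ}
    (htop : ¬ Tendsto f atTop (𝓝 (γ s₀))) (hbot : ¬ Tendsto f atBot (𝓝 (γ s₀))) :
    ∃ N, ∀ᶠ s in 𝓝 s₀, |φ s| ≤ N := by
  have hφi : Injective φ := fun s t hst => hγi (by rw [← hφ, ← hφ, hst])
  let T : Set ℝ := {s | ¬ ∃ N, ∀ᶠ s' in 𝓝 s, |φ s'| ≤ N}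
  let L : Set ℝ := {s | Tendsto f atTop (𝓝 (γ s)) ∨ Tendsto f atBot (𝓝 (γ s))}
  have hT : IsClosed T := by
    rw [← isOpen_compl_iff, isOpen_iff_mem_nhds]
    intro s hs
    simp only [T, mem_compl_iff, mem_ofPred_eq, not_not] at hs
    obtain ⟨N, hN⟩ := hs
    filter_upwards [eventually_eventually_nhds.2 hN] with s' hs'
    simp only [T, mem_compl_iff, mem_ofPred_eq, not_not]
    exact ⟨N, hs'⟩
  have hL : L.Finite := by
    refine Set.Finite.union (s := {s | Tendsto f atTop (𝓝 (γ s))})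
      (t := {s | Tendsto f atBot (𝓝 (γ s))}) (Set.Subsingleton.finite fun s hs t ht => ?_)
      (Set.Subsingleton.finite fun s hs t ht => ?_)
    · exact hγi (tendsto_nhds_unique hs ht)
    · exact hγi (tendsto_nhds_unique hs ht)
  by_contra hs₀
  have hs₀T : s₀ ∈ T := hs₀
  have hs₀L : s₀ ∉ L := not_or.2 ⟨htop, hbot⟩
  have : CompleteSpace T := hT.completeSpace_coe
  have hdense := dense_iUnion_interior_of_closed (X := T)
    (f := fun n : ℕ => Subtype.val ⁻¹' (φ ⁻¹' Icc (-(n : ℝ)) n))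
    (fun n => (isClosed_preimage_Icc_of_comp_eq hf hfi hγ hφ _ _).preimage continuous_subtype_val)
    (eq_univ_of_forall fun s => by
      obtain ⟨n, hn⟩ := exists_nat_ge |φ s|
      exact mem_iUnion.2 ⟨n, abs_le.1 hn⟩)
  obtain ⟨s₁, hs₁L, hs₁⟩ := hdense.inter_open_nonempty (Subtype.val ⁻¹' Lᶜ)
    (hL.isClosed.isOpen_compl.preimage continuous_subtype_val) ⟨⟨s₀, hs₀T⟩, hs₀L⟩
  obtain ⟨n, hn⟩ := mem_iUnion.1 hs₁
  rw [mem_interior_iff_mem_nhds, nhds_subtype_eq_comap, mem_comap] at hn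
  obtain ⟨V, hV, hVn⟩ := hn
  have hφs₁ : |φ s₁| ≤ n := abs_le.2 (hVn (mem_of_mem_nhds hV : (s₁ : ℝ) ∈ V))
  let F : Set ℝ := L ∪ φ ⁻¹' {((n : ℝ) + 1), -((n : ℝ) + 1)}
  have hF : F.Finite := hL.union ((toFinite _).preimage hφi.injOn)
  have hs₁F : (s₁ : ℝ) ∉ F := by
    rintro (h | h | h)
    · exact hs₁L h
    · rw [h] at hφs₁
      linarith [le_abs_self ((n : ℝ) + 1)]
    · rw [h] at hφs₁
      linarith [neg_le_abs (-((n : ℝ) + 1))]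
  obtain ⟨δ, hδ, hball⟩ := Metric.mem_nhds_iff.1
    (inter_mem hV (hF.isClosed.isOpen_compl.mem_nhds hs₁F))
  rw [Real.ball_eq_Ioo] at hball
  refine s₁.2 ⟨n + 1, mem_of_superset (Ioo_mem_nhds (by linarith : (s₁ : ℝ) - δ < s₁)
    (by linarith : (s₁ : ℝ) < s₁ + δ)) fun s hs => ?_⟩
  by_contra hlt
  rw [mem_ofPred_eq, not_le] at hlt
  have hT' : ∀ q ∈ Ioo ((s₁ : ℝ) - δ) (s₁ + δ), (n : ℝ) + 1 < |φ q| →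
      ∃ N, ∀ᶠ q' in 𝓝 q, |φ q'| ≤ N := fun q hq hlt => by
    by_contra hqT
    have := abs_le.2 (hVn (a := ⟨q, hqT⟩) (hball hq).1)
    simp only at this
    linarith
  have hFout : ∀ c ∈ Ioo ((s₁ : ℝ) - δ) (s₁ + δ), |φ c| = (n : ℝ) + 1 ∨
      Tendsto f atTop (𝓝 (γ c)) ∨ Tendsto f atBot (𝓝 (γ c)) → False := fun c hc h => by
    refine (hball hc).2 ?_
    rcases h with h | h
    · exact Or.inr ((abs_eq (by positivity)).1 h)
    · exact Or.inl h
  rcases le_total (s₁ : ℝ) s with hle | hle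
  · have hsub : Icc (s₁ : ℝ) s ⊆ Ioo ((s₁ : ℝ) - δ) (s₁ + δ) := fun q hq =>
      ⟨by linarith [hq.1], by linarith [hq.2, hs.2]⟩
    obtain ⟨c, hc, h⟩ := exists_tendsto_or_abs_eq_of_comp_eq hf hfi hγ hφ
      (by positivity : (0 : ℝ) ≤ n + 1) hle (by linarith) hlt fun q hq => hT' q (hsub hq)
    exact hFout c (hsub hc) h
  · have hsub : ∀ q ∈ Icc (-(s₁ : ℝ)) (-s), -q ∈ Ioo ((s₁ : ℝ) - δ) (s₁ + δ) := fun q hq =>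
      ⟨by linarith [hq.2, hs.1], by linarith [hq.1]⟩
    obtain ⟨c, hc, h⟩ := exists_tendsto_or_abs_eq_of_comp_eq (γ := γ ∘ Neg.neg)
      (φ := φ ∘ Neg.neg) hf hfi (hγ.comp continuous_neg) (fun q => hφ (-q))
      (by positivity : (0 : ℝ) ≤ n + 1) (neg_le_neg hle) (by simp; linarith) (by simpa using hlt)
      fun q hq hlt => by
        obtain ⟨N, hN⟩ := hT' (-q) (hsub q hq) hlt
        exact ⟨N, continuous_neg.continuousAt.eventually hN⟩
    exact hFout (-c) (hsub c hc) h

theorem exists_subset_arc_and_nhds (hf : Continuous f) (hfi : Injective f)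
    (hγ : Continuous γ) (hγi : Injective γ) (hγf : range γ ⊆ range f) {s₀ t₀ a b : ℝ}
    (hst : f t₀ = γ s₀) (ht₀ : t₀ ∈ Ioo a b) (htop : ¬ Tendsto f atTop (𝓝 (γ s₀)))
    (hbot : ¬ Tendsto f atBot (𝓝 (γ s₀))) {ε : ℝ} (hε : 0 < ε) :
    ∃ δ, 0 < δ ∧ δ ≤ ε ∧ (∀ s ∈ Icc (s₀ - δ) (s₀ + δ), γ s ∈ f '' Icc a b) ∧
      ∃ V ∈ 𝓝 (γ s₀), f '' Icc a b ∩ V ⊆ γ '' Ioo (s₀ - δ) (s₀ + δ) := by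
  choose φ hφ using fun s => hγf (mem_range_self s)
  have hφi : Injective φ := fun s t hst => hγi (by rw [← hφ, ← hφ, hst])
  have hφ₀ : φ s₀ = t₀ := hfi ((hφ s₀).trans hst.symm)
  obtain ⟨N, hN⟩ := eventually_abs_le_of_comp_eq hf hfi hγ hγi hφ htop hbot
  have hcA : ContinuousOn φ {s | |φ s| ≤ N} :=
    continuousOn_of_comp_eq_of_mapsTo hf hfi hγ hφ fun s hs => abs_le.1 hs
  have hca : ContinuousAt φ s₀ := hcA.continuousAt hN
  obtain ⟨δ', hδ', hball⟩ := Metric.mem_nhds_iff.1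
    (inter_mem hN (hca.preimage_mem_nhds (Ioo_mem_nhds (hφ₀ ▸ ht₀.1) (hφ₀ ▸ ht₀.2))))
  rw [Real.ball_eq_Ioo] at hball
  set δ := min ε (δ' / 2) with hδdef
  have hδ : 0 < δ := lt_min hε (by linarith)
  have hδ2 : δ ≤ δ' / 2 := min_le_right _ _
  have hsub : Icc (s₀ - δ) (s₀ + δ) ⊆ Ioo (s₀ - δ') (s₀ + δ') := fun s hs =>
    ⟨by linarith [hs.1], by linarith [hs.2]⟩
  refine ⟨δ, hδ, min_le_left _ _, fun s hs =>
    ⟨φ s, Ioo_subset_Icc_self (hball (hsub hs)).2, hφ s⟩, ?_⟩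
  have hsub2 : Icc (s₀ - δ / 2) (s₀ + δ / 2) ⊆ Ioo (s₀ - δ) (s₀ + δ) := fun s hs =>
    ⟨by linarith [hs.1], by linarith [hs.2]⟩
  have hcI : ContinuousOn φ (Icc (s₀ - δ / 2) (s₀ + δ / 2)) :=
    hcA.mono fun s hs => (hball (hsub (Ioo_subset_Icc_self (hsub2 hs)))).1
  have hs₀ : s₀ ∈ Icc (s₀ - δ / 2) (s₀ + δ / 2) := ⟨by linarith, by linarith⟩
  have hl : s₀ - δ / 2 ∈ Icc (s₀ - δ / 2) (s₀ + δ / 2) := ⟨le_rfl, by linarith⟩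
  have hr : s₀ + δ / 2 ∈ Icc (s₀ - δ / 2) (s₀ + δ / 2) := ⟨by linarith, le_rfl⟩
  obtain ⟨lo, hi, ht₀', hI⟩ : ∃ lo hi, t₀ ∈ Ioo lo hi ∧
      Icc lo hi ⊆ φ '' Icc (s₀ - δ / 2) (s₀ + δ / 2) := by
    rcases hcI.strictMonoOn_of_injOn_Icc' (by linarith) hφi.injOn with h | h
    · exact ⟨_, _, hφ₀ ▸ ⟨h hl hs₀ (by linarith), h hs₀ hr (by linarith)⟩,
        intermediate_value_Icc (by linarith) hcI⟩
    · exact ⟨_, _, hφ₀ ▸ ⟨h hs₀ hr (by linarith), h hl hs₀ (by linarith)⟩,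
        intermediate_value_Icc' (by linarith) hcI⟩
  have hK : IsCompact (f '' (Icc a b \ Ioo lo hi)) :=
    (isCompact_Icc.diff isOpen_Ioo).image hf
  refine ⟨_, hK.isClosed.isOpen_compl.mem_nhds (fun hc => ?_), ?_⟩
  · rw [← hst, hfi.mem_set_image] at hc
    exact hc.2 ht₀'
  · rintro _ ⟨⟨t, ht, rfl⟩, htV⟩
    rw [mem_compl_iff, hfi.mem_set_image] at htV
    have : t ∈ Ioo lo hi := by_contra fun hc => htV ⟨ht, hc⟩
    obtain ⟨s, hs, rfl⟩ := hI (Ioo_subset_Icc_self this)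
    exact ⟨s, hsub2 hs, (hφ s).symm⟩

end Reparametrization

theorem measure_setOf_exists_isOpen_null {X Y : Type*} [MeasurableSpace X] [TopologicalSpace Y]
    [SecondCountableTopology Y] (m : Measure X) (H : Set X) (F : X → Y) :
    m {x ∈ H | ∃ V, IsOpen V ∧ F x ∈ V ∧ m (H ∩ F ⁻¹' V) = 0} = 0 := by
  have hb := TopologicalSpace.isBasis_countableBasis Y
  refine measure_mono_null (t := ⋃ V ∈ {V ∈ TopologicalSpace.countableBasis Y |
    m (H ∩ F ⁻¹' V) = 0}, H ∩ F ⁻¹' V) ?_ ((measure_biUnion_null_iff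
      ((TopologicalSpace.countable_countableBasis Y).mono (sep_subset _ _))).2 fun V hV => hV.2)
  rintro x ⟨hx, V, hV, hxV, hm⟩
  obtain ⟨V', hV', hxV', hsub⟩ := hb.exists_subset_of_mem_open hxV hV
  exact mem_biUnion (x := V') ⟨hV', measure_mono_null
    (inter_subset_inter_right _ (preimage_mono hsub)) hm⟩ ⟨hx, hxV'⟩

theorem exists_mem_forall_isOpen_measure_pos {X Y : Type*} [MeasurableSpace X]
    [TopologicalSpace Y] [SecondCountableTopology Y] {m : Measure X} {H : Set X} (hH : 0 < m H)
    (F : X → Y) : ∃ x ∈ H, ∀ V, IsOpen V → F x ∈ V → 0 < m (H ∩ F ⁻¹' V) := by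
  by_contra! hc
  refine hH.ne' (measure_mono_null (fun x hx => ?_) (measure_setOf_exists_isOpen_null m H F))
  obtain ⟨V, hV, hxV, hm⟩ := hc x hx
  exact ⟨hx, V, hV, hxV, nonpos_iff_eq_zero.1 hm⟩

theorem exists_notMem_measure_section_pos {X Y : Type*} [MeasurableSpace X] [MeasurableSpace Y]
    {m₁ : Measure X} {m₂ : Measure Y} [SFinite m₁] [SFinite m₂] {M : Set (X × Y)}
    (hM : MeasurableSet M) (hpos : 0 < (m₁.prod m₂) M) {Z : Set Y} (hZ : m₂ Z = 0) :
    ∃ y ∉ Z, 0 < m₁ ((fun x => (x, y)) ⁻¹' M) := by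
  by_contra! hc
  refine hpos.ne' ?_
  rw [Measure.prod_apply_symm hM]
  refine (lintegral_congr_ae ?_).trans lintegral_zero
  filter_upwards [measure_eq_zero_iff_ae_notMem.1 hZ] with y hy
  exact nonpos_iff_eq_zero.1 (hc y hy)

theorem measure_section_null_of_forall {X Y : Type*} [MeasurableSpace X] [MeasurableSpace Y]
    {m₁ : Measure X} {m₂ : Measure Y} [SFinite m₁] [SFinite m₂] {M : Set (X × Y)}
    (hM : MeasurableSet M) (h : ∀ x, m₂ (Prod.mk x ⁻¹' M) = 0) :
    m₂ {y | m₁ ((fun x => (x, y)) ⁻¹' M) ≠ 0} = 0 := by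
  have h0 : (m₁.prod m₂) M = 0 := by
    rw [Measure.prod_apply hM]
    simp [h]
  rw [Measure.prod_apply_symm hM, lintegral_eq_zero_iff (measurable_measure_prodMk_right hM)] at h0
  exact h0

theorem measurableSet_setOf_exists_isOpen_null {X Y Z : Type*} [MeasurableSpace X]
    [MeasurableSpace Y] [TopologicalSpace Z] [SecondCountableTopology Z] [MeasurableSpace Z]
    [OpensMeasurableSpace Z] (m : Measure Y) [SFinite m] {Q : Set Y} (hQ : MeasurableSet Q)
    {ψ : X → Y → Z} (hψ : Measurable (uncurry ψ)) :
    MeasurableSet {z : X × Y | z.2 ∈ Q ∧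
      ∃ V, IsOpen V ∧ ψ z.1 z.2 ∈ V ∧ m (Q ∩ ψ z.1 ⁻¹' V) = 0} := by
  have hb := TopologicalSpace.isBasis_countableBasis Z
  have hV : ∀ V ∈ TopologicalSpace.countableBasis Z,
      MeasurableSet {z : X × Y | ψ z.1 z.2 ∈ V ∧ m (Q ∩ ψ z.1 ⁻¹' V) = 0} := fun V hV => by
    have h1 : MeasurableSet (uncurry ψ ⁻¹' V) :=
      hψ (TopologicalSpace.isOpen_of_mem_countableBasis hV).measurableSet
    have h2 : Measurable fun x => m (Q ∩ ψ x ⁻¹' V) :=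
      measurable_measure_prodMk_left ((measurable_snd hQ).inter h1)
    exact h1.inter ((h2.comp measurable_fst) (measurableSet_singleton 0))
  have heq : {z : X × Y | z.2 ∈ Q ∧ ∃ V, IsOpen V ∧ ψ z.1 z.2 ∈ V ∧ m (Q ∩ ψ z.1 ⁻¹' V) = 0} =
      Prod.snd ⁻¹' Q ∩ ⋃ V ∈ TopologicalSpace.countableBasis Z,
        {z : X × Y | ψ z.1 z.2 ∈ V ∧ m (Q ∩ ψ z.1 ⁻¹' V) = 0} := by
    ext z
    constructor
    · rintro ⟨hz, V, hV, hzV, hm⟩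
      obtain ⟨V', hV', hzV', hsub⟩ := hb.exists_subset_of_mem_open hzV hV
      exact ⟨hz, mem_biUnion hV' ⟨hzV', measure_mono_null
        (inter_subset_inter_right _ (preimage_mono hsub)) hm⟩⟩
    · rintro ⟨hz, hz'⟩
      obtain ⟨V, hV, hzV, hm⟩ := mem_iUnion₂.1 hz'
      exact ⟨hz, V, TopologicalSpace.isOpen_of_mem_countableBasis hV, hzV, hm⟩
  rw [heq]
  exact (measurable_snd hQ).inter (.biUnion (TopologicalSpace.countable_countableBasis Z) hV)

theorem exists_axis_chart {S : Type*} [TopologicalSpace S] [T2Space S] {g : ℝ → S}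
    (hg : Continuous g) (hgi : Injective g) {c d : ℝ} {p : S} (hp : p ∈ g '' Ioo c d)
    (htop : ¬ Tendsto g atTop (𝓝 p)) (hbot : ¬ Tendsto g atBot (𝓝 p)) {j₀ : ℝ × ℝ → S}
    (hj₀ : IsOpenEmbedding j₀) (hj₀p : j₀ (0, 0) = p) (hj₀g : ∀ u, j₀ (u, 0) ∈ range g)
    {U : Set S} (hU : IsOpen U) (hpU : p ∈ U) :
    ∃ j : ℝ × ℝ → S, IsOpenEmbedding j ∧ j '' planeBox 1 ⊆ U ∧
      (∀ u ∈ Icc (-1 : ℝ) 1, j (u, 0) ∈ g '' Icc c d) ∧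
      ∃ V, IsOpen V ∧ p ∈ V ∧ ∀ q ∈ g '' Icc c d ∩ V, ∃ u ∈ Ioo (-1 : ℝ) 1, q = j (u, 0) := by
  obtain ⟨t₀, ht₀, rfl⟩ := hp
  have h0 : (0, 0) ∈ j₀ ⁻¹' U := by rwa [mem_preimage, hj₀p]
  obtain ⟨ε, hε, hεU⟩ := Metric.isOpen_iff.1 (hU.preimage hj₀.continuous) _ h0
  have hγ : Continuous fun u : ℝ => j₀ (u, 0) := hj₀.continuous.comp (by fun_prop)
  have hγi : Injective fun u : ℝ => j₀ (u, 0) := fun u v huv =>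
    congrArg Prod.fst (hj₀.injective huv)
  obtain ⟨δ, hδ, hδε, hδA, V, hV, hVA⟩ := exists_subset_arc_and_nhds hg hgi hγ hγi
    (range_subset_iff.2 hj₀g) (s₀ := 0) hj₀p.symm ht₀ (by rwa [hj₀p]) (by rwa [hj₀p])
    (half_pos hε)
  simp only [zero_sub, zero_add] at hδA hVA
  refine ⟨j₀ ∘ (Homeomorph.smulOfNeZero δ hδ.ne'), hj₀.comp (Homeomorph.isOpenEmbedding _), ?_,
    fun u hu => ?_, interior V, isOpen_interior, ?_, fun q hq => ?_⟩
  · rintro _ ⟨z, hz, rfl⟩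
    refine hεU ?_
    rw [mem_ball_iff_norm, Homeomorph.smulOfNeZero_apply, ← Prod.zero_eq_mk, sub_zero, norm_smul,
      Real.norm_of_nonneg hδ.le, Prod.norm_def]
    have h1 : max ‖z.1‖ ‖z.2‖ ≤ 1 := max_le (abs_le.2 hz.1) (abs_le.2 hz.2)
    nlinarith
  · have h1 := hδA (δ * u) ⟨by nlinarith [hu.1], by nlinarith [hu.2]⟩
    simpa using h1
  · have h1 := mem_interior_iff_mem_nhds.2 hV
    rwa [hj₀p] at h1
  · obtain ⟨s, hs, hsq⟩ := hVA ⟨hq.1, interior_subset hq.2⟩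
    refine ⟨δ⁻¹ * s, ⟨?_, ?_⟩, ?_⟩
    · rw [← div_eq_inv_mul, lt_div_iff₀ hδ]
      linarith [hs.1]
    · rw [← div_eq_inv_mul, div_lt_iff₀ hδ]
      linarith [hs.2]
    · simp [hδ.ne', ← hsq]

/-- The arcs `f x '' Icc (a x) (b x)`, `x ∈ P`, are pairwise disjoint and pass through the points
`ψ x y = f x (τ x y)`, `y ∈ Q`, in the order of the values of `κ`. -/
structure IsFibering {S : Type*} [TopologicalSpace S] (P Q : Set S) (ψ : S → S → S)
    (f : S → ℝ → S) (a b : S → ℝ) (τ : S → S → ℝ) (κ : S → ℝ) : Prop where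
  continuous : ∀ x ∈ P, Continuous (f x)
  injective : ∀ x ∈ P, Injective (f x)
  apply_eq : ∀ x ∈ P, ∀ y ∈ Q, f x (τ x y) = ψ x y
  mem_Icc : ∀ x ∈ P, ∀ y ∈ Q, τ x y ∈ Icc (a x) (b x)
  le_iff : ∀ x ∈ P, ∀ y ∈ Q, ∀ y' ∈ Q, τ x y ≤ τ x y' ↔ κ y ≤ κ y'
  disjoint : P.PairwiseDisjoint fun x => f x '' Icc (a x) (b x)

namespace IsFibering

variable {S : Type*} [TopologicalSpace S] {P Q : Set S} {ψ : S → S → S} {f : S → ℝ → S}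
  {a b : S → ℝ} {τ : S → S → ℝ} {κ : S → ℝ}

theorem mono (h : IsFibering P Q ψ f a b τ κ) {P' Q' : Set S} (hP : P' ⊆ P) (hQ : Q' ⊆ Q) :
    IsFibering P' Q' ψ f a b τ κ :=
  ⟨fun x hx => h.continuous x (hP hx), fun x hx => h.injective x (hP hx),
    fun x hx y hy => h.apply_eq x (hP hx) y (hQ hy), fun x hx y hy => h.mem_Icc x (hP hx) y (hQ hy),
    fun x hx y hy y' hy' => h.le_iff x (hP hx) y (hQ hy) y' (hQ hy'), h.disjoint.subset hP⟩

theorem lt_iff (h : IsFibering P Q ψ f a b τ κ) {x y y' : S} (hx : x ∈ P) (hy : y ∈ Q)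
    (hy' : y' ∈ Q) : τ x y < τ x y' ↔ κ y < κ y' := by
  rw [← not_le, h.le_iff x hx y' hy' y hy, not_le]

theorem apply_mem (h : IsFibering P Q ψ f a b τ κ) {x y : S} (hx : x ∈ P) (hy : y ∈ Q) :
    ψ x y ∈ f x '' Icc (a x) (b x) :=
  ⟨τ x y, h.mem_Icc x hx y hy, h.apply_eq x hx y hy⟩

theorem apply_mem_image_iff (h : IsFibering P Q ψ f a b τ κ) {x y : S} (hx : x ∈ P) (hy : y ∈ Q)
    {I : Set ℝ} : ψ x y ∈ f x '' I ↔ τ x y ∈ I := by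
  rw [← h.apply_eq x hx y hy, (h.injective x hx).mem_set_image]

theorem injOn (h : IsFibering P Q ψ f a b τ κ) {y : S} (hy : y ∈ Q) : InjOn (ψ · y) P := by
  intro x hx x' hx' hxx
  by_contra hne
  exact disjoint_left.1 (h.disjoint hx hx' hne) (h.apply_mem hx hy)
    (by rw [show ψ x y = ψ x' y from hxx]; exact h.apply_mem hx' hy)

/-- A family of short measurable subarcs of a fibering, all crossing a given transverse arc. -/
theorem exists_subarcs [T2Space S] [SecondCountableTopology S] [MeasurableSpace S] [BorelSpace S]
    (h : IsFibering P Q ψ f a b τ κ) (m : Measure S) [NullSingletonClass m]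
    (hψ : Measurable (uncurry ψ)) {g : ℝ → S} (hg : Continuous g) (hgi : Injective g) {c d : ℝ}
    {y ya yb : S} (hy : y ∈ Q) (hya : ya ∈ Q) (hyb : yb ∈ Q) (hya' : κ ya < κ y)
    (hyb' : κ y < κ yb) (hinter : ∀ x ∈ P, f x '' Icc (a x) (b x) ∩ g '' Icc c d = {ψ x y})
    {W : Set S} (hchart : ∀ p ∈ W ∩ g '' Icc c d, ∃ j : ℝ × ℝ → S, IsOpenEmbedding j ∧
      j (0, 0) = p ∧ ∀ u, j (u, 0) ∈ range g) {U : Set S} (hU : IsOpen U) {H : Set S}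
    (hHP : H ⊆ P) (hH : MeasurableSet H) (hHU : ∀ x ∈ H, ψ x y ∈ U ∩ W) (hmH : 0 < m H) :
    ∃ P' ⊆ H, MeasurableSet P' ∧ 0 < m P' ∧ ∃ s t : S → ℝ,
      (∀ x ∈ P', a x ≤ s x ∧ s x < τ x y ∧ τ x y < t x ∧ t x ≤ b x ∧
        f x '' Icc (s x) (t x) ⊆ U) ∧
      ∃ Y : Set S, MeasurableSet Y ∧ ∃ Φ : S → ℝ, Measurable Φ ∧ ∃ u : S → ℝ, Measurable u ∧
        InjOn u P' ∧ ∀ x ∈ P', ∀ z, z ∈ f x '' Icc (s x) (t x) ↔ z ∈ Y ∧ Φ z = u x := by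
  have hinj : InjOn (ψ · y) P := h.injOn hy
  have hψy : ∀ y, Measurable (ψ · y) := fun y => hψ.comp measurable_prodMk_right
  have hA : ∀ x ∈ P, ψ x y ∈ g '' Icc c d := fun x hx =>
    ((hinter x hx).symm ▸ rfl : ψ x y ∈ f x '' Icc (a x) (b x) ∩ g '' Icc c d).2
  let X : Set S := {x ∈ H | ψ x y = g c} ∪ {x ∈ H | ψ x y = g d} ∪
    {x ∈ H | Tendsto g atTop (𝓝 (ψ x y))} ∪ {x ∈ H | Tendsto g atBot (𝓝 (ψ x y))}
  have hX : X.Finite := by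
    refine (((Set.Subsingleton.finite ?_).union (Set.Subsingleton.finite ?_)).union
      (Set.Subsingleton.finite ?_)).union (Set.Subsingleton.finite ?_) <;>
    intro x hx x' hx' <;> refine hinj (hHP hx.1) (hHP hx'.1) ?_
    · exact hx.2.trans hx'.2.symm
    · exact hx.2.trans hx'.2.symm
    · exact tendsto_nhds_unique hx.2 hx'.2
    · exact tendsto_nhds_unique hx.2 hx'.2
  have hmX : 0 < m (H \ X) := by rwa [measure_sdiff_null (hX.measure_zero m)]
  obtain ⟨x₀, ⟨hx₀, hx₀X⟩, hsupp⟩ := exists_mem_forall_isOpen_measure_pos hmX (ψ · y)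
  simp only [X, mem_union, not_or] at hx₀X
  obtain ⟨⟨⟨hxc, hxd⟩, hxt⟩, hxb⟩ := hx₀X
  have hp : ψ x₀ y ∈ g '' Ioo c d := by
    obtain ⟨r, hr, hrp⟩ := hA x₀ (hHP hx₀)
    refine ⟨r, ⟨lt_of_le_of_ne hr.1 ?_, lt_of_le_of_ne hr.2 ?_⟩, hrp⟩
    · rintro rfl
      exact hxc ⟨hx₀, hrp.symm⟩
    · rintro rfl
      exact hxd ⟨hx₀, hrp.symm⟩
  obtain ⟨j₀, hj₀, hj₀p, hj₀g⟩ := hchart _ ⟨(hHU x₀ hx₀).2, hA x₀ (hHP hx₀)⟩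
  obtain ⟨j, hj, hjU, hjA, V, hV, hpV, hVA⟩ := exists_axis_chart hg hgi hp
    (fun hc => hxt ⟨hx₀, hc⟩) (fun hc => hxb ⟨hx₀, hc⟩) hj₀ hj₀p hj₀g hU (hHU x₀ hx₀).1
  obtain ⟨Ψ, hΨ, hΨj⟩ := hj.measurableEmbedding.exists_measurable_extend measurable_fst
    fun _ => inferInstance
  let E : Set S := (H \ X) ∩ (ψ · y) ⁻¹' V
  have hEH : E ⊆ H := inter_subset_left.trans sdiff_subset
  have hEP : E ⊆ P := hEH.trans hHP
  have hu : ∀ x ∈ E, Ψ (ψ x y) ∈ Ioo (-1 : ℝ) 1 ∧ ψ x y = j (Ψ (ψ x y), 0) := fun x hx => by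
    obtain ⟨u, hu, hux⟩ := hVA _ ⟨hA x (hEP hx), hx.2⟩
    have h1 : Ψ (ψ x y) = u := by
      rw [hux]
      exact congrFun hΨj (u, 0)
    rw [h1]
    exact ⟨hu, hux⟩
  have hsub : ∀ x ∈ P, Icc (τ x ya) (τ x yb) ⊆ Icc (a x) (b x) := fun x hx =>
    Icc_subset_Icc (h.mem_Icc x hx ya hya).1 (h.mem_Icc x hx yb hyb).2
  obtain ⟨P', hP'E, hP', hmP', s, t, hst, Y, hY, Φ, hΦ, H'⟩ := exists_good_arcs m
    (E := E) ((hH.diff hX.measurableSet).inter (hψy y hV.measurableSet)) (hsupp V hV hpV) hj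
    (fun x hx => h.continuous x (hEP hx)) (fun x hx => h.injective x (hEP hx))
    (fun x hx => (h.lt_iff (hEP hx) hya hy).2 hya') (fun x hx => (h.lt_iff (hEP hx) hy hyb).2 hyb')
    (hψy ya) (hψy yb) (fun x hx => h.apply_eq x (hEP hx) ya hya)
    (fun x hx => h.apply_eq x (hEP hx) yb hyb) (hΨ.comp (hψy y)) (fun x hx => (hu x hx).1)
    (fun x hx => (h.apply_eq x (hEP hx) y hy).trans (hu x hx).2)
    (fun x hx r hr hrj => by
      have h1 : f x r ∈ f x '' Icc (a x) (b x) ∩ g '' Icc c d := by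
        refine ⟨mem_image_of_mem _ (hsub x (hEP hx) hr), ?_⟩
        obtain ⟨⟨v, w⟩, ⟨hv, hw⟩, hvw⟩ := hrj
        obtain rfl : w = 0 := hw
        rw [← hvw]
        exact hjA v hv
      rw [hinter x (hEP hx), mem_singleton_iff, ← h.apply_eq x (hEP hx) y hy] at h1
      exact h.injective x (hEP hx) h1)
    (fun x hx x' hx' hne => (h.disjoint (hEP hx) (hEP hx') hne).mono
      (image_mono (hsub x (hEP hx))) (image_mono (hsub x' (hEP hx'))))
  refine ⟨P', hP'E.trans hEH, hP', hmP', s, t, fun x hx => ?_, Y, hY, Φ, hΦ, _, hΨ.comp (hψy y),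
    fun x hx x' hx' hxx => ?_, H'⟩
  · obtain ⟨h1, h2, h3, h4, h5⟩ := hst x hx
    have hxP := hEP (hP'E hx)
    exact ⟨(h.mem_Icc x hxP ya hya).1.trans h1, h2, h3, h4.trans (h.mem_Icc x hxP yb hyb).2,
      h5.trans hjU⟩
  · refine hinj (hEP (hP'E hx)) (hEP (hP'E hx')) ?_
    change ψ x y = ψ x' y
    rw [(hu x (hP'E hx)).2, (hu x' (hP'E hx')).2]
    exact congrArg (fun r => j (r, 0)) hxx

theorem exists_subfibers [T2Space S] [PolishSpace S] [MeasurableSpace S] [BorelSpace S]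
    (h : IsFibering P Q ψ f a b τ κ) (m₁ m₂ : Measure S) [SFinite m₁] [SFinite m₂]
    [NullSingletonClass m₁] [NullSingletonClass m₂] (hP : MeasurableSet P) (hQ : MeasurableSet Q)
    (hψ : Measurable (uncurry ψ)) (hκ : Measurable κ) (hκi : InjOn κ Q) {g : S → ℝ → S}
    (hg : ∀ y ∈ Q, Continuous (g y)) (hgi : ∀ y ∈ Q, Injective (g y)) {c d : S → ℝ}
    (hinter : ∀ x ∈ P, ∀ y ∈ Q,
      f x '' Icc (a x) (b x) ∩ g y '' Icc (c y) (d y) = {ψ x y})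
    {W : Set S} (hW : MeasurableSet W) (hchart : ∀ y ∈ Q, ∀ p ∈ W ∩ g y '' Icc (c y) (d y),
      ∃ j : ℝ × ℝ → S, IsOpenEmbedding j ∧ j (0, 0) = p ∧ ∀ u, j (u, 0) ∈ range (g y))
    {U : Set S} (hU : IsOpen U)
    (hpos : 0 < (m₁.prod m₂) ((P ×ˢ Q) ∩ uncurry ψ ⁻¹' (U ∩ W))) :
    ∃ P' ⊆ P, MeasurableSet P' ∧ 0 < m₁ P' ∧ ∃ Q' ⊆ Q, MeasurableSet Q' ∧ 0 < m₂ Q' ∧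
      ∃ s t : S → ℝ, (∀ x ∈ P', a x ≤ s x ∧ s x ≤ t x ∧ t x ≤ b x ∧
        f x '' Icc (s x) (t x) ⊆ U ∧ ∀ y ∈ Q', ψ x y ∈ f x '' Icc (s x) (t x)) ∧
      ∀ P'' ⊆ P', MeasurableSet P'' → MeasurableSet (⋃ x ∈ P'', f x '' Icc (s x) (t x)) := by
  set N : Set (S × S) := {z : S × S | z.2 ∈ Q ∧
    ∃ V, IsOpen V ∧ ψ z.1 z.2 ∈ V ∧ m₂ (Q ∩ ψ z.1 ⁻¹' V) = 0} with hNdef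
  have hN : MeasurableSet N := measurableSet_setOf_exists_isOpen_null m₂ hQ hψ
  have hN0 := measure_section_null_of_forall (m₁ := m₁) (m₂ := m₂) hN fun x =>
    measure_setOf_exists_isOpen_null m₂ Q (ψ x)
  have hE₁ : m₂ {y ∈ Q | ∀ y' ∈ Q, κ y ≤ κ y'} = 0 :=
    Set.Subsingleton.measure_zero (fun y hy y' hy' =>
      hκi hy.1 hy'.1 (le_antisymm (hy.2 y' hy'.1) (hy'.2 y hy.1))) m₂
  have hE₂ : m₂ {y ∈ Q | ∀ y' ∈ Q, κ y' ≤ κ y} = 0 :=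
    Set.Subsingleton.measure_zero (fun y hy y' hy' =>
      hκi hy.1 hy'.1 (le_antisymm (hy'.2 y hy.1) (hy.2 y' hy'.1))) m₂
  have hUW : MeasurableSet ((P ×ˢ Q) ∩ uncurry ψ ⁻¹' (U ∩ W)) :=
    (hP.prod hQ).inter (hψ (hU.measurableSet.inter hW))
  obtain ⟨y₀, hy₀, hmy₀⟩ := exists_notMem_measure_section_pos hUW hpos
    (measure_union_null (measure_union_null hN0 hE₁) hE₂)
  rw [mem_union, mem_union, not_or, not_or] at hy₀
  obtain ⟨⟨hy₀N, hy₀₁⟩, hy₀₂⟩ := hy₀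
  rw [mem_ofPred_eq, not_not] at hy₀N
  have hy₀Q : y₀ ∈ Q := by
    obtain ⟨x, hx⟩ := nonempty_of_measure_ne_zero hmy₀.ne'
    exact hx.1.2
  obtain ⟨ya, hya, hya'⟩ : ∃ ya ∈ Q, κ ya < κ y₀ := by
    by_contra! hc
    exact hy₀₁ ⟨hy₀Q, hc⟩
  obtain ⟨yb, hyb, hyb'⟩ : ∃ yb ∈ Q, κ y₀ < κ yb := by
    by_contra! hc
    exact hy₀₂ ⟨hy₀Q, hc⟩
  obtain ⟨P₁, hP₁H, hP₁, hmP₁, s, t, hst, Y, hY, Φ, hΦ, u, hu, hui, H⟩ := h.exists_subarcs m₁ hψ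
    (hg y₀ hy₀Q) (hgi y₀ hy₀Q) hy₀Q hya hyb hya' hyb' (fun x hx => hinter x hx y₀ hy₀Q)
    (hchart y₀ hy₀Q) hU (H := (fun x => (x, y₀)) ⁻¹' ((P ×ˢ Q) ∩ uncurry ψ ⁻¹' (U ∩ W)) \
      (fun x => (x, y₀)) ⁻¹' N) (fun x hx => hx.1.1.1)
    ((measurable_prodMk_right hUW).diff (measurable_prodMk_right hN)) (fun x hx => hx.1.2)
    (by rwa [measure_sdiff_null hy₀N])
  have hP₁P : P₁ ⊆ P := fun x hx => (hP₁H hx).1.1.1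
  let M : Set (S × S) := (P₁ ×ˢ Q) ∩
    {z | ψ z.1 z.2 ∈ Y ∧ Φ (ψ z.1 z.2) = u z.1}
  have hM : MeasurableSet M := (hP₁.prod hQ).inter ((hψ hY).inter
    (measurableSet_eq_fun (hΦ.comp hψ) (hu.comp measurable_fst)))
  have hMiff : ∀ x ∈ P₁, ∀ y ∈ Q, (x, y) ∈ M ↔ τ x y ∈ Icc (s x) (t x) := fun x hx y hy => by
    rw [← h.apply_mem_image_iff (hP₁P hx) hy, H x hx]
    exact ⟨fun h => h.2, fun h => ⟨⟨hx, hy⟩, h⟩⟩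
  have hMx : ∀ x ∈ P₁, 0 < m₂ (Prod.mk x ⁻¹' M) := fun x hx => by
    have hxP := hP₁P hx
    have hK : IsCompact (f x '' (Icc (a x) (b x) \ Ioo (s x) (t x))) :=
      (isCompact_Icc.diff isOpen_Ioo).image (h.continuous x hxP)
    have h1 : ψ x y₀ ∈ (f x '' (Icc (a x) (b x) \ Ioo (s x) (t x)))ᶜ := by
      rw [mem_compl_iff, h.apply_mem_image_iff hxP hy₀Q]
      exact fun hc => hc.2 ⟨(hst x hx).2.1, (hst x hx).2.2.1⟩
    have h2 : (x, y₀) ∉ N := (hP₁H hx).2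
    have h3 : m₂ (Q ∩ ψ x ⁻¹' (f x '' (Icc (a x) (b x) \ Ioo (s x) (t x)))ᶜ) ≠ 0 := fun hc =>
      h2 ⟨hy₀Q, _, hK.isClosed.isOpen_compl, h1, hc⟩
    refine (pos_iff_ne_zero.2 h3).trans_le (measure_mono fun y hy => ?_)
    refine (hMiff x hx y hy.1).2 (Ioo_subset_Icc_self (by_contra fun hc => ?_))
    exact hy.2 ((h.apply_mem_image_iff hxP hy.1).2 ⟨h.mem_Icc x hxP y hy.1, hc⟩)
  have hMpos : 0 < (m₁.prod m₂) M := by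
    rw [Measure.prod_apply hM, pos_iff_ne_zero, Ne,
      lintegral_eq_zero_iff (measurable_measure_prodMk_left hM)]
    intro hc
    refine hmP₁.ne' (measure_mono_null (fun x hx => ?_) hc)
    exact (hMx x hx).ne'
  have hgood := measure_setOf_exists_isOpen_null m₂ Q κ
  set B := {y ∈ Q | ∃ V, IsOpen V ∧ κ y ∈ V ∧ m₂ (Q ∩ κ ⁻¹' V) = 0} with hB
  have hB₁ : m₂ {y ∈ Q \ B | κ y₀ < κ y ∧ ∀ z ∈ Q \ B, κ y₀ < κ z → κ y ≤ κ z} = 0 :=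
    Set.Subsingleton.measure_zero (fun y hy y' hy' => hκi hy.1.1 hy'.1.1 (le_antisymm
      (hy.2.2 y' hy'.1 hy'.2.1) (hy'.2.2 y hy.1 hy.2.1))) m₂
  have hB₂ : m₂ {y ∈ Q \ B | κ y < κ y₀ ∧ ∀ z ∈ Q \ B, κ z < κ y₀ → κ z ≤ κ y} = 0 :=
    Set.Subsingleton.measure_zero (fun y hy y' hy' => hκi hy.1.1 hy'.1.1 (le_antisymm
      (hy'.2.2 y hy.1 hy.2.1) (hy.2.2 y' hy'.1 hy'.2.1))) m₂
  obtain ⟨y₂, hy₂, hmy₂⟩ := exists_notMem_measure_section_pos hM hMpos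
    (measure_union_null (measure_union_null hgood (measure_singleton y₀))
      (measure_union_null hB₁ hB₂))
  have hy₂Q : y₂ ∈ Q := by
    obtain ⟨x, hx⟩ := nonempty_of_measure_ne_zero hmy₂.ne'
    exact hx.1.2
  simp only [mem_union, not_or, mem_singleton_iff] at hy₂
  obtain ⟨⟨hy₂B, hne⟩, hy₂₁, hy₂₂⟩ := hy₂
  have hP'P₁ : (fun x => (x, y₂)) ⁻¹' M ⊆ P₁ := fun x hx => hx.1.1
  have key : ∀ I : Set ℝ, IsOpen I → I ⊆ uIcc (κ y₀) (κ y₂) → (∃ y ∈ Q \ B, κ y ∈ I) →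
      ∃ Q' ⊆ Q, MeasurableSet Q' ∧ 0 < m₂ Q' ∧ ∀ x ∈ (fun x => (x, y₂)) ⁻¹' M, ∀ y ∈ Q',
        τ x y ∈ Icc (s x) (t x) := by
    rintro I hI hIu ⟨y, ⟨hyQ, hyB⟩, hyI⟩
    refine ⟨Q ∩ κ ⁻¹' I, inter_subset_left, hQ.inter (hκ hI.measurableSet),
      pos_iff_ne_zero.2 fun hc => hyB ⟨hyQ, I, hI, hyI, hc⟩, fun x hx y hy => ?_⟩
    have hxP₁ := hP'P₁ hx
    have hxP := hP₁P hxP₁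
    have h1 := (hMiff x hxP₁ y₂ hy₂Q).1 hx
    have h0 := hst x hxP₁
    rcases le_total (κ y₀) (κ y₂) with hle | hle
    · have h2 := hIu hy.2
      rw [uIcc_of_le hle] at h2
      exact ⟨h0.2.1.le.trans ((h.le_iff x hxP y₀ hy₀Q y hy.1).2 h2.1),
        ((h.le_iff x hxP y hy.1 y₂ hy₂Q).2 h2.2).trans h1.2⟩
    · have h2 := hIu hy.2
      rw [uIcc_of_ge hle] at h2
      exact ⟨h1.1.trans ((h.le_iff x hxP y₂ hy₂Q y hy.1).2 h2.1),
        ((h.le_iff x hxP y hy.1 y₀ hy₀Q).2 h2.2).trans h0.2.2.1.le⟩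
  obtain ⟨Q', hQ'Q, hQ', hmQ', hQ's⟩ : ∃ Q' ⊆ Q, MeasurableSet Q' ∧ 0 < m₂ Q' ∧
      ∀ x ∈ (fun x => (x, y₂)) ⁻¹' M, ∀ y ∈ Q', τ x y ∈ Icc (s x) (t x) := by
    have hy₂QB : y₂ ∈ Q \ B := ⟨hy₂Q, hy₂B⟩
    rcases lt_or_gt_of_ne fun hc : κ y₀ = κ y₂ => hne (hκi hy₂Q hy₀Q hc.symm) with hlt | hlt
    · refine key (Ioo (κ y₀) (κ y₂)) isOpen_Ioo
        (by rw [uIcc_of_le hlt.le]; exact Ioo_subset_Icc_self) ?_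
      by_contra! hc
      exact hy₂₁ ⟨hy₂QB, hlt, fun z hz hz' => not_lt.1 fun hz2 => hc z hz ⟨hz', hz2⟩⟩
    · refine key (Ioo (κ y₂) (κ y₀)) isOpen_Ioo
        (by rw [uIcc_of_ge hlt.le]; exact Ioo_subset_Icc_self) ?_
      by_contra! hc
      exact hy₂₂ ⟨hy₂QB, hlt, fun z hz hz' => not_lt.1 fun hz2 => hc z hz ⟨hz2, hz'⟩⟩
  refine ⟨_, hP'P₁.trans hP₁P, measurable_prodMk_right hM, hmy₂, Q', hQ'Q, hQ', hmQ', s, t,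
    fun x hx => ?_, fun P'' hP'' hmP'' => ?_⟩
  · obtain ⟨h1, h2, h3, h4, h5⟩ := hst x (hP'P₁ hx)
    exact ⟨h1, (h2.trans h3).le, h4, h5, fun y hy =>
      (h.apply_mem_image_iff (hP₁P (hP'P₁ hx)) (hQ'Q hy)).2 (hQ's x hx y hy)⟩
  · have hsub : P'' ⊆ P₁ := hP''.trans hP'P₁
    have heq : ⋃ x ∈ P'', f x '' Icc (s x) (t x) = Y ∩ Φ ⁻¹' (u '' P'') := by
      ext z
      simp only [mem_iUnion₂, mem_inter_iff, mem_preimage, mem_image]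
      constructor
      · rintro ⟨x, hx, r, hr, rfl⟩
        obtain ⟨h1, h2⟩ := (H x (hsub hx) _).1 ⟨r, hr, rfl⟩
        exact ⟨h1, x, hx, h2.symm⟩
      · rintro ⟨hz, x, hx, hux⟩
        exact ⟨x, hx, (H x (hsub hx) z).2 ⟨hz, hux.symm⟩⟩
    rw [heq]
    exact hY.inter (hΦ (hmP''.image_of_measurable_injOn hu (hui.mono hsub)))

end IsFibering

theorem TransverseAt.symm {S : Type} [TopologicalSpace S] {ℓ ℓ' : Set S} {x : S}
    (h : TransverseAt ℓ ℓ' x) : TransverseAt ℓ' ℓ x := by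
  obtain ⟨α, β, hα, hβ, hαℓ, hβℓ, U, hU, hxU, e, he₁, he₂⟩ := h
  exact ⟨β, α, hβ, hα, hβℓ, hαℓ, U, hU, hxU, e.trans (Homeomorph.prodComm ℝ ℝ), he₂, he₁⟩

theorem TransverseAt.exists_isOpenEmbedding {S : Type} [TopologicalSpace S] {ℓ ℓ' : Set S} {x : S}
    (h : TransverseAt ℓ ℓ' x) :
    ∃ j : ℝ × ℝ → S, IsOpenEmbedding j ∧ j (0, 0) = x ∧ ∀ u, j (u, 0) ∈ ℓ := by
  obtain ⟨α, β, hα, -, ⟨_, _, f, -, -, rfl, a, b, -, -, -, rfl⟩, -, U, hU, hxU, e, he, -⟩ := h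
  have hx : (e ⟨x, hxU⟩).2 = 0 := by
    obtain ⟨y, hy, hyx⟩ := he.symm.subset ⟨hα, hxU⟩
    obtain rfl : y = ⟨x, hxU⟩ := Subtype.ext hyx
    exact hy
  refine ⟨Subtype.val ∘ e.symm ∘ (Homeomorph.addRight (e ⟨x, hxU⟩)),
    hU.isOpenEmbedding_subtypeVal.comp (e.symm.isOpenEmbedding.comp (Homeomorph.isOpenEmbedding _)),
    ?_, fun u => ?_⟩
  · simp [← Prod.zero_eq_mk]
  · have h1 : ((e.symm ((u, 0) + e ⟨x, hxU⟩) : U) : S) ∈ f '' Icc a b ∩ U := by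
      rw [← he]
      exact ⟨_, by simp [hx], rfl⟩
    exact image_subset_range _ _ h1.1

theorem exists_measurable_leftInverse_on_Icc {S : Type*} [TopologicalSpace S] [T2Space S]
    [MeasurableSpace S] [BorelSpace S] {f : ℝ → S} (hf : Continuous f) (hfi : Injective f)
    (a b : ℝ) : ∃ κ : S → ℝ, Measurable κ ∧ ∀ t ∈ Icc a b, κ (f t) = t := by
  have he : IsClosedEmbedding (fun t : Icc a b => f t) :=
    (hf.comp continuous_subtype_val).isClosedEmbedding (hfi.comp Subtype.val_injective)
  obtain ⟨κ, hκ, h⟩ := he.measurableEmbedding.exists_measurable_extend measurable_subtype_coe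
    fun _ => inferInstance
  exact ⟨κ, hκ, fun t ht => congrFun h ⟨t, ht⟩⟩

/-- The arc `B` is a closed arc, oriented by `ord`, of one of the lines in `L`, parametrized by
`f` on `Icc a b`. -/
structure IsOrientedArc {S : Type*} [TopologicalSpace S] (L : Set (Set S)) (ord : S → S → Prop)
    (B : Set S) (f : ℝ → S) (a b : ℝ) : Prop where
  range_mem : range f ∈ L
  continuous : Continuous f
  injective : Injective f
  le : a ≤ b
  eq_image : B = f '' Icc a b
  ord_iff : ∀ s ∈ Icc a b, ∀ t ∈ Icc a b, (ord (f s) (f t) ↔ s ≤ t)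

theorem IsOrientedArc.restrict {S : Type*} [TopologicalSpace S] {L : Set (Set S)}
    {ord : S → S → Prop} {B : Set S} {f : ℝ → S} {a b s t : ℝ} (h : IsOrientedArc L ord B f a b)
    (has : a ≤ s) (hst : s ≤ t) (htb : t ≤ b) : IsOrientedArc L ord (f '' Icc s t) f s t :=
  ⟨h.range_mem, h.continuous, h.injective, hst, rfl, fun r hr r' hr' =>
    h.ord_iff r (Icc_subset_Icc has htb hr) r' (Icc_subset_Icc has htb hr')⟩

theorem exists_isFibering {S : Type*} [TopologicalSpace S] [T2Space S] [MeasurableSpace S]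
    [BorelSpace S] {fibs fibu L : Set (Set S)} {ord : Set S → S → S → Prop}
    (hdisj : fibu.PairwiseDisjoint id)
    (harc : ∀ B ∈ fibu, ∃ f a b, IsOrientedArc L (ord B) B f a b)
    (hord : ∀ B ∈ fibu, ∀ B' ∈ fibu, ∀ A ∈ fibs, ∀ A' ∈ fibs,
      ∀ p ∈ B ∩ A, ∀ q ∈ B ∩ A', ∀ p' ∈ B' ∩ A, ∀ q' ∈ B' ∩ A', (ord B p q ↔ ord B' p' q'))
    {E F A₀ B₀ : Set S} (hB₀ : B₀ ∈ fibu) (hF : F ⊆ B₀)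
    (hA₀ : ∀ B ∈ fibu, (A₀ ∩ B).Subsingleton) (hE : E ⊆ A₀) {α β : S → Set S}
    (hβ : ∀ x ∈ E, β x ∈ fibu ∧ x ∈ β x) (hα : ∀ y ∈ F, α y ∈ fibs ∧ y ∈ α y)
    {ψ : S → S → S} (hψ : ∀ x ∈ E, ∀ y ∈ F, ψ x y ∈ β x ∩ α y) :
    ∃ f : S → ℝ → S, ∃ a b τ κ, (∀ x ∈ E, IsOrientedArc L (ord (β x)) (β x) (f x) (a x) (b x)) ∧
      Measurable κ ∧ InjOn κ F ∧ IsFibering E F ψ f a b τ κ := by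
  have : Nonempty S := ⟨(harc B₀ hB₀).choose 0⟩
  choose! f a b hf using harc
  have hτ : ∀ x ∈ E, ∀ y ∈ F, ∃ r ∈ Icc (a (β x)) (b (β x)), f (β x) r = ψ x y := by
    intro x hx y hy
    have h1 := (hψ x hx y hy).1
    rw [(hf _ (hβ x hx).1).eq_image] at h1
    exact h1
  choose! τ hτI hτ using hτ
  obtain ⟨κ, hκ, hκf⟩ := exists_measurable_leftInverse_on_Icc (hf _ hB₀).continuous
    (hf _ hB₀).injective (a B₀) (b B₀)
  have hκI : ∀ y ∈ F, κ y ∈ Icc (a B₀) (b B₀) ∧ f B₀ (κ y) = y := fun y hy => by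
    have h1 := hF hy
    rw [(hf _ hB₀).eq_image] at h1
    obtain ⟨r, hr, rfl⟩ := h1
    rw [hκf r hr]
    exact ⟨hr, rfl⟩
  refine ⟨fun x => f (β x), fun x => a (β x), fun x => b (β x), τ, κ, fun x hx =>
    hf _ (hβ x hx).1, hκ, fun y hy y' hy' hyy => ?_, fun x hx => (hf _ (hβ x hx).1).continuous,
    fun x hx => (hf _ (hβ x hx).1).injective, hτ, hτI, fun x hx y hy y' hy' => ?_,
    fun x hx x' hx' hne => ?_⟩
  · rw [← (hκI y hy).2, ← (hκI y' hy').2, hyy]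
  · rw [← (hf _ (hβ x hx).1).ord_iff _ (hτI x hx y hy) _ (hτI x hx y' hy'),
      ← (hf _ hB₀).ord_iff _ (hκI y hy).1 _ (hκI y' hy').1, hτ x hx y hy, hτ x hx y' hy',
      (hκI y hy).2, (hκI y' hy').2]
    exact hord _ (hβ x hx).1 _ hB₀ _ (hα y hy).1 _ (hα y' hy').1 _ (hψ x hx y hy) _
      (hψ x hx y' hy') _ ⟨hF hy, (hα y hy).2⟩ _ ⟨hF hy', (hα y' hy').2⟩
  · have h1 := hdisj (hβ x hx).1 (hβ x' hx').1 fun hc =>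
      hne (hA₀ _ (hβ x hx).1 ⟨hE hx, (hβ x hx).2⟩ ⟨hE hx', hc ▸ (hβ x' hx').2⟩)
    simp only [Function.onFun, id] at h1 ⊢
    rwa [← (hf _ (hβ x hx).1).eq_image, ← (hf _ (hβ x' hx').1).eq_image]

namespace Tartan

variable {μ : Measure S} {Ts Tu : MeasuredTurbulation μ}

/-- The tartan obtained by exchanging the roles of the two turbulations. -/
def swap (R : Tartan Ts Tu) : Tartan Tu Ts where
  Rs := R.Ru
  Ru := R.Rs
  borel_s := R.borel_u
  borel_u := R.borel_s
  fibs := R.fibu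
  fibu := R.fibs
  fibs_disjoint := R.fibu_disjoint
  fibu_disjoint := R.fibs_disjoint
  fibs_cover := R.fibu_cover
  fibu_cover := R.fibs_cover
  inter_unique A hA B hB := inter_comm B A ▸ R.inter_unique B hB A hA
  oriented := by
    obtain ⟨ords, ordu, hs, hu, hsu, hus⟩ := R.oriented
    exact ⟨ordu, ords, hu, hs, hus, hsu⟩
  bounded := by
    obtain ⟨L, hL, hs, hu⟩ := R.bounded
    exact ⟨L, hL, hu, hs⟩
  in_disk := by
    rw [union_comm]
    exact R.in_disk

theorem subsingleton_inter (R : Tartan Ts Tu) {A B : Set S} (hA : A ∈ R.fibs) (hB : B ∈ R.fibu) :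
    (A ∩ B).Subsingleton :=
  fun _ hx _ hy => (R.inter_unique A hA B hB).unique hx hy

theorem isArc_of_subset_line (R : Tartan Ts Tu) {A ℓ : Set S} (hA : A ∈ R.fibs)
    (hℓ : ℓ ∈ Ts.lines) {x : S} (hx : x ∈ A) (hxℓ : x ∈ ℓ) : IsArc ℓ A := by
  obtain ⟨_, _, hs, -⟩ := R.oriented
  obtain ⟨ℓ', hℓ', f, hf, hfi, rfl, a, b, hab, rfl, -⟩ := hs A hA
  obtain rfl := Ts.lines_disjoint.elim_set hℓ hℓ' x hxℓ (image_subset_range _ _ hx)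
  exact ⟨_, _, f, hf, hfi, rfl, a, b, hab, rfl, rfl, rfl⟩

theorem exists_isArc (R : Tartan Ts Tu) {A : Set S} (hA : A ∈ R.fibs) :
    ∃ ℓ ∈ Ts.lines, IsArc ℓ A := by
  obtain ⟨_, _, hs, -⟩ := R.oriented
  obtain ⟨_, hℓ, f, hf, hfi, rfl, a, b, hab, rfl, -⟩ := hs A hA
  exact ⟨_, hℓ, _, _, f, hf, hfi, rfl, a, b, hab, rfl, rfl, rfl⟩

end Tartan

theorem IsArc.subset {S : Type} [TopologicalSpace S] {ℓ A : Set S} (h : IsArc ℓ A) : A ⊆ ℓ := by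
  obtain ⟨_, _, f, -, -, rfl, _, _, -, -, -, rfl⟩ := h
  exact image_subset_range _ _

theorem IsArc.isCompact {S : Type} [TopologicalSpace S] {ℓ A : Set S} (h : IsArc ℓ A) : IsCompact A := by
  obtain ⟨_, _, f, hf, -, -, _, _, -, -, -, rfl⟩ := h
  exact isCompact_Icc.image hf

theorem IsOrientedArc.nonempty {S : Type*} [TopologicalSpace S] {L : Set (Set S)}
    {ord : S → S → Prop} {B : Set S} {f : ℝ → S} {a b : ℝ} (h : IsOrientedArc L ord B f a b) : B.Nonempty := by
  rw [h.eq_image]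
  exact (nonempty_Icc.2 h.le).image f

namespace Tartan

variable {μ : Measure S} {Ts Tu : MeasuredTurbulation μ}

theorem measure_lt_top (R : Tartan Ts Tu) {A ℓ : Set S} (hA : A ∈ R.fibs) (hℓ : ℓ ∈ Ts.lines)
    {x : S} (hx : x ∈ A) (hxℓ : x ∈ ℓ) : Ts.ν ℓ A < ⊤ := by
  obtain ⟨x, y, h⟩ := R.isArc_of_subset_line hA hℓ hx hxℓ
  exact Ts.ν_arc_finite ℓ hℓ A x y h

theorem measurableSet_core (R : Tartan Ts Tu) : MeasurableSet R.core :=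
  R.borel_s.inter R.borel_u

theorem measurableSet_of_mem_fibs [T2Space S] [BorelSpace S] (R : Tartan Ts Tu) {A : Set S}
    (hA : A ∈ R.fibs) : MeasurableSet A := by
  obtain ⟨ℓ, -, h⟩ := R.exists_isArc hA
  exact h.isCompact.measurableSet

theorem mem_core_iff (R : Tartan Ts Tu) {x : S} :
    x ∈ R.core ↔ ∃ A ∈ R.fibs, x ∈ A ∧ ∃ B ∈ R.fibu, x ∈ B := by
  simp only [core, ← R.fibs_cover, ← R.fibu_cover, mem_inter_iff, mem_sUnion]
  tauto

/-- A tartan all of whose fibers are contained in fibers of a compatible tartan is compatible. -/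
theorem Compatible.mono {R R' : Tartan Ts Tu} (h : R.Compatible)
    (hs : ∀ A' ∈ R'.fibs, ∃ A ∈ R.fibs, A' ⊆ A) (hu : ∀ B' ∈ R'.fibu, ∃ B ∈ R.fibu, B' ⊆ B) :
    R'.Compatible := by
  intro A' hA' B' hB' ℓs hℓs hAℓ ℓu hℓu hBℓ
  obtain ⟨A, hA, hAA⟩ := hs A' hA'
  obtain ⟨B, hB, hBB⟩ := hu B' hB'
  obtain ⟨z, ⟨hzA, hzB⟩, -⟩ := R'.inter_unique A' hA' B' hB'
  have hAarc := R.isArc_of_subset_line hA hℓs (hAA hzA) (hAℓ hzA)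
  have hBarc := R.swap.isArc_of_subset_line hB hℓu (hBB hzB) (hBℓ hzB)
  obtain ⟨ψ, hψ, hinj, himg, hmeas, hmeas', hmap⟩ :=
    h A hA B hB ℓs hℓs hAarc.subset ℓu hℓu hBarc.subset
  have hcore : R'.core ⊆ R.core := fun x hx => by
    obtain ⟨C', hC', hxC, D', hD', hxD⟩ := R'.mem_core_iff.1 hx
    obtain ⟨C, hC, hCC⟩ := hs C' hC'
    obtain ⟨D, hD, hDD⟩ := hu D' hD'
    exact R.mem_core_iff.2 ⟨C, hC, hCC hxC, D, hD, hDD hxD⟩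
  have hE : A' ∩ R'.core ⊆ A ∩ R.core := inter_subset_inter hAA hcore
  have hF : B' ∩ R'.core ⊆ B ∩ R.core := inter_subset_inter hBB hcore
  have hψ' : ∀ x ∈ A' ∩ R'.core, ∀ y ∈ B' ∩ R'.core,
      ∀ D' ∈ R'.fibu, x ∈ D' → ∀ C' ∈ R'.fibs, y ∈ C' → ψ (x, y) ∈ D' ∩ C' := by
    intro x hx y hy D' hD' hxD C' hC' hyC
    obtain ⟨C, hC, hCC⟩ := hs C' hC'
    obtain ⟨D, hD, hDD⟩ := hu D' hD'
    obtain ⟨w, ⟨hwC, hwD⟩, -⟩ := R'.inter_unique C' hC' D' hD'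
    have h1 := hψ x (hE hx) y (hF hy) D hD (hDD hxD) C hC (hCC hyC)
    rw [R.subsingleton_inter hC hD ⟨h1.2, h1.1⟩ ⟨hCC hwC, hDD hwD⟩]
    exact ⟨hwD, hwC⟩
  have himg' : ψ '' ((A' ∩ R'.core) ×ˢ (B' ∩ R'.core)) = R'.core := by
    apply Subset.antisymm
    · rintro _ ⟨⟨x, y⟩, ⟨hx, hy⟩, rfl⟩
      obtain ⟨-, -, -, D', hD', hxD⟩ := R'.mem_core_iff.1 hx.2
      obtain ⟨C', hC', hyC, -⟩ := R'.mem_core_iff.1 hy.2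
      have h1 := hψ' x hx y hy D' hD' hxD C' hC' hyC
      exact R'.mem_core_iff.2 ⟨C', hC', h1.2, D', hD', h1.1⟩
    · intro w hw
      obtain ⟨C', hC', hwC, D', hD', hwD⟩ := R'.mem_core_iff.1 hw
      obtain ⟨x, ⟨hxA, hxD⟩, -⟩ := R'.inter_unique A' hA' D' hD'
      obtain ⟨y, ⟨hyC, hyB⟩, -⟩ := R'.inter_unique C' hC' B' hB'
      have hx : x ∈ A' ∩ R'.core := ⟨hxA, R'.mem_core_iff.2 ⟨A', hA', hxA, D', hD', hxD⟩⟩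
      have hy : y ∈ B' ∩ R'.core := ⟨hyB, R'.mem_core_iff.2 ⟨C', hC', hyC, B', hB', hyB⟩⟩
      have h1 := hψ' x hx y hy D' hD' hxD C' hC' hyC
      exact ⟨(x, y), ⟨hx, hy⟩, R'.subsingleton_inter hC' hD' ⟨h1.2, h1.1⟩ ⟨hwC, hwD⟩⟩
  refine ⟨ψ, hψ', hinj.mono (prod_mono hE hF), himg', hmeas,
    fun G hG => hmeas' G (hG.trans (prod_mono hE hF)), ?_⟩
  have : IsFiniteMeasure ((Ts.ν ℓs).restrict (A ∩ R.core)) :=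
    isFiniteMeasure_restrict.2 ((measure_mono inter_subset_left).trans_lt
      (R.measure_lt_top hA hℓs (hAA hzA) (hAℓ hzA))).ne
  have : IsFiniteMeasure ((Tu.ν ℓu).restrict (B ∩ R.core)) :=
    isFiniteMeasure_restrict.2 ((measure_mono inter_subset_left).trans_lt
      (R.swap.measure_lt_top hB hℓu (hBB hzB) (hBℓ hzB))).ne
  have hpre : (A ∩ R.core) ×ˢ (B ∩ R.core) ∩ ψ ⁻¹' R'.core =
      (A' ∩ R'.core) ×ˢ (B' ∩ R'.core) := by
    have h1 := hinj.preimage_image_inter (prod_mono hE hF)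
    rwa [himg', inter_comm] at h1
  calc _ = Measure.map ψ ((((Ts.ν ℓs).restrict (A ∩ R.core)).restrict (A' ∩ R'.core)).prod
        (((Tu.ν ℓu).restrict (B ∩ R.core)).restrict (B' ∩ R'.core))) := by
        rw [Measure.restrict_restrict_of_subset hE, Measure.restrict_restrict_of_subset hF]
    _ = Measure.map ψ ((((Ts.ν ℓs).restrict (A ∩ R.core)).prod
        ((Tu.ν ℓu).restrict (B ∩ R.core))).restrict (ψ ⁻¹' R'.core)) := by
        rw [Measure.prod_restrict, ← hpre]
        congr 1
        have h1 : ((Ts.ν ℓs).restrict (A ∩ R.core)).prod ((Tu.ν ℓu).restrict (B ∩ R.core)) =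
            (((Ts.ν ℓs).restrict (A ∩ R.core)).prod
              ((Tu.ν ℓu).restrict (B ∩ R.core))).restrict ((A ∩ R.core) ×ˢ (B ∩ R.core)) := by
          rw [← Measure.prod_restrict, Measure.restrict_restrict_of_subset subset_rfl,
            Measure.restrict_restrict_of_subset subset_rfl]
        conv_rhs => rw [h1]
        rw [Measure.restrict_restrict (hmeas R'.measurableSet_core), inter_comm (ψ ⁻¹' _)]
    _ = μ.restrict R'.core := by
        rw [← Measure.restrict_map hmeas R'.measurableSet_core, hmap,
          Measure.restrict_restrict_of_subset hcore]

end Tartan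

namespace Tartan

variable {μ : Measure S} {Ts Tu : MeasuredTurbulation μ}

/-- Families of oriented subarcs of the fibers of a tartan, with measurable disjoint unions and
such that subarcs from different families meet, are the fibers of a tartan. -/
theorem exists_subtartan (R : Tartan Ts Tu) {ords ordu : Set S → S → S → Prop}
    (hsu : ∀ A ∈ R.fibs, ∀ A' ∈ R.fibs, ∀ B ∈ R.fibu, ∀ B' ∈ R.fibu,
      ∀ p ∈ A ∩ B, ∀ q ∈ A ∩ B', ∀ p' ∈ A' ∩ B, ∀ q' ∈ A' ∩ B', (ords A p q ↔ ords A' p' q'))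
    (hus : ∀ B ∈ R.fibu, ∀ B' ∈ R.fibu, ∀ A ∈ R.fibs, ∀ A' ∈ R.fibs,
      ∀ p ∈ B ∩ A, ∀ q ∈ B ∩ A', ∀ p' ∈ B' ∩ A, ∀ q' ∈ B' ∩ A', (ordu B p q ↔ ordu B' p' q'))
    {fibs fibu : Set (Set S)}
    (hs : ∀ A' ∈ fibs, ∃ A ∈ R.fibs, A' ⊆ A ∧ ∃ f a b, IsOrientedArc Ts.lines (ords A) A' f a b)
    (hu : ∀ B' ∈ fibu, ∃ B ∈ R.fibu, B' ⊆ B ∧ ∃ f a b, IsOrientedArc Tu.lines (ordu B) B' f a b)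
    (hds : fibs.PairwiseDisjoint id) (hdu : fibu.PairwiseDisjoint id)
    (hms : MeasurableSet (⋃₀ fibs)) (hmu : MeasurableSet (⋃₀ fibu))
    (hne : ∀ A ∈ fibs, ∀ B ∈ fibu, (A ∩ B).Nonempty) :
    ∃ R' : Tartan Ts Tu, R'.fibs = fibs ∧ R'.fibu = fibu := by
  choose! Φ hΦ hΦs hs using hs
  choose! Θ hΘ hΘs hu using hu
  refine ⟨{
    Rs := ⋃₀ fibs
    Ru := ⋃₀ fibu
    borel_s := hms
    borel_u := hmu
    fibs := fibs
    fibu := fibu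
    fibs_disjoint := hds
    fibu_disjoint := hdu
    fibs_cover := rfl
    fibu_cover := rfl
    inter_unique := fun A hA B hB => ?_
    oriented := ⟨fun A => ords (Φ A), fun B => ordu (Θ B), fun A hA => ?_, fun B hB => ?_, ?_, ?_⟩
    bounded := ?_
    in_disk := ?_ }, rfl, rfl⟩
  · obtain ⟨z, hz⟩ := hne A hA B hB
    exact ⟨z, hz, fun w hw => R.subsingleton_inter (hΦ A hA) (hΘ B hB)
      (inter_subset_inter (hΦs A hA) (hΘs B hB) hw) (inter_subset_inter (hΦs A hA) (hΘs B hB) hz)⟩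
  · obtain ⟨f, a, b, h⟩ := hs A hA
    exact ⟨_, h.range_mem, f, h.continuous, h.injective, rfl, a, b, h.le, h.eq_image, h.ord_iff⟩
  · obtain ⟨f, a, b, h⟩ := hu B hB
    exact ⟨_, h.range_mem, f, h.continuous, h.injective, rfl, a, b, h.le, h.eq_image, h.ord_iff⟩
  · exact fun A hA A' hA' B hB B' hB' p hp q hq p' hp' q' hq' =>
      hsu _ (hΦ A hA) _ (hΦ A' hA') _ (hΘ B hB) _ (hΘ B' hB')
        p (inter_subset_inter (hΦs A hA) (hΘs B hB) hp)
        q (inter_subset_inter (hΦs A hA) (hΘs B' hB') hq)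
        p' (inter_subset_inter (hΦs A' hA') (hΘs B hB) hp')
        q' (inter_subset_inter (hΦs A' hA') (hΘs B' hB') hq')
  · exact fun B hB B' hB' A hA A' hA' p hp q hq p' hp' q' hq' =>
      hus _ (hΘ B hB) _ (hΘ B' hB') _ (hΦ A hA) _ (hΦ A' hA')
        p (inter_subset_inter (hΘs B hB) (hΦs A hA) hp)
        q (inter_subset_inter (hΘs B hB) (hΦs A' hA') hq)
        p' (inter_subset_inter (hΘs B' hB') (hΦs A hA) hp')
        q' (inter_subset_inter (hΘs B' hB') (hΦs A' hA') hq')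
  · obtain ⟨L, hL, hLs, hLu⟩ := R.bounded
    refine ⟨L, hL, fun A hA ℓ hℓ hAℓ => ?_, fun B hB ℓ hℓ hBℓ => ?_⟩
    · obtain ⟨_, _, _, h⟩ := hs A hA
      obtain ⟨x, hx⟩ := h.nonempty
      exact (measure_mono (hΦs A hA)).trans (hLs _ (hΦ A hA) ℓ hℓ
        (R.isArc_of_subset_line (hΦ A hA) hℓ (hΦs A hA hx) (hAℓ hx)).subset)
    · obtain ⟨_, _, _, h⟩ := hu B hB
      obtain ⟨x, hx⟩ := h.nonempty
      exact (measure_mono (hΘs B hB)).trans (hLu _ (hΘ B hB) ℓ hℓ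
        (R.swap.isArc_of_subset_line (hΘ B hB) hℓ (hΘs B hB hx) (hBℓ hx)).subset)
  · obtain ⟨D, hD, hRD, he⟩ := R.in_disk
    refine ⟨D, hD, Subset.trans (union_subset_union ?_ ?_) hRD, he⟩
    · rw [← R.fibs_cover]
      exact sUnion_subset fun A hA => (hΦs A hA).trans (subset_sUnion_of_mem (hΦ A hA))
    · rw [← R.fibu_cover]
      exact sUnion_subset fun B hB => (hΘs B hB).trans (subset_sUnion_of_mem (hΘ B hB))

end Tartan

namespace Tartan

variable {μ : Measure S} {Ts Tu : MeasuredTurbulation μ}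

/-- If the core of a compatible tartan meets an open set `U` in positive measure, then its fibers
have subarcs contained in `U` which form a compatible tartan of positive measure. -/
theorem exists_compatible_subset [T2Space S] [PolishSpace S] [BorelSpace S]
    [IsProbabilityMeasure μ] (R : Tartan Ts Tu) (hR : R.Compatible) (htrans : Ts.TransversePair Tu)
    {U : Set S} (hU : IsOpen U) (hRU : 0 < μ (U ∩ R.core)) :
    ∃ R' : Tartan Ts Tu, R'.Compatible ∧ 0 < μ R'.core ∧ R'.Rs ∪ R'.Ru ⊆ U := by
  obtain ⟨W, hW, hμW, htr⟩ := htrans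
  have hWc : μ Wᶜ = 0 := (prob_compl_eq_zero_iff hW).2 hμW
  obtain ⟨x₀, -, hx₀⟩ := nonempty_of_measure_ne_zero hRU.ne'
  obtain ⟨A₀, hA₀, hxA₀, B₀, hB₀, hxB₀⟩ := R.mem_core_iff.1 hx₀
  obtain ⟨ℓs, hℓs, hA₀s⟩ := R.exists_isArc hA₀
  obtain ⟨ℓu, hℓu, hB₀u⟩ := R.swap.exists_isArc hB₀
  obtain ⟨ψ, hψ, -, -, hmeas, -, hmap⟩ :=
    hR A₀ hA₀ B₀ hB₀ ℓs hℓs hA₀s.subset ℓu hℓu hB₀u.subset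
  obtain ⟨ords, ordu, hs, hu, hsu, hus⟩ := R.oriented
  have hs' : ∀ A ∈ R.fibs, ∃ f a b, IsOrientedArc Ts.lines (ords A) A f a b := fun A hA => by
    obtain ⟨_, hℓ, f, hf, hfi, rfl, a, b, hab, hAf, h⟩ := hs A hA
    exact ⟨f, a, b, hℓ, hf, hfi, hab, hAf, h⟩
  have hu' : ∀ B ∈ R.fibu, ∃ f a b, IsOrientedArc Tu.lines (ordu B) B f a b := fun B hB => by
    obtain ⟨_, hℓ, f, hf, hfi, rfl, a, b, hab, hBf, h⟩ := hu B hB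
    exact ⟨f, a, b, hℓ, hf, hfi, hab, hBf, h⟩
  set E : Set S := A₀ ∩ R.core
  set F : Set S := B₀ ∩ R.core
  have hEm : MeasurableSet E := (R.measurableSet_of_mem_fibs hA₀).inter R.measurableSet_core
  have hFm : MeasurableSet F := (R.swap.measurableSet_of_mem_fibs hB₀).inter R.measurableSet_core
  set m₁ : Measure S := (Ts.ν ℓs).restrict E
  set m₂ : Measure S := (Tu.ν ℓu).restrict F
  have : IsFiniteMeasure m₁ := isFiniteMeasure_restrict.2 ((measure_mono inter_subset_left).trans_lt
    (R.measure_lt_top hA₀ hℓs hxA₀ (hA₀s.subset hxA₀))).ne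
  have : IsFiniteMeasure m₂ := isFiniteMeasure_restrict.2 ((measure_mono inter_subset_left).trans_lt
    (R.swap.measure_lt_top hB₀ hℓu hxB₀ (hB₀u.subset hxB₀))).ne
  have : NullSingletonClass m₁ :=
    ⟨fun x => le_antisymm ((Measure.restrict_apply_le E {x}).trans_eq
      (Ts.ν_nonatomic ℓs hℓs x)) zero_le⟩
  have : NullSingletonClass m₂ :=
    ⟨fun x => le_antisymm ((Measure.restrict_apply_le F {x}).trans_eq
      (Tu.ν_nonatomic ℓu hℓu x)) zero_le⟩
  have hβ : ∀ x ∈ E, ∃ B ∈ R.fibu, x ∈ B := fun x hx => by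
    obtain ⟨-, -, -, h⟩ := R.mem_core_iff.1 hx.2
    exact h
  have hα : ∀ y ∈ F, ∃ A ∈ R.fibs, y ∈ A := fun y hy => by
    obtain ⟨A, hA, hyA, -⟩ := R.mem_core_iff.1 hy.2
    exact ⟨A, hA, hyA⟩
  choose! β hβ using hβ
  choose! α hα using hα
  have hψ' : ∀ x ∈ E, ∀ y ∈ F, ψ (x, y) ∈ β x ∩ α y := fun x hx y hy =>
    hψ x hx y hy _ (hβ x hx).1 (hβ x hx).2 _ (hα y hy).1 (hα y hy).2
  obtain ⟨f, a, b, τ, κ, hf, hκ, hκi, hfib⟩ := exists_isFibering R.fibu_disjoint hu' hus hB₀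
    (inter_subset_left : F ⊆ B₀) (fun B hB => R.subsingleton_inter hA₀ hB)
    (inter_subset_left : E ⊆ A₀) hβ hα (ψ := curry ψ) hψ'
  obtain ⟨g, c, d, τ', κ', hg, hκ', hκi', hgib⟩ := exists_isFibering R.fibs_disjoint hs' hsu hA₀
    (inter_subset_left : E ⊆ A₀) (fun A hA => R.swap.subsingleton_inter hB₀ hA)
    (inter_subset_left : F ⊆ B₀) hα hβ (ψ := fun y x => ψ (x, y))
    fun y hy x hx => (hψ' x hx y hy).symm
  have hinter : ∀ x ∈ E, ∀ y ∈ F, f x '' Icc (a x) (b x) ∩ g y '' Icc (c y) (d y) = {ψ (x, y)} := by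
    intro x hx y hy
    rw [← (hf x hx).eq_image, ← (hg y hy).eq_image]
    have h1 : (β x ∩ α y).Subsingleton := R.swap.subsingleton_inter (hβ x hx).1 (hα y hy).1
    exact h1.eq_singleton_of_mem (hψ' x hx y hy)
  have hchart : ∀ y ∈ F, ∀ p ∈ W ∩ g y '' Icc (c y) (d y),
      ∃ j : ℝ × ℝ → S, IsOpenEmbedding j ∧ j (0, 0) = p ∧ ∀ u, j (u, 0) ∈ range (g y) := by
    rintro y hy p ⟨hpW, hp⟩
    obtain ⟨ℓ, hℓ, ℓ', -, hpℓ, -, h⟩ := htr p hpW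
    obtain rfl := Ts.lines_disjoint.elim_set hℓ (hg y hy).range_mem p hpℓ (image_subset_range _ _ hp)
    exact h.exists_isOpenEmbedding
  have hchart' : ∀ x ∈ E, ∀ p ∈ W ∩ f x '' Icc (a x) (b x),
      ∃ j : ℝ × ℝ → S, IsOpenEmbedding j ∧ j (0, 0) = p ∧ ∀ u, j (u, 0) ∈ range (f x) := by
    rintro x hx p ⟨hpW, hp⟩
    obtain ⟨ℓ, -, ℓ', hℓ', -, hpℓ', h⟩ := htr p hpW
    obtain rfl :=
      Tu.lines_disjoint.elim_set hℓ' (hf x hx).range_mem p hpℓ' (image_subset_range _ _ hp)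
    exact h.symm.exists_isOpenEmbedding
  have hprod : (m₁.prod m₂).restrict (E ×ˢ F) = m₁.prod m₂ := by
    rw [← Measure.prod_restrict, Measure.restrict_restrict_of_subset subset_rfl,
      Measure.restrict_restrict_of_subset subset_rfl]
  have hmapA : ∀ G : Set S, MeasurableSet G → (m₁.prod m₂) (ψ ⁻¹' G) = μ (G ∩ R.core) :=
    fun G hG => by rw [← Measure.map_apply hmeas hG, hmap, Measure.restrict_apply hG]
  obtain ⟨P, hPE, hPm, hP, Q, hQF, hQm, hQ, s, t, hst, hum⟩ :=
    hfib.exists_subfibers m₁ m₂ hEm hFm hmeas hκ hκi (fun y hy => (hg y hy).continuous)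
      (fun y hy => (hg y hy).injective) hinter hW hchart hU (by
        change 0 < (m₁.prod m₂) (E ×ˢ F ∩ ψ ⁻¹' (U ∩ W))
        rw [inter_comm, ← Measure.restrict_apply (hmeas (hU.measurableSet.inter hW)), hprod,
          hmapA _ (hU.measurableSet.inter hW), inter_right_comm,
          measure_inter_conull hWc]
        exact hRU)
  obtain ⟨Q', hQ'Q, hQ'm, hQ', P', hP'P, hP'm, hP', s', t', hst', hsm⟩ :=
    (hgib.mono hQF hPE).exists_subfibers m₂ m₁ hQm hPm (hmeas.comp measurable_swap) hκ'
      (hκi'.mono hPE) (fun x hx => (hf x (hPE hx)).continuous)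
      (fun x hx => (hf x (hPE hx)).injective)
      (fun y hy x hx => inter_comm _ _ ▸ hinter x (hPE hx) y (hQF hy)) hW
      (fun x hx => hchart' x (hPE hx)) hU (by
        have h1 : Q ×ˢ P ∩ (uncurry fun y x => ψ (x, y)) ⁻¹' (U ∩ W) =
            Prod.swap ⁻¹' (P ×ˢ Q ∩ ψ ⁻¹' W) := by
          ext ⟨y, x⟩
          simp only [uncurry, mem_inter_iff, mem_prod, mem_preimage, Prod.swap_prod_mk]
          refine ⟨fun h => ⟨h.1.symm, h.2.2⟩, fun h => ⟨h.1.symm, ?_, h.2⟩⟩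
          obtain ⟨-, -, -, hcU, hψc⟩ := hst x h.1.1
          exact hcU (hψc y h.1.2)
        have h2 : (m₁.prod m₂) (ψ ⁻¹' W)ᶜ = 0 := by
          rw [← preimage_compl, hmapA _ hW.compl]
          exact measure_mono_null inter_subset_left hWc
        rw [h1, Measure.measurePreserving_swap.measure_preimage
          ((hPm.prod hQm).inter (hmeas hW)).nullMeasurableSet,
          measure_inter_conull h2, Measure.prod_prod]
        exact ENNReal.mul_pos hP.ne' hQ.ne')
  have hP'E := hP'P.trans hPE
  have hQ'F := hQ'Q.trans hQF
  have hcβ : ∀ x ∈ P', f x '' Icc (s x) (t x) ⊆ β x := fun x hx => by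
    rw [(hf x (hP'E hx)).eq_image]
    obtain ⟨h1, -, h2, -⟩ := hst x (hP'P hx)
    exact image_mono (Icc_subset_Icc h1 h2)
  have hcα : ∀ y ∈ Q', g y '' Icc (s' y) (t' y) ⊆ α y := fun y hy => by
    rw [(hg y (hQ'F hy)).eq_image]
    obtain ⟨h1, -, h2, -⟩ := hst' y hy
    exact image_mono (Icc_subset_Icc h1 h2)
  have hψc : ∀ x ∈ P', ∀ y ∈ Q', ψ (x, y) ∈ g y '' Icc (s' y) (t' y) ∩ f x '' Icc (s x) (t x) :=
    fun x hx y hy => ⟨(hst' y hy).2.2.2.2 x hx, (hst x (hP'P hx)).2.2.2.2 y (hQ'Q hy)⟩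
  obtain ⟨R', hR's, hR'u⟩ := R.exists_subtartan hsu hus
    (fibs := (fun y => g y '' Icc (s' y) (t' y)) '' Q')
    (fibu := (fun x => f x '' Icc (s x) (t x)) '' P')
    (forall_mem_image.2 fun y hy => ⟨α y, (hα y (hQ'F hy)).1, hcα y hy, g y, s' y, t' y,
      (hg y (hQ'F hy)).restrict (hst' y hy).1 (hst' y hy).2.1 (hst' y hy).2.2.1⟩)
    (forall_mem_image.2 fun x hx => ⟨β x, (hβ x (hP'E hx)).1, hcβ x hx, f x, s x, t x,
      (hf x (hP'E hx)).restrict (hst x (hP'P hx)).1 (hst x (hP'P hx)).2.1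
        (hst x (hP'P hx)).2.2.1⟩)
    (by
      rintro _ ⟨y, hy, rfl⟩ _ ⟨y', hy', rfl⟩ hne
      refine (hgib.disjoint (hQ'F hy) (hQ'F hy') fun h => hne (h ▸ rfl)).mono ?_ ?_
      · exact (hcα y hy).trans_eq (hg y (hQ'F hy)).eq_image
      · exact (hcα y' hy').trans_eq (hg y' (hQ'F hy')).eq_image)
    (by
      rintro _ ⟨x, hx, rfl⟩ _ ⟨x', hx', rfl⟩ hne
      refine (hfib.disjoint (hP'E hx) (hP'E hx') fun h => hne (h ▸ rfl)).mono ?_ ?_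
      · exact (hcβ x hx).trans_eq (hf x (hP'E hx)).eq_image
      · exact (hcβ x' hx').trans_eq (hf x' (hP'E hx')).eq_image)
    (by simpa only [sUnion_image] using hsm Q' subset_rfl hQ'm)
    (by simpa only [sUnion_image] using hum P' hP'P hP'm)
    (forall_mem_image.2 fun y hy => forall_mem_image.2 fun x hx => ⟨_, hψc x hx y hy⟩)
  refine ⟨R', hR.mono ?_ ?_, ?_, union_subset ?_ ?_⟩
  · rw [hR's]
    exact forall_mem_image.2 fun y hy => ⟨α y, (hα y (hQ'F hy)).1, hcα y hy⟩
  · rw [hR'u]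
    exact forall_mem_image.2 fun x hx => ⟨β x, (hβ x (hP'E hx)).1, hcβ x hx⟩
  · calc 0 < m₁ P' * m₂ Q' := ENNReal.mul_pos hP'.ne' hQ'.ne'
      _ = (m₁.prod m₂) (P' ×ˢ Q') := (Measure.prod_prod _ _).symm
      _ ≤ (m₁.prod m₂) (ψ ⁻¹' R'.core) := measure_mono fun ⟨x, y⟩ ⟨hx, hy⟩ =>
        R'.mem_core_iff.2 ⟨_, hR's ▸ mem_image_of_mem _ hy, (hψc x hx y hy).1, _,
          hR'u ▸ mem_image_of_mem _ hx, (hψc x hx y hy).2⟩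
      _ ≤ μ R'.core := (hmapA _ R'.measurableSet_core).trans_le (measure_mono inter_subset_left)
  · rw [← R'.fibs_cover, hR's, sUnion_image]
    exact iUnion₂_subset fun y hy => (hst' y hy).2.2.2.1
  · rw [← R'.fibu_cover, hR'u, sUnion_image]
    exact iUnion₂_subset fun x hx => (hst x (hP'P hx)).2.2.2.1

end Tartan

/-- if a countable family of stable bi-Lipschitz regular compatible tartans
covers a full measure subset of `S`, then every non-empty open set contains a positive
measure compatible tartan; hence the pair of turbulations is full. -/
theorem full_of_biLipschitz_regular_tartans
    {S : Type} [TopologicalSpace S] [T2Space S] [CompactSpace S]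
    [ChartedSpace (EuclideanHalfSpace 2) S] [MeasurableSpace S] [BorelSpace S]
    (μ : Measure S) [IsProbabilityMeasure μ] (hμ : IsOUMeasure μ)
    (Ts Tu : MeasuredTurbulation μ) (htrans : Ts.TransversePair Tu)
    (Rseq : ℕ → Tartan Ts Tu)
    (hcomp : ∀ i, (Rseq i).Compatible)
    (hreg : ∀ i, (Rseq i).StableBiLipschitzRegular)
    (hcover : μ (⋃ i, (Rseq i).core) = 1) :
    (∀ U : Set S, IsOpen U → U.Nonempty →
      ∃ R : Tartan Ts Tu, R.Compatible ∧ 0 < μ R.core ∧ R.Rs ∪ R.Ru ⊆ U) ∧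
    FullPair Ts Tu := by
  have hpos : ∀ U : Set S, IsOpen U → U.Nonempty →
      ∃ R : Tartan Ts Tu, R.Compatible ∧ 0 < μ R.core ∧ R.Rs ∪ R.Ru ⊆ U := by
    intro U hU hne
    have : SecondCountableTopology (EuclideanHalfSpace 2) :=
      inferInstanceAs (SecondCountableTopology {x : EuclideanSpace ℝ (Fin 2) // 0 ≤ x 0})
    have := ChartedSpace.secondCountable_of_sigmaCompact (EuclideanHalfSpace 2) S
    have : PolishSpace S := by
      let := TopologicalSpace.metrizableSpaceMetric S
      infer_instance
    have hc : μ (⋃ i, (Rseq i).core)ᶜ = 0 :=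
      (prob_compl_eq_zero_iff (MeasurableSet.iUnion fun i => (Rseq i).measurableSet_core)).2 hcover
    have hU' : 0 < μ (⋃ i, U ∩ (Rseq i).core) := by
      rw [← inter_iUnion, measure_inter_conull hc]
      exact hμ.openPos U hU hne
    obtain ⟨i, hi⟩ := exists_measure_pos_of_not_measure_iUnion_null hU'.ne'
    exact (Rseq i).exists_compatible_subset (hcomp i) htrans hU hi
  exact ⟨hpos, ⟨Rseq, hcomp, hcover⟩, hpos⟩

end
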